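/- Measure shrinking lemma (Lemma 3.5). Let α ∈ (0,1] and let v be a local weak supersolution of the homogeneous equation ∂_t v − div(𝒜(t,x,Dv)) + ℒv = 0 in Ω_T. For every R > 0 and (t₀,x₀) with I_{2R}^⊖(t₀) × B_{2R}(x₀) compactly contained in I × Ω, and any δ, σ ∈ (0,1], q ∈ (1,2], H > 0, suppose v ≥ 0 a.e. in Q_{2R}(t₀,x₀) and |{x ∈ B_R(x₀) : v(t,x) ≥ H}| ≥ α |B_R(x₀)| for almost every t ∈ I_{δR}^⊖(t₀). Then there exists C > 0 depending only on d, s, Λ, q such that either (⨍_{I_{2R}^⊖(t₀)} Tail(v₋(t); x₀, 2R)^q dt)^{1/q} > σH, or |{(t,x) ∈ I_{δR}^⊖(t₀) × B_R(x₀) : v(t,x) ≤ σH/4}| ≤ (C / (α δ (log₂(2/σ))^{1/2})) |I_{δR}^⊖(t₀) × B_R(x₀)|. Here v₋ = max{−v, 0} and |·| denotes Lebesgue measure. -/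

import Mathlib

open MeasureTheory Set Filter Metric
open scoped ENNReal NNReal Topology RealInnerProductSpace

noncomputable section

/-- Euclidean space `ℝ^d`. -/
abbrev Ed (d : ℕ) : Type := EuclideanSpace ℝ (Fin d)

variable {d : ℕ}

/-- Backward time interval `I_r^⊖(t₀) = (t₀ - r², t₀)`. -/
def Iminus (t₀ r : ℝ) : Set ℝ := Set.Ioo (t₀ - r ^ 2) t₀

/-- Parabolic cylinder `Q_r(t₀,x₀) = I_r^⊖(t₀) × B_r(x₀)`. -/
def pCyl (t₀ : ℝ) (x₀ : Ed d) (r : ℝ) : Set (ℝ × Ed d) :=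
  (Iminus t₀ r) ×ˢ (Metric.ball x₀ r)

/-- Nonlocal tail `Tail(v; x₀, R) = R² ∫_{ℝ^d ∖ B_R(x₀)} |v(y)| |x₀ - y|^{-d-2s} dy`. -/
def Tail (s : ℝ) (v : Ed d → ℝ) (x₀ : Ed d) (R : ℝ) : ℝ :=
  R ^ 2 * ∫ y in (Metric.ball x₀ R)ᶜ, |v y| / ‖x₀ - y‖ ^ ((d : ℝ) + 2 * s)

/-- Caloric Riesz potential `ℐ^ν_α(t₀,x₀;R) = ∫₀^R ν(Q_ρ(t₀,x₀)) ρ^{-(d+2-α)} dρ/ρ`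
for a nonnegative measure `ν`. -/
def RieszPot (ν : Measure (ℝ × Ed d)) (α : ℝ) (t₀ : ℝ) (x₀ : Ed d) (R : ℝ) : ℝ :=
  ∫ ρ in Set.Ioo (0 : ℝ) R, (ν (pCyl t₀ x₀ ρ)).toReal / ρ ^ ((d : ℝ) + 2 - α) / ρ

/-- The structure conditions (1.2)-(1.3) on the vector field `𝒜`. -/
structure VectorFieldHyp (d : ℕ) (Λ : ℝ) (A : ℝ → Ed d → Ed d → Ed d) : Prop where
  meas : ∀ ξ : Ed d, Measurable fun p : ℝ × Ed d => A p.1 p.2 ξ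
  cont : ∀ t x, Continuous (A t x)
  growth : ∀ t x ξ, ‖A t x ξ‖ ≤ Λ * ‖ξ‖
  monotone : ∀ t x ξ η, Λ⁻¹ * ‖η - ξ‖ ^ 2 ≤ ⟪A t x η - A t x ξ, η - ξ⟫

/-- The ellipticity and symmetry conditions on the jump kernel `K`. -/
structure KernelHyp (d : ℕ) (s Λ : ℝ) (K : ℝ → Ed d → Ed d → ℝ) : Prop where
  meas : Measurable fun p : ℝ × Ed d × Ed d => K p.1 p.2.1 p.2.2
  symm : ∀ t x y, K t x y = K t y x
  lower : ∀ t x y, x ≠ y → Λ⁻¹ / ‖x - y‖ ^ ((d : ℝ) + 2 * s) ≤ K t x y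
  upper : ∀ t x y, x ≠ y → K t x y ≤ Λ / ‖x - y‖ ^ ((d : ℝ) + 2 * s)

/-- Membership of `v` (with weak spatial gradient `Dv`) in the function space
`L²_loc(J; W^{1,2}_loc(Ω)) ∩ L^∞_loc(J; L²_loc(Ω)) ∩ L²_loc(J; 𝓛¹_{2s}(ℝ^d))`. -/
structure LocalWeakReg (d : ℕ) (s : ℝ) (J : Set ℝ) (Ω : Set (Ed d))
    (v : ℝ → Ed d → ℝ) (Dv : ℝ → Ed d → Ed d) : Prop where
  meas : Measurable (Function.uncurry v)
  measD : Measurable (Function.uncurry Dv)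
  grad : ∀ t ∈ J, ∀ φ : Ed d → ℝ, ContDiff ℝ (⊤ : ℕ∞) φ → HasCompactSupport φ →
    tsupport φ ⊆ Ω → ∀ e : Ed d,
      ∫ x, v t x * (fderiv ℝ φ x) e = - ∫ x, φ x * ⟪Dv t x, e⟫
  l2w12 : ∀ t₁ t₂ : ℝ, Set.Icc t₁ t₂ ⊆ J → ∀ Kc : Set (Ed d), IsCompact Kc → Kc ⊆ Ω →
    MeasureTheory.IntegrableOn
      (fun p : ℝ × Ed d => (v p.1 p.2) ^ 2 + ‖Dv p.1 p.2‖ ^ 2) ((Set.Ioo t₁ t₂) ×ˢ Kc)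
  linfl2 : ∀ t₁ t₂ : ℝ, Set.Icc t₁ t₂ ⊆ J → ∀ Kc : Set (Ed d), IsCompact Kc → Kc ⊆ Ω →
    ∃ M : ℝ, ∀ᵐ t ∂(volume.restrict (Set.Ioo t₁ t₂)), (∫ x in Kc, (v t x) ^ 2) ≤ M
  tail_ae : ∀ᵐ t : ℝ, t ∈ J →
    MeasureTheory.Integrable fun y : Ed d => |v t y| / (1 + ‖y‖ ^ ((d : ℝ) + 2 * s))
  tail_l2 : ∀ t₁ t₂ : ℝ, Set.Icc t₁ t₂ ⊆ J →
    MeasureTheory.IntegrableOn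
      (fun t => (∫ y : Ed d, |v t y| / (1 + ‖y‖ ^ ((d : ℝ) + 2 * s))) ^ 2) (Set.Ioo t₁ t₂)

/-- Smooth test functions with compact spatial support contained in `Ω`. -/
def IsTestFunction (Ω : Set (Ed d)) (φ : ℝ → Ed d → ℝ) : Prop :=
  ContDiff ℝ (⊤ : ℕ∞) (Function.uncurry φ) ∧
    ∃ Kc : Set (Ed d), IsCompact Kc ∧ Kc ⊆ Ω ∧ ∀ t, tsupport (φ t) ⊆ Kc

/-- The left-hand side of the weak formulation of
`∂_t u - div(𝒜(t,x,Du)) + ℒu` tested against `φ` on `(t₁,t₂] × Ω`. -/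
def mixedLHS (A : ℝ → Ed d → Ed d → Ed d) (K : ℝ → Ed d → Ed d → ℝ)
    (Ω : Set (Ed d)) (u : ℝ → Ed d → ℝ) (Du : ℝ → Ed d → Ed d)
    (φ : ℝ → Ed d → ℝ) (t₁ t₂ : ℝ) : ℝ :=
  -(∫ t in Set.Ioc t₁ t₂, ∫ x in Ω, u t x * deriv (fun τ => φ τ x) t)
    + (∫ x in Ω, u t₂ x * φ t₂ x) - (∫ x in Ω, u t₁ x * φ t₁ x)
    + (∫ t in Set.Ioc t₁ t₂, ∫ x in Ω, ⟪A t x (Du t x), gradient (φ t) x⟫)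
    + ∫ t in Set.Ioc t₁ t₂, ∫ x : Ed d, ∫ y : Ed d,
        (u t x - u t y) * (φ t x - φ t y) * K t x y

/-- Integral of a function against a finite signed measure. -/
def signedIntegral (μ : MeasureTheory.SignedMeasure (ℝ × Ed d)) (f : ℝ × Ed d → ℝ) : ℝ :=
  (∫ p, f p ∂μ.toJordanDecomposition.posPart)
    - ∫ p, f p ∂μ.toJordanDecomposition.negPart

/-- Local weak solution of `∂_t u - div(𝒜(t,x,Du)) + ℒu = μ` in `J × Ω`. -/
def IsLocalWeakSolution (A : ℝ → Ed d → Ed d → Ed d) (K : ℝ → Ed d → Ed d → ℝ)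
    (J : Set ℝ) (Ω : Set (Ed d)) (μ : MeasureTheory.SignedMeasure (ℝ × Ed d))
    (u : ℝ → Ed d → ℝ) (Du : ℝ → Ed d → Ed d) : Prop :=
  ∀ t₁ t₂ : ℝ, t₁ ≤ t₂ → Set.Icc t₁ t₂ ⊆ J →
    ∀ φ : ℝ → Ed d → ℝ, IsTestFunction Ω φ →
      mixedLHS A K Ω u Du φ t₁ t₂ =
        signedIntegral μ (Set.indicator ((Set.Ioc t₁ t₂) ×ˢ Ω) fun p => φ p.1 p.2)

/-- Local weak solution of the homogeneous equation
`∂_t v - div(𝒜(t,x,Dv)) + ℒv = 0` in `J × Ω`. -/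
def IsLocalWeakSolutionHom (A : ℝ → Ed d → Ed d → Ed d) (K : ℝ → Ed d → Ed d → ℝ)
    (J : Set ℝ) (Ω : Set (Ed d))
    (v : ℝ → Ed d → ℝ) (Dv : ℝ → Ed d → Ed d) : Prop :=
  ∀ t₁ t₂ : ℝ, t₁ ≤ t₂ → Set.Icc t₁ t₂ ⊆ J →
    ∀ φ : ℝ → Ed d → ℝ, IsTestFunction Ω φ → mixedLHS A K Ω v Dv φ t₁ t₂ = 0

/-- Local weak subsolution of the homogeneous equation in `J × Ω`. -/
def IsLocalWeakSubsolutionHom (A : ℝ → Ed d → Ed d → Ed d) (K : ℝ → Ed d → Ed d → ℝ)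
    (J : Set ℝ) (Ω : Set (Ed d))
    (v : ℝ → Ed d → ℝ) (Dv : ℝ → Ed d → Ed d) : Prop :=
  ∀ t₁ t₂ : ℝ, t₁ ≤ t₂ → Set.Icc t₁ t₂ ⊆ J →
    ∀ φ : ℝ → Ed d → ℝ, IsTestFunction Ω φ → (∀ t x, 0 ≤ φ t x) →
      mixedLHS A K Ω v Dv φ t₁ t₂ ≤ 0

/-- Local weak supersolution of the homogeneous equation in `J × Ω`. -/
def IsLocalWeakSupersolutionHom (A : ℝ → Ed d → Ed d → Ed d) (K : ℝ → Ed d → Ed d → ℝ)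
    (J : Set ℝ) (Ω : Set (Ed d))
    (v : ℝ → Ed d → ℝ) (Dv : ℝ → Ed d → Ed d) : Prop :=
  ∀ t₁ t₂ : ℝ, t₁ ≤ t₂ → Set.Icc t₁ t₂ ⊆ J →
    ∀ φ : ℝ → Ed d → ℝ, IsTestFunction Ω φ → (∀ t x, φ t x ≤ 0) →
      mixedLHS A K Ω v Dv φ t₁ t₂ ≤ 0

/-- The global excess functional `E(u,t₀,x₀,R)`. -/
def Excess (s q : ℝ) (u : ℝ → Ed d → ℝ) (t₀ : ℝ) (x₀ : Ed d) (R : ℝ) : ℝ :=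
  (⨍ t in Iminus t₀ R, (⨍ x in Metric.ball x₀ R,
      |u t x - ⨍ p in pCyl t₀ x₀ R, u p.1 p.2|) ^ q) ^ (1 / q)
  + (⨍ t in Iminus t₀ R,
      (Tail s (fun y => u t y - ⨍ p in pCyl t₀ x₀ R, u p.1 p.2) x₀ R) ^ q) ^ (1 / q)

set_option linter.unusedSectionVars false

section Mollification

variable {X : Type*} [NormedAddCommGroup X] [NormedSpace ℝ X] [FiniteDimensional ℝ X]
  [MeasureSpace X] [BorelSpace X] [(volume : Measure X).IsAddHaarMeasure]
  {F : Type*} [NormedAddCommGroup F] [NormedSpace ℝ F]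

/-- The bump function of outer radius `1 / (n + 1)` centred at the origin. -/
def bumpSeq (X : Type*) [NormedAddCommGroup X] (n : ℕ) : ContDiffBump (0 : X) where
  rIn := 1 / (2 * ((n : ℝ) + 1))
  rOut := 1 / ((n : ℝ) + 1)
  rIn_pos := by positivity
  rIn_lt_rOut := by
    apply one_div_lt_one_div_of_lt <;> linarith [(Nat.cast_nonneg n : (0 : ℝ) ≤ n)]

/-- The standard mollifying kernels. -/
def rho (n : ℕ) : X → ℝ := (bumpSeq X n).normed volume

/-- Mollification of `f` at scale `1 / (n + 1)`. -/
def mol (n : ℕ) (f : X → F) : X → F :=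
  convolution (rho n) f (ContinuousLinearMap.lsmul ℝ ℝ) volume

lemma mol_apply (n : ℕ) (f : X → F) (p : X) : mol n f p = ∫ q, rho n q • f (p - q) := rfl

lemma mol_apply' (n : ℕ) (f : X → F) (p : X) : mol n f p = ∫ q, rho n (p - q) • f q := by
  rw [mol, convolution_eq_swap]; rfl

lemma rho_nonneg (n : ℕ) (q : X) : 0 ≤ rho n q := ContDiffBump.nonneg_normed _ q

lemma rho_neg (n : ℕ) (q : X) : rho n (-q) = rho n q := ContDiffBump.normed_neg _ q

lemma contDiff_rho (n : ℕ) : ContDiff ℝ (⊤ : ℕ∞) (rho n : X → ℝ) := ContDiffBump.contDiff_normed _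

lemma continuous_rho (n : ℕ) : Continuous (rho n : X → ℝ) := (contDiff_rho n).continuous

lemma hasCompactSupport_rho (n : ℕ) : HasCompactSupport (rho n : X → ℝ) :=
  ContDiffBump.hasCompactSupport_normed _

lemma integrable_rho (n : ℕ) : Integrable (rho n : X → ℝ) := ContDiffBump.integrable_normed _

lemma integral_rho (n : ℕ) : ∫ q : X, rho n q = 1 := ContDiffBump.integral_normed _

lemma rho_eq_zero {n : ℕ} {q : X} (h : 1 / ((n : ℝ) + 1) ≤ ‖q‖) : rho n q = 0 := by
  have : q ∉ Function.support (rho n : X → ℝ) := by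
    rw [rho, ContDiffBump.support_normed_eq, mem_ball_zero_iff]; exact not_lt.2 h
  simpa using this

lemma lintegral_rho (n : ℕ) : ∫⁻ q : X, ENNReal.ofReal (rho n q) = 1 := by
  rw [← ofReal_integral_eq_lintegral_ofReal (integrable_rho n) (ae_of_all _ (rho_nonneg n)),
    integral_rho, ENNReal.ofReal_one]

/-- The probability measure with density `rho n`. -/
def rhoMeasure (n : ℕ) : Measure X := volume.withDensity fun q => ENNReal.ofReal (rho n q)

lemma isProbabilityMeasure_rhoMeasure (n : ℕ) : IsProbabilityMeasure (rhoMeasure n : Measure X) :=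
  ⟨by rw [rhoMeasure, withDensity_apply _ MeasurableSet.univ, setLIntegral_univ, lintegral_rho]⟩

lemma measurable_ofReal_rho (n : ℕ) : Measurable fun q : X => ENNReal.ofReal (rho n q) :=
  (continuous_rho n).measurable.ennreal_ofReal

lemma sq_lintegral_le_of_isProbabilityMeasure {α : Type*} [MeasurableSpace α] (μ : Measure α)
    [IsProbabilityMeasure μ] {f : α → ℝ≥0∞} (hf : AEMeasurable f μ) :
    (∫⁻ a, f a ∂μ) ^ 2 ≤ ∫⁻ a, f a ^ 2 ∂μ := by
  have h := ENNReal.lintegral_mul_le_Lp_mul_Lq μ (Real.HolderConjugate.two_two) hf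
    (aemeasurable_const (b := (1 : ℝ≥0∞)))
  simp only [Pi.mul_apply, mul_one, ENNReal.one_rpow, lintegral_const, measure_univ] at h
  calc (∫⁻ a, f a ∂μ) ^ 2 ≤ ((∫⁻ a, f a ^ (2 : ℝ) ∂μ) ^ (1 / (2 : ℝ))) ^ 2 := by gcongr
    _ = ∫⁻ a, f a ^ 2 ∂μ := by
      rw [← ENNReal.rpow_natCast, ← ENNReal.rpow_mul]; norm_num

lemma enorm_mol_sq_le (n : ℕ) {f : X → F} (hf : AEStronglyMeasurable f) (p : X) :
    ‖mol n f p‖ₑ ^ 2 ≤ ∫⁻ q, ENNReal.ofReal (rho n q) * ‖f (p - q)‖ₑ ^ 2 := by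
  have hm : AEMeasurable (fun q => ‖f (p - q)‖ₑ) volume :=
    (hf.comp_quasiMeasurePreserving
      (quasiMeasurePreserving_sub_left volume p)).enorm
  have hac : (rhoMeasure n : Measure X) ≪ volume := withDensity_absolutelyContinuous _ _
  have := isProbabilityMeasure_rhoMeasure (X := X) n
  calc ‖mol n f p‖ₑ ^ 2 ≤ (∫⁻ q, ENNReal.ofReal (rho n q) * ‖f (p - q)‖ₑ) ^ 2 := by
        gcongr
        rw [mol_apply]
        refine (enorm_integral_le_lintegral_enorm _).trans_eq (lintegral_congr fun q => ?_)
        rw [enorm_smul, Real.enorm_of_nonneg (rho_nonneg n q)]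
    _ = (∫⁻ q, ‖f (p - q)‖ₑ ∂(rhoMeasure n)) ^ 2 := by
        rw [rhoMeasure, lintegral_withDensity_eq_lintegral_mul₀
          (measurable_ofReal_rho n).aemeasurable hm]; rfl
    _ ≤ ∫⁻ q, ‖f (p - q)‖ₑ ^ 2 ∂(rhoMeasure n) :=
        sq_lintegral_le_of_isProbabilityMeasure _ (hm.mono_ac hac)
    _ = _ := by
        rw [rhoMeasure, lintegral_withDensity_eq_lintegral_mul₀
          (measurable_ofReal_rho n).aemeasurable (hm.pow_const 2)]; rfl

lemma lintegral_mol_sq_le (n : ℕ) {f : X → F} (hf : AEStronglyMeasurable f) :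
    ∫⁻ p, ‖mol n f p‖ₑ ^ 2 ≤ ∫⁻ p, ‖f p‖ₑ ^ 2 := by
  calc ∫⁻ p, ‖mol n f p‖ₑ ^ 2
      ≤ ∫⁻ p, ∫⁻ q, ENNReal.ofReal (rho n q) * ‖f (p - q)‖ₑ ^ 2 :=
        lintegral_mono fun p => enorm_mol_sq_le n hf p
    _ = ∫⁻ q, ∫⁻ p, ENNReal.ofReal (rho n q) * ‖f (p - q)‖ₑ ^ 2 := by
        refine lintegral_lintegral_swap ?_
        refine AEMeasurable.mul ((measurable_ofReal_rho n).comp measurable_snd).aemeasurable ?_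
        exact ((hf.comp_quasiMeasurePreserving
          (quasiMeasurePreserving_sub volume volume)).enorm).pow_const 2
    _ = ∫⁻ q, ENNReal.ofReal (rho n q) * ∫⁻ p, ‖f p‖ₑ ^ 2 := by
        refine lintegral_congr fun q => ?_
        rw [lintegral_const_mul' _ _ ENNReal.ofReal_ne_top,
          lintegral_sub_right_eq_self (fun p => ‖f p‖ₑ ^ 2) q]
    _ = ∫⁻ p, ‖f p‖ₑ ^ 2 := by
        rw [lintegral_mul_const _ (measurable_ofReal_rho n), lintegral_rho, one_mul]

lemma mol_eq_zero {n : ℕ} {f : X → F} {p : X}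
    (h : ∀ q, ‖p - q‖ < 1 / ((n : ℝ) + 1) → f q = 0) : mol n f p = 0 := by
  rw [mol_apply']
  refine integral_eq_zero_of_ae (ae_of_all _ fun q => ?_)
  rcases lt_or_ge ‖p - q‖ (1 / ((n : ℝ) + 1)) with hq | hq
  · simp [h q hq]
  · simp [rho_eq_zero hq]

lemma integrable_rho_smul (n : ℕ) {f : X → F} (hf : LocallyIntegrable f) (p : X) :
    Integrable fun q => rho n (p - q) • f q := by
  refine hf.integrable_smul_left_of_hasCompactSupport ((continuous_rho n).comp (by fun_prop)) ?_
  exact (hasCompactSupport_rho n).comp_homeomorph (Homeomorph.subLeft p)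

lemma contDiff_mol (n : ℕ) {f : X → F} (hf : LocallyIntegrable f) :
    ContDiff ℝ (⊤ : ℕ∞) (mol n f) :=
  (hasCompactSupport_rho n).contDiff_convolution_left _ (contDiff_rho n) hf

lemma mol_nonneg (n : ℕ) {f : X → ℝ} (hf : ∀ᵐ p, 0 ≤ f p) (p : X) : 0 ≤ mol n f p := by
  rw [mol_apply']
  exact integral_nonneg_of_ae (hf.mono fun q hq => mul_nonneg (rho_nonneg n _) hq)

lemma norm_mol_le (n : ℕ) {f : X → F} {M : ℝ} (hf : ∀ p, ‖f p‖ ≤ M) (p : X) :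
    ‖mol n f p‖ ≤ M := by
  rw [mol_apply]
  calc ‖∫ q, rho n q • f (p - q)‖ ≤ ∫ q, rho n q * M := by
        refine norm_integral_le_of_norm_le ((integrable_rho n).mul_const M) (ae_of_all _ fun q => ?_)
        rw [norm_smul, Real.norm_of_nonneg (rho_nonneg n q)]
        exact mul_le_mul_of_nonneg_left (hf _) (rho_nonneg n q)
    _ = M := by rw [integral_mul_const, integral_rho, one_mul]

lemma mol_sub (n : ℕ) {f g : X → F} (hf : LocallyIntegrable f) (hg : LocallyIntegrable g) (p : X) :
    mol n (fun q => f q - g q) p = mol n f p - mol n g p := by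
  simp only [mol_apply', smul_sub]
  exact integral_sub (integrable_rho_smul n hf p) (integrable_rho_smul n hg p)

variable [CompleteSpace F]

lemma tendsto_mol_ae {f : X → F} (hf : LocallyIntegrable f) :
    ∀ᵐ p, Tendsto (fun n => mol n f p) atTop (𝓝 (f p)) := by
  refine ContDiffBump.ae_convolution_tendsto_right_of_locallyIntegrable (K := 2)
    (φ := fun n => bumpSeq X n) ?_ (Eventually.of_forall fun n => ?_) hf
  · exact tendsto_one_div_add_atTop_nhds_zero_nat
  · simp only [bumpSeq]; rw [one_div, one_div, mul_inv]; linarith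

lemma enorm_add_sq_le (a b : F) : ‖a + b‖ₑ ^ 2 ≤ 2 * ‖a‖ₑ ^ 2 + 2 * ‖b‖ₑ ^ 2 := by
  simp only [← ofReal_norm]
  rw [← ENNReal.ofReal_pow (norm_nonneg _), ← ENNReal.ofReal_pow (norm_nonneg _),
    ← ENNReal.ofReal_pow (norm_nonneg _), ← ENNReal.ofReal_ofNat, ← ENNReal.ofReal_mul (by norm_num),
    ← ENNReal.ofReal_mul (by norm_num), ← ENNReal.ofReal_add (by positivity) (by positivity)]
  refine ENNReal.ofReal_le_ofReal ?_
  nlinarith [norm_add_le a b, sq_nonneg (‖a‖ - ‖b‖), norm_nonneg (a + b), norm_nonneg a,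
    norm_nonneg b]

end Mollification

lemma eLpNorm_two_sq {α F : Type*} [MeasurableSpace α] [NormedAddCommGroup F] (μ : Measure α)
    (f : α → F) : eLpNorm f 2 μ ^ 2 = ∫⁻ a, ‖f a‖ₑ ^ 2 ∂μ := by
  simpa using eLpNorm_nnreal_pow_eq_lintegral (f := f) (μ := μ) (p := 2) (by norm_num)

lemma memLp_two_iff {α F : Type*} [MeasurableSpace α] [NormedAddCommGroup F] {μ : Measure α}
    {f : α → F} (hf : AEStronglyMeasurable f μ) :
    MemLp f 2 μ ↔ ∫⁻ a, ‖f a‖ₑ ^ 2 ∂μ < ∞ := by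
  rw [← eLpNorm_two_sq, MemLp, and_iff_right hf]
  simp

section MollificationLimits

variable {X : Type*} [NormedAddCommGroup X] [NormedSpace ℝ X] [FiniteDimensional ℝ X]
  [MeasureSpace X] [BorelSpace X] [(volume : Measure X).IsAddHaarMeasure]
  {F : Type*} [NormedAddCommGroup F] [NormedSpace ℝ F] [CompleteSpace F]

lemma tendsto_mol_L2_of_continuous {g : X → F} (hg : Continuous g) (hc : HasCompactSupport g) :
    Tendsto (fun n => ∫⁻ p, ‖mol n g p - g p‖ₑ ^ 2) atTop (𝓝 0) := by
  obtain ⟨M, hM⟩ := hg.bounded_above_of_compact_support hc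
  have hK : IsCompact (cthickening 1 (tsupport g)) := hc.cthickening
  have hloc : LocallyIntegrable g := hg.locallyIntegrable
  have key : Tendsto (fun n => ∫⁻ p, ‖mol n g p - g p‖ₑ ^ 2) atTop
      (𝓝 (∫⁻ _ : X, (0 : ℝ≥0∞))) := by
    refine tendsto_lintegral_of_dominated_convergence
      ((cthickening 1 (tsupport g)).indicator fun _ => ENNReal.ofReal (2 * M) ^ 2) ?_ ?_ ?_ ?_
    · intro n
      exact (((contDiff_mol n hloc).continuous.sub hg).enorm.measurable).pow_const 2
    · intro n
      refine ae_of_all _ fun p => ?_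
      by_cases hp : p ∈ cthickening 1 (tsupport g)
      · simp only [indicator_of_mem hp]
        gcongr
        rw [← ofReal_norm]
        refine ENNReal.ofReal_le_ofReal ?_
        linarith [norm_sub_le (mol n g p) (g p), norm_mol_le n hM p, hM p]
      · have h0 : ∀ q, ‖p - q‖ < 1 / ((n : ℝ) + 1) → g q = 0 := by
          intro q hq
          by_contra h
          apply hp
          have hq1 : q ∈ tsupport g := subset_tsupport g h
          refine mem_cthickening_of_dist_le p q 1 _ hq1 ?_
          rw [dist_eq_norm]
          refine hq.le.trans ?_
          rw [div_le_one (by positivity)]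
          linarith [(Nat.cast_nonneg n : (0 : ℝ) ≤ n)]
        have h1 : g p = 0 := h0 p (by simpa using by positivity)
        simp [mol_eq_zero h0, h1]
    · rw [lintegral_indicator isClosed_cthickening.measurableSet, setLIntegral_const]
      exact ENNReal.mul_ne_top (ENNReal.pow_ne_top ENNReal.ofReal_ne_top) hK.measure_lt_top.ne
    · refine ae_of_all _ fun p => ?_
      have h1 : Tendsto (fun n => mol n g p) atTop (𝓝 (g p)) := by
        refine ContDiffBump.convolution_tendsto_right_of_continuous (φ := fun n => bumpSeq X n)
          ?_ hg p
        exact tendsto_one_div_add_atTop_nhds_zero_nat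
      have h2 : Tendsto (fun n => ‖mol n g p - g p‖ₑ ^ 2) atTop (𝓝 (‖g p - g p‖ₑ ^ 2)) :=
        ((ENNReal.continuous_pow 2).tendsto _).comp (h1.sub_const _).enorm
      simpa using h2
  simpa using key

lemma tendsto_mol_L2 {f : X → F} (hf : MemLp f 2) :
    Tendsto (fun n => ∫⁻ p, ‖mol n f p - f p‖ₑ ^ 2) atTop (𝓝 0) := by
  rw [ENNReal.tendsto_atTop_zero]
  intro ε hε
  obtain ⟨δ, hδ0, hδ⟩ : ∃ δ : ℝ≥0∞, δ ≠ 0 ∧ 10 * δ ^ 2 ≤ ε := by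
    have hc : Tendsto (fun δ : ℝ≥0∞ => 10 * δ ^ 2) (𝓝 0) (𝓝 0) := by
      have := ENNReal.Tendsto.const_mul (a := 10) ((ENNReal.continuous_pow 2).tendsto 0)
        (Or.inr (by simp))
      simpa using this
    have h1 : ∀ᶠ δ in 𝓝[>] (0 : ℝ≥0∞), 10 * δ ^ 2 < ε :=
      (hc.mono_left nhdsWithin_le_nhds).eventually (gt_mem_nhds hε)
    obtain ⟨δ, h2, h3⟩ := (h1.and self_mem_nhdsWithin).exists
    exact ⟨δ, (ne_of_gt h3), h2.le⟩
  obtain ⟨g, hgc, hfg, hg, hgL⟩ := hf.exists_hasCompactSupport_eLpNorm_sub_le (by simp) hδ0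
  have hfg2 : ∫⁻ p, ‖f p - g p‖ₑ ^ 2 ≤ δ ^ 2 := by
    have := eLpNorm_two_sq volume (f - g)
    simp only [Pi.sub_apply] at this
    rw [← this]; gcongr
  have hfl : LocallyIntegrable f := hf.locallyIntegrable (by norm_num)
  have hgl : LocallyIntegrable g := hg.locallyIntegrable
  obtain ⟨N, hN⟩ := (ENNReal.tendsto_atTop_zero.1 (tendsto_mol_L2_of_continuous hg hgc))
    (δ ^ 2) (by positivity)
  refine ⟨N, fun n hn => ?_⟩
  have hm1 : AEMeasurable (fun p => ‖mol n g p - g p‖ₑ ^ 2) :=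
    ((((contDiff_mol n hgl).continuous.sub hg).enorm.measurable).pow_const 2).aemeasurable
  have hm2 : AEMeasurable (fun p => ‖mol n (fun q => f q - g q) p‖ₑ ^ 2) :=
    (((contDiff_mol n (hfl.sub hgl)).continuous.enorm.measurable).pow_const 2).aemeasurable
  calc ∫⁻ p, ‖mol n f p - f p‖ₑ ^ 2
      ≤ ∫⁻ p, (2 * ‖mol n (fun q => f q - g q) p‖ₑ ^ 2
          + (4 * ‖mol n g p - g p‖ₑ ^ 2 + 4 * ‖f p - g p‖ₑ ^ 2)) := by
        refine lintegral_mono fun p => ?_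
        have e : mol n f p - f p = mol n (fun q => f q - g q) p
            + ((mol n g p - g p) + (-(f p - g p))) := by
          rw [mol_sub n hfl hgl]; abel
        have h1 := enorm_add_sq_le (mol n (fun q => f q - g q) p)
          ((mol n g p - g p) + (-(f p - g p)))
        have h2 := enorm_add_sq_le (mol n g p - g p) (-(f p - g p))
        rw [enorm_neg] at h2
        rw [e]
        refine h1.trans ?_
        gcongr
        calc _ ≤ 2 * (2 * ‖mol n g p - g p‖ₑ ^ 2 + 2 * ‖f p - g p‖ₑ ^ 2) := by gcongr
          _ = _ := by ring
    _ = 2 * (∫⁻ p, ‖mol n (fun q => f q - g q) p‖ₑ ^ 2)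
          + (4 * (∫⁻ p, ‖mol n g p - g p‖ₑ ^ 2) + 4 * ∫⁻ p, ‖f p - g p‖ₑ ^ 2) := by
        rw [lintegral_add_left' (hm2.const_mul _), lintegral_add_left' (hm1.const_mul _),
          lintegral_const_mul' _ _ (by simp), lintegral_const_mul' _ _ (by simp),
          lintegral_const_mul' _ _ (by simp)]
    _ ≤ 2 * δ ^ 2 + (4 * δ ^ 2 + 4 * δ ^ 2) := by
        have h3 : ∫⁻ p, ‖mol n (fun q => f q - g q) p‖ₑ ^ 2 ≤ δ ^ 2 :=
          (lintegral_mol_sq_le n (hf.1.sub hg.aestronglyMeasurable)).trans hfg2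
        have h4 := hN n hn
        gcongr
    _ ≤ ε := by
        refine le_trans (le_of_eq ?_) hδ
        ring

lemma lintegral_norm_sq_smul_tendsto {α : Type*} [MeasurableSpace α] {μ : Measure α}
    {m : ℕ → α → ℝ} {m' : α → ℝ} {f : ℕ → α → F} {f' : α → F} {M : ℝ}
    (hm : ∀ n, AEStronglyMeasurable (m n) μ) (hm' : AEStronglyMeasurable m' μ)
    (hM : ∀ n, ∀ᵐ a ∂μ, |m n a| ≤ M) (hlim : ∀ᵐ a ∂μ, Tendsto (fun n => m n a) atTop (𝓝 (m' a)))
    (hfn : ∀ n, AEStronglyMeasurable (f n) μ) (hf' : MemLp f' 2 μ)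
    (hf : Tendsto (fun n => ∫⁻ a, ‖f n a - f' a‖ₑ ^ 2 ∂μ) atTop (𝓝 0)) :
    Tendsto (fun n => ∫⁻ a, ‖m n a • f n a - m' a • f' a‖ₑ ^ 2 ∂μ) atTop (𝓝 0) := by
  have hM' : ∀ᵐ a ∂μ, |m' a| ≤ M := by
    filter_upwards [ae_all_iff.2 hM, hlim] with a ha hl
    exact le_of_tendsto hl.abs (Eventually.of_forall ha)
  have h2 : Tendsto (fun n => ∫⁻ a, ‖(m n a - m' a) • f' a‖ₑ ^ 2 ∂μ) atTop
      (𝓝 (∫⁻ _, 0 ∂μ)) := by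
    refine tendsto_lintegral_of_dominated_convergence'
      (fun a => ENNReal.ofReal (2 * M) ^ 2 * ‖f' a‖ₑ ^ 2) ?_ ?_ ?_ ?_
    · intro n
      exact ((((hm n).sub hm').smul hf'.1).enorm).pow_const 2
    · intro n
      filter_upwards [hM n, hM'] with a h1 h2
      rw [enorm_smul, mul_pow]
      gcongr
      rw [← ofReal_norm]
      refine ENNReal.ofReal_le_ofReal ?_
      rw [Real.norm_eq_abs]
      linarith [abs_sub (m n a) (m' a)]
    · rw [lintegral_const_mul' _ _ (ENNReal.pow_ne_top ENNReal.ofReal_ne_top)]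
      exact ENNReal.mul_ne_top (ENNReal.pow_ne_top ENNReal.ofReal_ne_top)
        ((memLp_two_iff hf'.1).1 hf').ne
    · filter_upwards [hlim] with a ha
      have := ((ENNReal.continuous_pow 2).tendsto _).comp
        ((ha.sub_const (m' a)).smul_const (f' a)).enorm
      simpa [Function.comp_def] using this
  simp only [lintegral_zero] at h2
  have h3 : Tendsto (fun n => 2 * (ENNReal.ofReal M ^ 2 * ∫⁻ a, ‖f n a - f' a‖ₑ ^ 2 ∂μ)
      + 2 * ∫⁻ a, ‖(m n a - m' a) • f' a‖ₑ ^ 2 ∂μ) atTop (𝓝 (2 * (ENNReal.ofReal M ^ 2 * 0) + 2 * 0)) :=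
    (ENNReal.Tendsto.const_mul (ENNReal.Tendsto.const_mul hf
      (Or.inr (ENNReal.pow_ne_top ENNReal.ofReal_ne_top))) (Or.inr (by simp))).add
      (ENNReal.Tendsto.const_mul h2 (Or.inr (by simp)))
  simp only [mul_zero, add_zero] at h3
  refine tendsto_of_tendsto_of_tendsto_of_le_of_le tendsto_const_nhds h3 (fun n => zero_le) ?_
  intro n
  have hmeas : AEMeasurable (fun a => 2 * (ENNReal.ofReal M ^ 2 * ‖f n a - f' a‖ₑ ^ 2)) μ :=
    ((((hfn n).sub hf'.1).enorm.pow_const 2).const_mul _).const_mul _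
  calc ∫⁻ a, ‖m n a • f n a - m' a • f' a‖ₑ ^ 2 ∂μ
      ≤ ∫⁻ a, (2 * (ENNReal.ofReal M ^ 2 * ‖f n a - f' a‖ₑ ^ 2)
          + 2 * ‖(m n a - m' a) • f' a‖ₑ ^ 2) ∂μ := by
        refine lintegral_mono_ae ?_
        filter_upwards [hM n] with a ha
        have e : m n a • f n a - m' a • f' a
            = m n a • (f n a - f' a) + (m n a - m' a) • f' a := by
          rw [smul_sub, sub_smul]; abel
        rw [e]
        refine (enorm_add_sq_le _ _).trans ?_
        gcongr
        rw [enorm_smul, mul_pow]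
        gcongr
        rw [← ofReal_norm]
        exact ENNReal.ofReal_le_ofReal ha
    _ = _ := by
        rw [lintegral_add_left' hmeas, lintegral_const_mul' _ _ (by simp),
          lintegral_const_mul' _ _ (ENNReal.pow_ne_top ENNReal.ofReal_ne_top),
          lintegral_const_mul' _ _ (by simp)]

lemma tendsto_lintegral_sq_of_tendsto {α : Type*} [MeasurableSpace α] {μ : Measure α}
    {f : ℕ → α → F} {f' : α → F} (hfn : ∀ n, AEStronglyMeasurable (f n) μ) (hf' : MemLp f' 2 μ)
    (hf : Tendsto (fun n => ∫⁻ a, ‖f n a - f' a‖ₑ ^ 2 ∂μ) atTop (𝓝 0)) :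
    Tendsto (fun n => ∫⁻ a, ‖f n a‖ₑ ^ 2 ∂μ) atTop (𝓝 (∫⁻ a, ‖f' a‖ₑ ^ 2 ∂μ)) := by
  have h1 : Tendsto (fun n => eLpNorm (f n - f') 2 μ) atTop (𝓝 0) := by
    have := (ENNReal.continuous_rpow_const (y := 1 / 2)).tendsto 0 |>.comp hf
    simp only [one_div, ENNReal.zero_rpow_of_pos (by norm_num : (0 : ℝ) < 2⁻¹)] at this
    refine this.congr fun n => ?_
    have e := eLpNorm_two_sq μ (f n - f')
    simp only [Pi.sub_apply] at e
    simp only [Function.comp]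
    rw [← e, ← ENNReal.rpow_natCast, ← ENNReal.rpow_mul]; norm_num
  have h2 : Tendsto (fun n => eLpNorm (f n) 2 μ) atTop (𝓝 (eLpNorm f' 2 μ)) := by
    refine tendsto_of_tendsto_of_tendsto_of_le_of_le
      (g := fun n => eLpNorm f' 2 μ - eLpNorm (f n - f') 2 μ)
      (h := fun n => eLpNorm f' 2 μ + eLpNorm (f n - f') 2 μ) ?_ ?_ ?_ ?_
    · simpa using ENNReal.Tendsto.sub tendsto_const_nhds h1 (Or.inl hf'.2.ne)
    · simpa using tendsto_const_nhds.add h1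
    · intro n
      rw [tsub_le_iff_right]
      have := eLpNorm_add_le (hfn n) (hf'.1.sub (hfn n)) (p := 2) (μ := μ) (by norm_num)
      rw [add_sub_cancel, eLpNorm_sub_comm] at this
      exact this
    · intro n
      have := eLpNorm_add_le hf'.1 ((hfn n).sub hf'.1) (p := 2) (μ := μ) (by norm_num)
      rwa [add_sub_cancel] at this
  have h3 := ((ENNReal.continuous_pow 2).tendsto _).comp h2
  simpa only [Function.comp_def, eLpNorm_two_sq] using h3

lemma integrable_inner_of_memLp_two {α H : Type*} [NormedAddCommGroup H] [InnerProductSpace ℝ H]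
    [MeasurableSpace α] {μ : Measure α} {f g : α → H} (hf : MemLp f 2 μ) (hg : MemLp g 2 μ) :
    Integrable (fun a => ⟪f a, g a⟫) μ :=
  (MemLp.integrable_mul hf.norm hg.norm).mono' (hf.1.inner hg.1)
    (ae_of_all _ fun _ => norm_inner_le_norm _ _)

lemma tendsto_integral_inner {α H : Type*} [NormedAddCommGroup H] [InnerProductSpace ℝ H]
    [MeasurableSpace α] {μ : Measure α}
    {f : ℕ → α → H} {f' A : α → H} (hfn : ∀ n, MemLp (f n) 2 μ) (hf' : MemLp f' 2 μ)
    (hA : MemLp A 2 μ)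
    (hf : Tendsto (fun n => ∫⁻ a, ‖f n a - f' a‖ₑ ^ 2 ∂μ) atTop (𝓝 0)) :
    Tendsto (fun n => ∫ a, ⟪A a, f n a⟫ ∂μ) atTop (𝓝 (∫ a, ⟪A a, f' a⟫ ∂μ)) := by
  refine tendsto_integral_of_L1 _ (integrable_inner_of_memLp_two hA hf').aestronglyMeasurable
    (Eventually.of_forall fun n => integrable_inner_of_memLp_two hA (hfn n)) ?_
  have h1 : Tendsto (fun n => (∫⁻ a, ‖A a‖ₑ ^ (2 : ℝ) ∂μ) ^ (1 / (2 : ℝ)) *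
      (∫⁻ a, ‖f n a - f' a‖ₑ ^ (2 : ℝ) ∂μ) ^ (1 / (2 : ℝ))) atTop (𝓝 0) := by
    have hA2 : ∫⁻ a, ‖A a‖ₑ ^ (2 : ℝ) ∂μ < ∞ := by
      simpa using (memLp_two_iff hA.1).1 hA
    have := (ENNReal.continuous_rpow_const (y := 1 / 2)).tendsto 0 |>.comp hf
    have := ENNReal.Tendsto.const_mul this (a := (∫⁻ a, ‖A a‖ₑ ^ (2 : ℝ) ∂μ) ^ (1 / (2 : ℝ)))
      (Or.inr (ENNReal.rpow_ne_top_of_nonneg (by norm_num) hA2.ne))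
    simpa using this
  refine tendsto_of_tendsto_of_tendsto_of_le_of_le tendsto_const_nhds h1 (fun n => zero_le) ?_
  intro n
  refine le_trans (lintegral_mono fun a => ?_) (ENNReal.lintegral_mul_le_Lp_mul_Lq μ
    Real.HolderConjugate.two_two hA.1.enorm ((hfn n).1.sub hf'.1).enorm)
  simp only [Pi.mul_apply]
  rw [← inner_sub_right, ← ofReal_norm, ← ofReal_norm, ← ofReal_norm,
    ← ENNReal.ofReal_mul (norm_nonneg _)]
  exact ENNReal.ofReal_le_ofReal (norm_inner_le_norm _ _)

lemma fderiv_mol_apply (n : ℕ) {ψ : X → ℝ} (hψ : ContDiff ℝ 1 ψ) (hc : HasCompactSupport ψ)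
    (p e : X) : fderiv ℝ (mol n ψ) p e = mol n (fun q => fderiv ℝ ψ q e) p := by
  have h := hc.hasFDerivAt_convolution_right (ContinuousLinearMap.lsmul ℝ ℝ)
    (f := rho n) (μ := volume) (integrable_rho n).locallyIntegrable hψ p
  have h' : fderiv ℝ (mol n ψ) p = _ := h.fderiv
  have hdc : Continuous (fderiv ℝ ψ) := hψ.continuous_fderiv (by norm_num)
  have hex : ConvolutionExistsAt (rho n) (fderiv ℝ ψ) p
      ((ContinuousLinearMap.lsmul ℝ ℝ).precompR X) volume :=
    (hasCompactSupport_rho n).convolutionExists_left _ (continuous_rho n)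
      hdc.locallyIntegrable p
  rw [h', convolution_def, ContinuousLinearMap.integral_apply hex]
  rfl

lemma integral_mul_mol (n : ℕ) {V f : X → ℝ} (hV : Integrable V) (hf : Integrable f) :
    ∫ p, V p * mol n f p = ∫ p, mol n V p * f p := by
  obtain ⟨M, hM⟩ := (continuous_rho (X := X) n).bounded_above_of_compact_support
    (hasCompactSupport_rho n)
  have hint : Integrable (fun z : X × X => rho n (z.1 - z.2) * (V z.1 * f z.2)) := by
    refine (hV.mul_prod hf).bdd_mul (c := M) ?_ (ae_of_all _ fun z => hM _)
    exact ((continuous_rho n).comp (by fun_prop)).aestronglyMeasurable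
  calc ∫ p, V p * mol n f p = ∫ p, ∫ q, rho n (p - q) * (V p * f q) := by
        refine integral_congr_ae (ae_of_all _ fun p => ?_)
        simp only [mol_apply', smul_eq_mul]
        rw [← integral_const_mul]
        exact integral_congr_ae (ae_of_all _ fun q => by ring)
    _ = ∫ q, ∫ p, rho n (p - q) * (V p * f q) := integral_integral_swap hint
    _ = ∫ q, mol n V q * f q := by
        refine integral_congr_ae (ae_of_all _ fun q => ?_)
        simp only [mol_apply', smul_eq_mul]
        rw [← integral_mul_const]
        refine integral_congr_ae (ae_of_all _ fun p => ?_)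
        simp only
        rw [← rho_neg n (p - q), neg_sub]; ring

end MollificationLimits

section LogarithmicPotential

/-- The decreasing function `1/(a+ε) - 1/(a+h)`. -/
def potF (ε h a : ℝ) : ℝ := (a + ε)⁻¹ - (a + h)⁻¹

/-- Minus the derivative of `potF`. -/
def potF' (ε h a : ℝ) : ℝ := ((a + ε)⁻¹) ^ 2 - ((a + h)⁻¹) ^ 2

/-- A primitive of `potF`. -/
def potG (ε h a : ℝ) : ℝ := Real.log (a + ε) - Real.log (a + h)

variable {ε h a b : ℝ}

lemma potF_nonneg (hε : 0 < ε) (hh : ε ≤ h) (ha : 0 ≤ a) : 0 ≤ potF ε h a := by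
  have hh0 : 0 < h := by linarith
  have : (a + h)⁻¹ ≤ (a + ε)⁻¹ := by gcongr
  unfold potF; linarith

lemma potF_le (hε : 0 < ε) (hh : ε ≤ h) (ha : 0 ≤ a) : potF ε h a ≤ ε⁻¹ := by
  have hh0 : 0 < h := by linarith
  have h1 : (a + ε)⁻¹ ≤ ε⁻¹ := by gcongr; linarith
  have h2 : 0 ≤ (a + h)⁻¹ := by positivity
  unfold potF; linarith

lemma mul_potF_le (hε : 0 < ε) (hh : ε ≤ h) (ha : 0 ≤ a) : a * potF ε h a ≤ 1 := by
  have hh0 : 0 < h := by linarith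
  have h1 : a * (a + ε)⁻¹ ≤ 1 := by
    rw [← div_eq_mul_inv, div_le_one (by positivity)]; linarith
  have h2 : 0 ≤ a * (a + h)⁻¹ := by positivity
  unfold potF; linarith

lemma potF'_nonneg (hε : 0 < ε) (hh : ε ≤ h) (ha : 0 ≤ a) : 0 ≤ potF' ε h a := by
  have hh0 : 0 < h := by linarith
  have : (a + h)⁻¹ ≤ (a + ε)⁻¹ := by gcongr
  have h2 : 0 ≤ (a + h)⁻¹ := by positivity
  unfold potF'; nlinarith

lemma potF'_le (hε : 0 < ε) (ha : 0 ≤ a) : potF' ε h a ≤ ε⁻¹ ^ 2 := by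
  have h1 : ((a + ε)⁻¹) ^ 2 ≤ ε⁻¹ ^ 2 := by gcongr; linarith
  unfold potF'; nlinarith [sq_nonneg (a + h)⁻¹]

lemma potF_sq_le (hε : 0 < ε) (hh : ε ≤ h) (ha : 0 ≤ a) : potF ε h a ^ 2 ≤ potF' ε h a := by
  have hh0 : 0 < h := by linarith
  have : (a + h)⁻¹ ≤ (a + ε)⁻¹ := by gcongr
  have h2 : 0 ≤ (a + h)⁻¹ := by positivity
  unfold potF potF'; nlinarith

lemma hasDerivAt_potF (hε : 0 < ε) (hh : ε ≤ h) (ha : 0 ≤ a) :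
    HasDerivAt (potF ε h) (-potF' ε h a) a := by
  have hh0 : 0 < h := by linarith
  have h1 := (((hasDerivAt_id a).add_const ε).inv (by simp only [id]; positivity)).sub
    (((hasDerivAt_id a).add_const h).inv (by simp only [id]; positivity))
  refine (h1.congr_deriv ?_)
  simp only [id, potF']
  rw [inv_pow, inv_pow]; ring

lemma hasDerivAt_potG (hε : 0 < ε) (hh : ε ≤ h) (ha : 0 ≤ a) :
    HasDerivAt (potG ε h) (potF ε h a) a := by
  have hh0 : 0 < h := by linarith
  have h1 := (((hasDerivAt_id a).add_const ε).log (by simp only [id]; positivity)).sub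
    (((hasDerivAt_id a).add_const h).log (by simp only [id]; positivity))
  refine (h1.congr_deriv ?_)
  simp [id, potF]

lemma potF_anti (hε : 0 < ε) (hh : ε ≤ h) (hb : 0 ≤ b) (hab : b ≤ a) :
    potF ε h a ≤ potF ε h b := by
  have hh0 : 0 < h := by linarith
  have e : ∀ c, 0 ≤ c → potF ε h c = (h - ε) * ((c + ε)⁻¹ * (c + h)⁻¹) := by
    intro c hc
    have : c + ε ≠ 0 := by positivity
    have : c + h ≠ 0 := by positivity
    unfold potF; field_simp; ring
  rw [e a (hb.trans hab), e b hb]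
  have : 0 ≤ h - ε := by linarith
  have ha : 0 ≤ a := hb.trans hab
  gcongr

lemma potG_nonpos (hε : 0 < ε) (hh : ε ≤ h) (ha : 0 ≤ a) : potG ε h a ≤ 0 := by
  have : Real.log (a + ε) ≤ Real.log (a + h) := Real.log_le_log (by positivity) (by linarith)
  unfold potG; linarith

lemma neg_log_le_potG (hε : 0 < ε) (hh : ε ≤ h) (ha : 0 ≤ a) :
    -Real.log (h / ε) ≤ potG ε h a := by
  unfold potG
  have hh0 : 0 < h := by linarith
  rw [← Real.log_inv, ← Real.log_div (by positivity) (by positivity)]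
  refine Real.log_le_log (by positivity) ?_
  rw [inv_div, div_le_div_iff₀ hh0 (by positivity)]
  nlinarith

lemma potG_diff_ge (hε : 0 < ε) (hh : 8 * ε ≤ h) (hb : 0 ≤ b) (hbε : b ≤ ε) (ha : h / 2 ≤ a) :
    Real.log (h / ε) / 8 ≤ potG ε h a - potG ε h b := by
  have hh0 : 0 < h := by linarith
  have ha0 : 0 < a := by linarith
  have h1 : Real.log (1 / 3) ≤ potG ε h a := by
    unfold potG
    rw [← Real.log_div (by positivity) (by positivity)]
    refine Real.log_le_log (by norm_num) ?_
    rw [div_le_div_iff₀ (by norm_num) (by positivity)]; linarith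
  have h2 : potG ε h b ≤ Real.log (2 * ε / h) := by
    unfold potG
    rw [← Real.log_div (by positivity) (by positivity)]
    refine Real.log_le_log (by positivity) ?_
    gcongr <;> linarith
  have h3 : Real.log (1 / 3) - Real.log (2 * ε / h) = Real.log (h / ε) - Real.log 6 := by
    rw [← Real.log_div (by positivity) (by positivity),
      ← Real.log_div (by positivity) (by positivity)]
    congr 1; field_simp; norm_num
  have h4 : Real.log 6 ≤ 7 / 8 * Real.log (h / ε) := by
    have e1 : Real.log ((6 : ℝ) ^ 8) ≤ Real.log ((8 : ℝ) ^ 7) :=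
      Real.log_le_log (by norm_num) (by norm_num)
    rw [Real.log_pow, Real.log_pow] at e1
    have e2 : Real.log 8 ≤ Real.log (h / ε) :=
      Real.log_le_log (by norm_num) (by rw [le_div_iff₀ hε]; linarith)
    push_cast at e1
    linarith
  linarith

lemma mul_potF_sub_ge (hε : 0 < ε) (hh : 8 * ε ≤ h) (hb : 0 ≤ b) (hbε : b ≤ ε)
    (ha : h / 2 ≤ a) :
    h / ε / 64 ≤ -((a - b) * (potF ε h a - potF ε h b)) := by
  have hh0 : 0 < h := by linarith
  have ha0 : 0 < a := by linarith
  have hab : 3 / 8 * h ≤ a - b := by linarith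
  have h1 : (2 * ε)⁻¹ - h⁻¹ ≤ potF ε h b := by
    have e1 : (2 * ε)⁻¹ ≤ (b + ε)⁻¹ := by gcongr; linarith
    have e2 : (b + h)⁻¹ ≤ h⁻¹ := by gcongr; linarith
    unfold potF; linarith
  have h2 : (a - b) * potF ε h a ≤ 1 := by
    refine le_trans ?_ (mul_potF_le hε (by linarith : ε ≤ h) ha0.le)
    have := potF_nonneg hε (by linarith : ε ≤ h) ha0.le
    gcongr; linarith
  have h3 : 3 / 8 * h * ((2 * ε)⁻¹ - h⁻¹) ≤ (a - b) * potF ε h b := by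
    have : h⁻¹ ≤ (2 * ε)⁻¹ := by gcongr; linarith
    refine mul_le_mul hab h1 (by linarith) (by linarith)
  have h4 : 3 / 8 * h * ((2 * ε)⁻¹ - h⁻¹) = 3 / 16 * (h / ε) - 3 / 8 := by
    field_simp; ring
  have h5 : 8 ≤ h / ε := by rw [le_div_iff₀ hε]; exact hh
  nlinarith

lemma mul_cutoff_potF_sub_le_of_le (hε : 0 < ε) (hh : ε ≤ h) (hb : 0 ≤ b) (hab : b ≤ a)
    (e₁ : ℝ) {e₂ : ℝ} :
    (a - b) * (e₁ ^ 2 * potF ε h a - e₂ ^ 2 * potF ε h b) ≤ 3 * (e₁ - e₂) ^ 2 := by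
  have hh0 : 0 < h := by linarith
  have ha : 0 ≤ a := hb.trans hab
  have h1 := potF_nonneg hε hh ha
  set D := (a - b) * potF ε h a with hD
  have hD0 : 0 ≤ D := mul_nonneg (by linarith) h1
  have hD1 : D ≤ 1 := le_trans (by rw [hD]; gcongr; linarith) (mul_potF_le hε hh ha)
  have hQ : D ^ 2 ≤ (a - b) * (potF ε h b - potF ε h a) := by
    have key : (a - b) * potF ε h a ^ 2 ≤ potF ε h b - potF ε h a := by
      have f1 : (b + ε)⁻¹ - (a + ε)⁻¹ = (a - b) * ((b + ε)⁻¹ * (a + ε)⁻¹) := by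
        have : a + ε ≠ 0 := by positivity
        have : b + ε ≠ 0 := by positivity
        field_simp; ring
      have f2 : (b + h)⁻¹ - (a + h)⁻¹ = (a - b) * ((b + h)⁻¹ * (a + h)⁻¹) := by
        have : a + h ≠ 0 := by positivity
        have : b + h ≠ 0 := by positivity
        field_simp; ring
      have f3 : potF ε h b - potF ε h a
          = (a - b) * ((b + ε)⁻¹ * (a + ε)⁻¹ - (b + h)⁻¹ * (a + h)⁻¹) := by
        unfold potF; rw [mul_sub, ← f1, ← f2]; ring
      rw [f3]
      have : 0 ≤ a - b := by linarith
      gcongr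
      have g1 := potF_anti hε hh hb hab
      unfold potF at g1 h1 ⊢
      have g2 : 0 ≤ (b + h)⁻¹ := by positivity
      have g3 : 0 ≤ (a + h)⁻¹ := by positivity
      nlinarith
    have : 0 ≤ a - b := by linarith
    nlinarith
  have h2 : (a - b) * (e₁ ^ 2 * potF ε h a - e₂ ^ 2 * potF ε h b)
      = -e₂ ^ 2 * ((a - b) * (potF ε h b - potF ε h a)) + (e₁ ^ 2 - e₂ ^ 2) * D := by
    rw [hD]; ring
  rw [h2]
  nlinarith [sq_nonneg (e₂ * D - (e₁ - e₂)), mul_le_mul_of_nonneg_left hQ (sq_nonneg e₂),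
    mul_le_mul_of_nonneg_left hD1 (sq_nonneg (e₁ - e₂))]

lemma mul_cutoff_potF_sub_le (hε : 0 < ε) (hh : ε ≤ h) (ha : 0 ≤ a) (hb : 0 ≤ b) (e₁ e₂ : ℝ) :
    (a - b) * (e₁ ^ 2 * potF ε h a - e₂ ^ 2 * potF ε h b) ≤ 3 * (e₁ - e₂) ^ 2 := by
  rcases le_total b a with hab | hab
  · exact mul_cutoff_potF_sub_le_of_le hε hh hb hab e₁
  · have := mul_cutoff_potF_sub_le_of_le hε hh ha hab e₂ (e₂ := e₁)
    nlinarith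

lemma flux_potF_le {H : Type*} [NormedAddCommGroup H] [InnerProductSpace ℝ H] {Λ η : ℝ}
    (hΛ : 1 ≤ Λ) (hε : 0 < ε) (hh : ε ≤ h) (ha : 0 ≤ a) {A W D : H} (hA : ‖A‖ ≤ Λ * ‖W‖)
    (hAW : Λ⁻¹ * ‖W‖ ^ 2 ≤ ⟪A, W⟫) :
    ⟪A, (2 * η * potF ε h a) • D - (η ^ 2 * potF' ε h a) • W⟫ ≤
      -(Λ⁻¹ / 2) * (η ^ 2 * (potF ε h a ^ 2 * ‖W‖ ^ 2)) + 2 * Λ ^ 3 * ‖D‖ ^ 2 := by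
  have hΛ0 : 0 < Λ := by linarith
  have h1 := potF_sq_le hε hh ha
  rw [inner_sub_right, real_inner_smul_right, real_inner_smul_right]
  have h2 : |⟪A, D⟫| ≤ Λ * ‖W‖ * ‖D‖ :=
    (abs_real_inner_le_norm A D).trans (by gcongr)
  have h3 : η ^ 2 * potF ε h a ^ 2 * (Λ⁻¹ * ‖W‖ ^ 2) ≤ η ^ 2 * potF' ε h a * ⟪A, W⟫ :=
    mul_le_mul (by gcongr) hAW (by positivity)
      (mul_nonneg (sq_nonneg _) (potF'_nonneg hε hh ha))
  have h4 : 2 * η * potF ε h a * ⟪A, D⟫ ≤ 2 * (|η * potF ε h a| * ‖W‖) * (Λ * ‖D‖) := by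
    calc 2 * η * potF ε h a * ⟪A, D⟫ ≤ |2 * η * potF ε h a * ⟪A, D⟫| := le_abs_self _
      _ = 2 * |η * potF ε h a| * |⟪A, D⟫| := by
        rw [abs_mul, mul_assoc 2 η, abs_mul 2]; norm_num
      _ ≤ 2 * |η * potF ε h a| * (Λ * ‖W‖ * ‖D‖) := by gcongr
      _ = _ := by ring
  set x := |η * potF ε h a| * ‖W‖ with hx
  have hx2 : x ^ 2 = η ^ 2 * (potF ε h a ^ 2 * ‖W‖ ^ 2) := by
    rw [hx, mul_pow, sq_abs]; ring
  have h5 : 2 * x * (Λ * ‖D‖) ≤ Λ⁻¹ / 2 * x ^ 2 + 2 * Λ ^ 3 * ‖D‖ ^ 2 := by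
    have e : Λ⁻¹ / 2 * x ^ 2 + 2 * Λ ^ 3 * ‖D‖ ^ 2 - 2 * x * (Λ * ‖D‖)
        = Λ⁻¹ / 2 * (x - 2 * Λ ^ 2 * ‖D‖) ^ 2 := by
      field_simp; ring
    have : 0 ≤ Λ⁻¹ / 2 * (x - 2 * Λ ^ 2 * ‖D‖) ^ 2 := by positivity
    linarith
  rw [← hx2]
  have h6 : η ^ 2 * potF ε h a ^ 2 * (Λ⁻¹ * ‖W‖ ^ 2) = Λ⁻¹ * x ^ 2 := by rw [hx2]; ring
  linarith

end LogarithmicPotential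

section RadialKernel

/-- The radial kernel `‖z‖^{-d-2s}`. -/
def kern (s : ℝ) (z : Ed d) : ℝ := (‖z‖ ^ ((d : ℝ) + 2 * s))⁻¹

variable {s : ℝ}

lemma kern_nonneg (s : ℝ) (z : Ed d) : 0 ≤ kern s z := by unfold kern; positivity

lemma kern_neg (s : ℝ) (z : Ed d) : kern s (-z) = kern s z := by simp [kern]

lemma measurable_kern (s : ℝ) : Measurable (kern s : Ed d → ℝ) := by
  unfold kern; fun_prop

lemma kern_smul {r : ℝ} (hr : 0 < r) (z : Ed d) :
    kern s (r • z) = r ^ (-((d : ℝ) + 2 * s)) * kern s z := by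
  rw [kern, kern, norm_smul, Real.norm_of_nonneg hr.le, Real.mul_rpow hr.le (norm_nonneg _),
    mul_inv, Real.rpow_neg hr.le]

lemma lintegral_eq_smul_comp {r : ℝ} (hr : 0 < r) (f : Ed d → ℝ≥0∞) :
    ∫⁻ z, f z = ENNReal.ofReal (r ^ (d : ℝ)) * ∫⁻ z, f (r • z) := by
  have h1 := (Homeomorph.smulOfNeZero r hr.ne').measurableEmbedding.lintegral_map
    (μ := (volume : Measure (Ed d))) f
  have h2 := Measure.map_addHaar_smul (volume : Measure (Ed d)) hr.ne'
  have h3 : (Homeomorph.smulOfNeZero r hr.ne' : Ed d → Ed d) = fun z => r • z := rfl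
  rw [h3, h2, lintegral_smul_measure, finrank_euclideanSpace_fin, abs_of_pos (by positivity)] at h1
  simp only [smul_eq_mul] at h1
  rw [← h1, ← mul_assoc, ← ENNReal.ofReal_mul (by positivity), Real.rpow_natCast,
    mul_inv_cancel₀ (by positivity)]
  simp

lemma exists_lintegral_sq_kern_le (hd : 1 ≤ d) (hs : s ∈ Ioo (0 : ℝ) 1) :
    ∃ C : ℝ, 0 < C ∧ ∀ r : ℝ, 0 < r →
      ∫⁻ z in ball (0 : Ed d) r, ENNReal.ofReal (‖z‖ ^ 2 * kern s z)
        ≤ ENNReal.ofReal (C * r ^ (2 - 2 * s)) := by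
  have hmeas : Measurable fun z : Ed d => ‖z‖ ^ 2 * kern s z :=
    (measurable_norm.pow_const 2).mul (measurable_kern s)
  have hint : IntegrableOn (fun z : Ed d => ‖z‖ ^ 2 * kern s z) (ball 0 1) := by
    refine integrableOn_ball_of_norm_le_rpow (C := 1) (α := (d : ℝ) + 2 * s - 2)
      (by simpa using hd) (by simp; linarith [hs.2]) (ae_of_all _ fun z => ?_)
      hmeas.aestronglyMeasurable
    rw [Real.norm_of_nonneg (mul_nonneg (by positivity) (kern_nonneg s z)), one_mul, kern]
    rcases eq_or_ne z 0 with rfl | hz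
    · rw [norm_zero, zero_pow two_ne_zero, zero_mul]; positivity
    · have : 0 < ‖z‖ := norm_pos_iff.2 hz
      rw [show -((d : ℝ) + 2 * s - 2) = ((2 : ℕ) : ℝ) + -((d : ℝ) + 2 * s) by push_cast; ring,
        Real.rpow_add this ((2 : ℕ) : ℝ), Real.rpow_natCast, Real.rpow_neg this.le]
  set c := ∫ z in ball (0 : Ed d) 1, ‖z‖ ^ 2 * kern s z with hc
  have hc0 : 0 ≤ c := integral_nonneg fun z => mul_nonneg (by positivity) (kern_nonneg s z)
  have hlin : ∫⁻ z in ball (0 : Ed d) 1, ENNReal.ofReal (‖z‖ ^ 2 * kern s z)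
      = ENNReal.ofReal c := by
    rw [hc, ofReal_integral_eq_lintegral_ofReal hint
      (ae_of_all _ fun z => mul_nonneg (by positivity) (kern_nonneg s z))]
  refine ⟨c + 1, by linarith, fun r hr => ?_⟩
  rw [← lintegral_indicator measurableSet_ball, lintegral_eq_smul_comp hr]
  have e : ∀ z : Ed d, (ball (0 : Ed d) r).indicator
      (fun z => ENNReal.ofReal (‖z‖ ^ 2 * kern s z)) (r • z)
      = ENNReal.ofReal (r ^ (2 - ((d : ℝ) + 2 * s))) * (ball (0 : Ed d) 1).indicator
        (fun z => ENNReal.ofReal (‖z‖ ^ 2 * kern s z)) z := by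
    intro z
    by_cases hz : z ∈ ball (0 : Ed d) 1
    · have hz' : r • z ∈ ball (0 : Ed d) r := by
        rw [mem_ball_zero_iff] at hz ⊢
        rw [norm_smul, Real.norm_of_nonneg hr.le]; nlinarith
      rw [indicator_of_mem hz, indicator_of_mem hz', ← ENNReal.ofReal_mul (by positivity),
        kern_smul hr, norm_smul, Real.norm_of_nonneg hr.le, sub_eq_add_neg, Real.rpow_add hr,
        Real.rpow_two]
      congr 1; ring
    · have hz' : r • z ∉ ball (0 : Ed d) r := by
        rw [mem_ball_zero_iff, not_lt] at hz ⊢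
        rw [norm_smul, Real.norm_of_nonneg hr.le]; nlinarith
      rw [indicator_of_notMem hz, indicator_of_notMem hz', mul_zero]
  simp only [e]
  rw [lintegral_const_mul' _ _ ENNReal.ofReal_ne_top, lintegral_indicator measurableSet_ball,
    hlin, ← ENNReal.ofReal_mul (by positivity), ← ENNReal.ofReal_mul (by positivity), ← mul_assoc,
    ← Real.rpow_add hr]
  refine ENNReal.ofReal_le_ofReal ?_
  rw [show (d : ℝ) + (2 - ((d : ℝ) + 2 * s)) = 2 - 2 * s by ring, mul_comm]
  gcongr; linarith

lemma exists_lintegral_kern_compl_le (hs : 0 < s) :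
    ∃ C : ℝ, 0 < C ∧ ∀ r : ℝ, 0 < r →
      ∫⁻ z in (ball (0 : Ed d) r)ᶜ, ENNReal.ofReal (kern s z)
        ≤ ENNReal.ofReal (C * r ^ (-(2 * s))) := by
  have hint : IntegrableOn (fun z : Ed d => kern s z) (ball 0 1)ᶜ := by
    have h1 : Integrable fun z : Ed d => (2 : ℝ) ^ ((d : ℝ) + 2 * s) *
        (1 + ‖z‖) ^ (-((d : ℝ) + 2 * s)) :=
      (integrable_one_add_norm (by simp; linarith)).const_mul _
    refine h1.integrableOn.mono' (measurable_kern s).aestronglyMeasurable ?_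
    refine (ae_restrict_iff' measurableSet_ball.compl).2 (ae_of_all _ fun z hz => ?_)
    rw [mem_compl_iff, mem_ball_zero_iff, not_lt] at hz
    have hz0 : 0 < ‖z‖ := by linarith
    rw [Real.norm_of_nonneg (kern_nonneg s z), kern, Real.rpow_neg (by positivity),
      ← div_eq_mul_inv, ← one_div, div_le_div_iff₀ (by positivity) (by positivity), one_mul,
      ← Real.mul_rpow (by norm_num) (by positivity)]
    gcongr; linarith
  set c := ∫ z in (ball (0 : Ed d) 1)ᶜ, kern s z with hc
  have hc0 : 0 ≤ c := integral_nonneg fun z => kern_nonneg s z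
  have hlin : ∫⁻ z in (ball (0 : Ed d) 1)ᶜ, ENNReal.ofReal (kern s z)
      = ENNReal.ofReal c := by
    rw [hc, ofReal_integral_eq_lintegral_ofReal hint (ae_of_all _ fun z => kern_nonneg s z)]
  refine ⟨c + 1, by linarith, fun r hr => ?_⟩
  rw [← lintegral_indicator measurableSet_ball.compl, lintegral_eq_smul_comp hr]
  have e : ∀ z : Ed d, (ball (0 : Ed d) r)ᶜ.indicator
      (fun z => ENNReal.ofReal (kern s z)) (r • z)
      = ENNReal.ofReal (r ^ (-((d : ℝ) + 2 * s))) * (ball (0 : Ed d) 1)ᶜ.indicator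
        (fun z => ENNReal.ofReal (kern s z)) z := by
    intro z
    by_cases hz : z ∈ ball (0 : Ed d) 1
    · have hz' : r • z ∈ ball (0 : Ed d) r := by
        rw [mem_ball_zero_iff] at hz ⊢
        rw [norm_smul, Real.norm_of_nonneg hr.le]; nlinarith
      rw [indicator_of_notMem (not_not.2 hz'), indicator_of_notMem (not_not.2 hz), mul_zero]
    · have hz' : r • z ∉ ball (0 : Ed d) r := by
        rw [mem_ball_zero_iff, not_lt] at hz ⊢
        rw [norm_smul, Real.norm_of_nonneg hr.le]; nlinarith
      rw [indicator_of_mem (mem_compl hz), indicator_of_mem (mem_compl hz'),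
        ← ENNReal.ofReal_mul (by positivity), kern_smul hr]
  simp only [e]
  rw [lintegral_const_mul' _ _ ENNReal.ofReal_ne_top,
    lintegral_indicator measurableSet_ball.compl,
    hlin, ← ENNReal.ofReal_mul (by positivity), ← ENNReal.ofReal_mul (by positivity), ← mul_assoc,
    ← Real.rpow_add hr]
  refine ENNReal.ofReal_le_ofReal ?_
  rw [show (d : ℝ) + (-((d : ℝ) + 2 * s)) = -(2 * s) by ring, mul_comm]
  gcongr; linarith

end RadialKernel

section Translation

variable {X : Type*} [NormedAddCommGroup X] [NormedSpace ℝ X] [FiniteDimensional ℝ X]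
  [MeasureSpace X] [BorelSpace X] [(volume : Measure X).IsAddHaarMeasure]

lemma lintegral_translation_sq_le {f : X → ℝ} (w : X) {S S' : Set X} (hS : MeasurableSet S)
    (hS' : MeasurableSet S') (hSS : ∀ p ∈ S, ∀ θ ∈ Icc (0 : ℝ) 1, p + θ • w ∈ S')
    (hf : ContDiff ℝ 1 f) :
    ∫⁻ p in S, ‖f (p + w) - f p‖ₑ ^ 2 ≤ ∫⁻ p in S', ‖fderiv ℝ f p w‖ₑ ^ 2 := by
  have hdc : Continuous fun p => fderiv ℝ f p w :=
    (hf.continuous_fderiv (by norm_num)).clm_apply continuous_const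
  let μ : Measure ℝ := volume.restrict (Icc 0 1)
  have hμ : IsProbabilityMeasure μ := ⟨by simp [μ]⟩
  have hpt : ∀ p, ‖f (p + w) - f p‖ₑ ^ 2 ≤ ∫⁻ θ, ‖fderiv ℝ f (p + θ • w) w‖ₑ ^ 2 ∂μ := by
    intro p
    have hder : ∀ θ ∈ uIcc (0 : ℝ) 1,
        HasDerivAt (fun θ : ℝ => f (p + θ • w)) (fderiv ℝ f (p + θ • w) w) θ := by
      intro θ _
      have h1 : HasDerivAt (fun θ : ℝ => p + θ • w) w θ := by
        simpa using ((hasDerivAt_id θ).smul_const w).const_add p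
      exact ((hf.differentiable (by norm_num)) _).hasFDerivAt.comp_hasDerivAt θ h1
    have hcont : Continuous fun θ : ℝ => fderiv ℝ f (p + θ • w) w :=
      hdc.comp (by fun_prop)
    have hftc := intervalIntegral.integral_eq_sub_of_hasDerivAt hder
      (hcont.intervalIntegrable 0 1)
    simp only [one_smul, zero_smul, add_zero] at hftc
    rw [← hftc, intervalIntegral.integral_of_le zero_le_one, ← integral_Icc_eq_integral_Ioc]
    calc _ ≤ (∫⁻ θ, ‖fderiv ℝ f (p + θ • w) w‖ₑ ∂μ) ^ 2 := by
          gcongr; exact enorm_integral_le_lintegral_enorm _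
      _ ≤ _ := sq_lintegral_le_of_isProbabilityMeasure μ hcont.enorm.measurable.aemeasurable
  have hmeas : Measurable fun z : X × ℝ => ‖fderiv ℝ f (z.1 + z.2 • w) w‖ₑ ^ 2 :=
    ((hdc.comp (by fun_prop : Continuous fun z : X × ℝ => z.1 + z.2 • w)).enorm.measurable).pow_const
      2
  calc ∫⁻ p in S, ‖f (p + w) - f p‖ₑ ^ 2
      ≤ ∫⁻ p in S, ∫⁻ θ, ‖fderiv ℝ f (p + θ • w) w‖ₑ ^ 2 ∂μ := lintegral_mono hpt
    _ = ∫⁻ θ, (∫⁻ p in S, ‖fderiv ℝ f (p + θ • w) w‖ₑ ^ 2) ∂μ :=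
        lintegral_lintegral_swap hmeas.aemeasurable
    _ ≤ ∫⁻ _, (∫⁻ p in S', ‖fderiv ℝ f p w‖ₑ ^ 2) ∂μ := by
        refine lintegral_mono_ae ?_
        refine (ae_restrict_iff' measurableSet_Icc).2 (ae_of_all _ fun θ hθ => ?_)
        rw [← lintegral_indicator hS, ← lintegral_indicator hS']
        rw [← lintegral_add_right_eq_self
          (S'.indicator fun p => ‖fderiv ℝ f p w‖ₑ ^ 2) (θ • w)]
        refine lintegral_mono fun p => ?_
        by_cases hp : p ∈ S
        · rw [indicator_of_mem hp, indicator_of_mem (hSS p hp θ hθ)]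
        · rw [indicator_of_notMem hp]; exact zero_le
    _ = _ := by simp

end Translation

section MollifiedGradient

instance isAddHaarMeasure_volume_space_time :
    (volume : Measure (ℝ × Ed d)).IsAddHaarMeasure :=
  inferInstanceAs ((volume : Measure ℝ).prod (volume : Measure (Ed d))).IsAddHaarMeasure

lemma fderiv_rho_eq_zero {X : Type*} [NormedAddCommGroup X] [NormedSpace ℝ X]
    [FiniteDimensional ℝ X] [MeasureSpace X] [BorelSpace X]
    [(volume : Measure X).IsAddHaarMeasure] {n : ℕ} {q : X} (h : rho n q = 0) :
    fderiv ℝ (rho n) q = 0 :=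
  IsLocalMin.fderiv_eq_zero (Eventually.of_forall fun y => by rw [h]; exact rho_nonneg n y)

lemma fderiv_mol_apply_left {X : Type*} [NormedAddCommGroup X] [NormedSpace ℝ X]
    [FiniteDimensional ℝ X] [MeasureSpace X] [BorelSpace X]
    [(volume : Measure X).IsAddHaarMeasure] (n : ℕ) {f : X → ℝ} (hf : LocallyIntegrable f)
    (p e : X) : fderiv ℝ (mol n f) p e = ∫ q, fderiv ℝ (rho n) (p - q) e * f q := by
  have hc := hasCompactSupport_rho (X := X) n
  have h1 : ContDiff ℝ 1 (rho n : X → ℝ) := (contDiff_rho n).of_le (by exact_mod_cast le_top)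
  have h := hc.hasFDerivAt_convolution_left (ContinuousLinearMap.lsmul ℝ ℝ)
    (μ := volume) h1 hf p
  have h' : fderiv ℝ (mol n f) p = _ := h.fderiv
  have hdc : Continuous (fderiv ℝ (rho n : X → ℝ)) := h1.continuous_fderiv (by norm_num)
  have hex : ConvolutionExistsAt (fderiv ℝ (rho n)) f p
      ((ContinuousLinearMap.lsmul ℝ ℝ).precompL X) volume :=
    (hc.fderiv ℝ).convolutionExists_left _ hdc hf p
  rw [h', convolution_def, ContinuousLinearMap.integral_apply hex,
    ← integral_sub_left_eq_self _ volume p]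
  simp

variable {Ω : Set (Ed d)} {v : ℝ → Ed d → ℝ} {Dv : ℝ → Ed d → Ed d} {a b ρ : ℝ} {x₀ : Ed d}

lemma fderiv_mol_indicator_apply {V : ℝ × Ed d → ℝ} {W : ℝ × Ed d → Ed d}
    (hV : V = (Ioo a b ×ˢ ball x₀ ρ).indicator fun p => v p.1 p.2)
    (hW : W = (Ioo a b ×ˢ ball x₀ ρ).indicator fun p => Dv p.1 p.2)
    (hVi : Integrable V) (hWi : Integrable W) (hΩ : closedBall x₀ ρ ⊆ Ω)
    (grad : ∀ t ∈ Ioo a b, ∀ φ : Ed d → ℝ, ContDiff ℝ (⊤ : ℕ∞) φ → HasCompactSupport φ →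
      tsupport φ ⊆ Ω → ∀ e : Ed d,
        ∫ x, v t x * (fderiv ℝ φ x) e = - ∫ x, φ x * ⟪Dv t x, e⟫)
    {n : ℕ} {p : ℝ × Ed d} (hp : ball p (1 / ((n : ℝ) + 1)) ⊆ Ioo a b ×ˢ ball x₀ ρ) (e : Ed d) :
    fderiv ℝ (mol n V) p (0, e) = ⟪mol n W p, e⟫ := by
  have hd1 : ContDiff ℝ 1 (rho n : ℝ × Ed d → ℝ) :=
    (contDiff_rho n).of_le (by exact_mod_cast le_top)
  have hrho0 : ∀ q ∉ Ioo a b ×ˢ ball x₀ ρ, rho n (p - q) = 0 := by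
    intro q hq
    apply rho_eq_zero
    by_contra h
    exact hq (hp (by rw [mem_ball', dist_eq_norm]; exact not_le.1 h))
  have hdc : Continuous fun q : ℝ × Ed d => fderiv ℝ (rho n) (p - q) (0, e) :=
    ((hd1.continuous_fderiv (by norm_num)).comp (by fun_prop)).clm_apply continuous_const
  have hI1 : Integrable fun q : ℝ × Ed d => fderiv ℝ (rho n) (p - q) (0, e) * V q := by
    obtain ⟨M, hM⟩ := ((hd1.continuous_fderiv (by norm_num))).bounded_above_of_compact_support
      ((hasCompactSupport_rho (X := ℝ × Ed d) n).fderiv ℝ)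
    refine hVi.bdd_mul (c := M * ‖((0 : ℝ), e)‖) hdc.aestronglyMeasurable
      (ae_of_all _ fun q => ?_)
    exact (ContinuousLinearMap.le_opNorm _ _).trans (by gcongr; exact hM _)
  have hI2 : Integrable fun q : ℝ × Ed d => rho n (p - q) * ⟪W q, e⟫ := by
    obtain ⟨M, hM⟩ := (continuous_rho (X := ℝ × Ed d) n).bounded_above_of_compact_support
      (hasCompactSupport_rho n)
    refine (hWi.inner_const e).bdd_mul (c := M) ?_ (ae_of_all _ fun q => hM _)
    exact ((continuous_rho n).comp (by fun_prop)).aestronglyMeasurable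
  have hI3 : Integrable fun q : ℝ × Ed d => rho n (p - q) • W q :=
    integrable_rho_smul n hWi.locallyIntegrable p
  have hR : ⟪mol n W p, e⟫ = ∫ q, rho n (p - q) * ⟪W q, e⟫ := by
    rw [mol_apply', real_inner_comm, ← integral_inner hI3]
    simp only [real_inner_smul_right, real_inner_comm]
  rw [fderiv_mol_apply_left n hVi.locallyIntegrable, hR, Measure.volume_eq_prod,
    integral_prod _ hI1, integral_prod _ hI2]
  refine integral_congr_ae (ae_of_all _ fun t => ?_)
  by_cases ht : t ∈ Ioo a b
  · set φ : Ed d → ℝ := fun x => rho n (p - (t, x)) with hφ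
    have hφd : ContDiff ℝ (⊤ : ℕ∞) φ := (contDiff_rho n).comp (by fun_prop)
    have hsupp : ∀ x ∉ ball x₀ ρ, φ x = 0 := fun x hx => hrho0 _ fun h => hx h.2
    have hts : tsupport φ ⊆ closedBall x₀ ρ := by
      refine closure_minimal (fun x hx => ?_) isClosed_closedBall
      by_contra h
      exact hx (hsupp x fun h' => h (ball_subset_closedBall h'))
    have hφc : HasCompactSupport φ :=
      HasCompactSupport.of_support_subset_isCompact (isCompact_closedBall x₀ ρ)
        (subset_closure.trans hts)
    have hfd : ∀ x, fderiv ℝ φ x e = -fderiv ℝ (rho n) (p - (t, x)) (0, e) := by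
      intro x
      have h1 : HasFDerivAt (fun x : Ed d => p - (t, x))
          (-(ContinuousLinearMap.inr ℝ ℝ (Ed d))) x :=
        (hasFDerivAt_prodMk_right t x).const_sub p
      have h2 := ((hd1.differentiable (by norm_num)) (p - (t, x))).hasFDerivAt.comp x h1
      have h3 : fderiv ℝ φ x = _ := h2.fderiv
      rw [h3]; simp [← map_neg]
    have hg := grad t ht φ hφd hφc (hts.trans hΩ) e
    calc ∫ x, fderiv ℝ (rho n) (p - (t, x)) (0, e) * V (t, x)
        = -∫ x, v t x * fderiv ℝ φ x e := by
          rw [← integral_neg]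
          refine integral_congr_ae (ae_of_all _ fun x => ?_)
          simp only [hfd]
          by_cases hx : x ∈ ball x₀ ρ
          · rw [hV, indicator_of_mem (show (t, x) ∈ Ioo a b ×ˢ ball x₀ ρ from ⟨ht, hx⟩)]; ring
          · rw [fderiv_rho_eq_zero (hrho0 (t, x) fun h => hx h.2)]; simp
      _ = ∫ x, φ x * ⟪Dv t x, e⟫ := by rw [hg, neg_neg]
      _ = ∫ x, rho n (p - (t, x)) * ⟪W (t, x), e⟫ := by
          refine integral_congr_ae (ae_of_all _ fun x => ?_)
          simp only [hφ]
          by_cases hx : x ∈ ball x₀ ρ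
          · rw [hW, indicator_of_mem (show (t, x) ∈ Ioo a b ×ˢ ball x₀ ρ from ⟨ht, hx⟩)]
          · rw [hrho0 (t, x) fun h => hx h.2]; simp
  · have hV0 : ∀ x, V (t, x) = 0 := fun x => by
      rw [hV, indicator_of_notMem fun h => ht h.1]
    have hW0 : ∀ x, W (t, x) = 0 := fun x => by
      rw [hW, indicator_of_notMem fun h => ht h.1]
    simp [hV0, hW0]

end MollifiedGradient

section TestedInequality

lemma integral_Ioc_setIntegral_eq {a b : ℝ} {Ω : Set (Ed d)} {f : ℝ × Ed d → ℝ}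
    (hf : Integrable f) (h0 : ∀ p, f p ≠ 0 → p.1 ∈ Ioc a b ∧ p.2 ∈ Ω) :
    ∫ t in Ioc a b, ∫ x in Ω, f (t, x) = ∫ p, f p := by
  rw [Measure.volume_eq_prod, integral_prod f hf]
  have h1 : ∀ t, ∫ x in Ω, f (t, x) = ∫ x, f (t, x) := fun t =>
    setIntegral_eq_integral_of_forall_compl_eq_zero fun x hx => by
      by_contra h
      exact hx (h0 (t, x) h).2
  simp only [h1]
  refine setIntegral_eq_integral_of_forall_compl_eq_zero fun t ht => ?_
  refine integral_eq_zero_of_ae (ae_of_all _ fun x => ?_)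
  by_contra h
  exact ht (h0 (t, x) h).1

variable {T a b ρ : ℝ} {Ω : Set (Ed d)} {A : ℝ → Ed d → Ed d → Ed d}
  {K : ℝ → Ed d → Ed d → ℝ} {v : ℝ → Ed d → ℝ} {Dv : ℝ → Ed d → Ed d} {x₀ : Ed d}

lemma fderiv_eq_zero_of_notMem {X : Type*} [NormedAddCommGroup X] [NormedSpace ℝ X] {g : X → ℝ}
    {S : Set X} (hS : IsClosed S) (h0 : ∀ p ∉ S, g p = 0) {p : X} (hp : p ∉ S) :
    fderiv ℝ g p = 0 := by
  have : g =ᶠ[𝓝 p] fun _ => 0 := by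
    filter_upwards [hS.isOpen_compl.mem_nhds hp] with q hq using h0 q hq
  rw [this.fderiv_eq]; simp

lemma supersolution_tested (hsuper : IsLocalWeakSupersolutionHom A K (Ioo 0 T) Ω v Dv)
    (hab : a < b) (hJ : Icc a b ⊆ Ioo 0 T) (hΩ : closedBall x₀ ρ ⊆ Ω)
    {V : ℝ × Ed d → ℝ} {B : ℝ × Ed d → Ed d}
    (hV : V = (Ioo a b ×ˢ ball x₀ ρ).indicator fun p => v p.1 p.2)
    (hB : B = (Ioo a b ×ˢ ball x₀ ρ).indicator fun p => A p.1 p.2 (Dv p.1 p.2))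
    (hVi : Integrable V) (hBi : Integrable B)
    {g : ℝ × Ed d → ℝ} (hg : ContDiff ℝ (⊤ : ℕ∞) g) (hg0 : ∀ p, 0 ≤ g p) {S : Set (ℝ × Ed d)}
    (hS : IsCompact S) (hSQ : S ⊆ Ioo a b ×ˢ ball x₀ ρ) (hgS : ∀ p ∉ S, g p = 0)
    (hΦ : Integrable (fun z : ℝ × Ed d × Ed d =>
      (v z.1 z.2.1 - v z.1 z.2.2) * (g (z.1, z.2.1) - g (z.1, z.2.2)) * K z.1 z.2.1 z.2.2)
      ((volume.restrict (Ioc a b)).prod (volume.prod volume))) :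
    ∫ p, V p * fderiv ℝ g p (1, 0) ≤ (∫ p, fderiv ℝ g p (0, B p)) +
      ∫ z, (v z.1 z.2.1 - v z.1 z.2.2) * (g (z.1, z.2.1) - g (z.1, z.2.2)) * K z.1 z.2.1 z.2.2
        ∂((volume.restrict (Ioc a b)).prod (volume.prod volume)) := by
  have hd1 : ContDiff ℝ 1 g := hg.of_le (by exact_mod_cast le_top)
  have hdiff : Differentiable ℝ g := hd1.differentiable (by norm_num)
  have hdc : Continuous (fderiv ℝ g) := hd1.continuous_fderiv (by norm_num)
  have hfd0 : ∀ p ∉ S, fderiv ℝ g p = 0 := fun p hp =>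
    fderiv_eq_zero_of_notMem hS.isClosed hgS hp
  have hgc : HasCompactSupport (fderiv ℝ g) :=
    HasCompactSupport.intro hS fun p hp => hfd0 p hp
  obtain ⟨M, hM⟩ := hdc.bounded_above_of_compact_support hgc
  set φ : ℝ → Ed d → ℝ := fun t x => -g (t, x) with hφ
  have hSΩ : Prod.snd '' S ⊆ Ω := by
    rintro _ ⟨p, hp, rfl⟩
    exact hΩ (ball_subset_closedBall (hSQ hp).2)
  have htest : IsTestFunction Ω φ := by
    refine ⟨hg.neg, Prod.snd '' S, hS.image continuous_snd, hSΩ, fun t => ?_⟩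
    refine closure_minimal (fun x hx => ?_) (hS.image continuous_snd).isClosed
    by_contra h
    refine hx ?_
    simp only [hφ]
    rw [hgS (t, x) fun h' => h ⟨_, h', rfl⟩, neg_zero]
  have h := hsuper a b hab.le hJ φ htest fun t x => by simp [hφ, hg0]
  have hbd : ∀ t x, t ∉ Ioo a b → φ t x = 0 := fun t x ht => by
    simp only [hφ]
    rw [hgS (t, x) fun h' => ht (hSQ h').1, neg_zero]
  have hmem : ∀ p ∈ S, p.1 ∈ Ioc a b ∧ p.2 ∈ Ω := fun p hp =>
    ⟨Ioo_subset_Ioc_self (hSQ hp).1, hΩ (ball_subset_closedBall (hSQ hp).2)⟩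
  have e1 : ∫ t in Ioc a b, ∫ x in Ω, v t x * deriv (fun τ => φ τ x) t
      = -∫ p, V p * fderiv ℝ g p (1, 0) := by
    rw [← integral_neg]
    have hI : Integrable fun p => -(V p * fderiv ℝ g p (1, 0)) := by
      simp only [mul_comm (V _)]
      refine (hVi.bdd_mul (c := M * ‖((1 : ℝ), (0 : Ed d))‖)
        (hdc.clm_apply continuous_const).aestronglyMeasurable (ae_of_all _ fun p => ?_)).neg
      exact (ContinuousLinearMap.le_opNorm _ _).trans (by gcongr; exact hM _)
    rw [← integral_Ioc_setIntegral_eq (a := a) (b := b) (Ω := Ω) hI]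
    · refine integral_congr_ae (ae_of_all _ fun t => integral_congr_ae (ae_of_all _ fun x => ?_))
      have h1 : HasDerivAt (fun τ => φ τ x) (-fderiv ℝ g (t, x) (1, 0)) t := by
        have h2 : HasDerivAt (fun τ : ℝ => (τ, x)) ((1 : ℝ), (0 : Ed d)) t :=
          (hasDerivAt_id t).prodMk (hasDerivAt_const t x)
        exact ((hdiff (t, x)).hasFDerivAt.comp_hasDerivAt t h2).neg
      simp only [h1.deriv]
      by_cases hx : (t, x) ∈ S
      · rw [hV, indicator_of_mem (hSQ hx)]; ring
      · rw [hfd0 _ hx]; simp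
    · intro p hp
      refine hmem p ?_
      by_contra h'
      exact hp (by rw [hfd0 _ h']; simp)
  have e2 : ∫ t in Ioc a b, ∫ x in Ω, ⟪A t x (Dv t x), gradient (φ t) x⟫
      = -∫ p, fderiv ℝ g p (0, B p) := by
    rw [← integral_neg]
    have hI : Integrable fun p => -(fderiv ℝ g p (0, B p)) := by
      refine Integrable.neg (Integrable.mono' (hBi.norm.const_mul M) ?_ (ae_of_all _ fun p => ?_))
      · have h1 : AEStronglyMeasurable (fun p => ((0 : ℝ), B p)) :=
          aestronglyMeasurable_const.prodMk hBi.1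
        exact isBoundedBilinearMap_apply.continuous.comp_aestronglyMeasurable
          (hdc.aestronglyMeasurable.prodMk h1)
      · refine (ContinuousLinearMap.le_opNorm _ _).trans ?_
        have : ‖((0 : ℝ), B p)‖ = ‖B p‖ := by simp [Prod.norm_def]
        rw [this]
        gcongr; exact hM _
    rw [← integral_Ioc_setIntegral_eq (a := a) (b := b) (Ω := Ω) hI]
    · refine integral_congr_ae (ae_of_all _ fun t => integral_congr_ae (ae_of_all _ fun x => ?_))
      have h1 : HasFDerivAt (φ t) (-(fderiv ℝ g (t, x) ∘L ContinuousLinearMap.inr ℝ ℝ (Ed d))) x :=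
        ((hdiff (t, x)).hasFDerivAt.comp x (hasFDerivAt_prodMk_right t x)).neg
      simp only
      rw [real_inner_comm, gradient, InnerProductSpace.toDual_symm_apply, h1.fderiv]
      by_cases hx : (t, x) ∈ S
      · rw [hB, indicator_of_mem (hSQ hx)]; simp
      · rw [hfd0 _ hx]; simp
    · intro p hp
      refine hmem p ?_
      by_contra h'
      exact hp (by rw [hfd0 _ h']; simp)
  have e3 : ∫ t in Ioc a b, ∫ x : Ed d, ∫ y : Ed d,
        (v t x - v t y) * (φ t x - φ t y) * K t x y
      = -∫ z, (v z.1 z.2.1 - v z.1 z.2.2) * (g (z.1, z.2.1) - g (z.1, z.2.2)) * K z.1 z.2.1 z.2.2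
        ∂((volume.restrict (Ioc a b)).prod (volume.prod volume)) := by
    rw [integral_prod _ hΦ, ← integral_neg]
    refine integral_congr_ae ?_
    filter_upwards [hΦ.prod_right_ae] with t ht
    rw [integral_prod _ ht, ← integral_neg]
    refine integral_congr_ae (ae_of_all _ fun x => ?_)
    simp only
    rw [← integral_neg]
    refine integral_congr_ae (ae_of_all _ fun y => ?_)
    simp only [hφ]
    ring
  rw [mixedLHS, e1, e2, e3] at h
  simp only [hbd a _ (by simp), hbd b _ (by simp), mul_zero, integral_zero] at h
  linarith

end TestedInequality

section NonlocalTerm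

lemma lintegral_shear {h : ℝ × Ed d × Ed d → ℝ≥0∞} (hh : Measurable h) :
    ∫⁻ z, h z = ∫⁻ z : Ed d, ∫⁻ p : ℝ × Ed d, h (p.1, p.2, p.2 + z) := by
  have h1 : Measurable fun w : (ℝ × Ed d) × Ed d => h (w.1.1, w.1.2, w.1.2 + w.2) :=
    hh.comp (by fun_prop)
  rw [← lintegral_lintegral_swap (f := fun (p : ℝ × Ed d) (z : Ed d) => h (p.1, p.2, p.2 + z))
    h1.aemeasurable, Measure.volume_eq_prod, lintegral_prod _ hh.aemeasurable,
    Measure.volume_eq_prod ℝ (Ed d), lintegral_prod _ h1.lintegral_prod_right'.aemeasurable]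
  refine lintegral_congr fun t => ?_
  have h2 := lintegral_prod (fun w : Ed d × Ed d => h (t, w))
    (μ := volume) (ν := volume) (hh.comp measurable_prodMk_left).aemeasurable
  rw [← Measure.volume_eq_prod] at h2
  rw [h2]
  refine lintegral_congr fun x => ?_
  exact (lintegral_add_left_eq_self (fun y => h (t, x, y)) x).symm

lemma lintegral_swap_space (h : ℝ × Ed d × Ed d → ℝ≥0∞) (hh : Measurable h) :
    ∫⁻ z : ℝ × Ed d × Ed d, h (z.1, z.2.2, z.2.1) = ∫⁻ z, h z := by
  have h1 : MeasurePreserving (fun z : ℝ × Ed d × Ed d => (z.1, z.2.2, z.2.1)) :=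
    (MeasurePreserving.id (volume : Measure ℝ)).prod
      (Measure.measurePreserving_swap (μ := (volume : Measure (Ed d)))
        (ν := (volume : Measure (Ed d))))
  exact h1.lintegral_comp hh

variable {s Λ a b r : ℝ} {K : ℝ → Ed d → Ed d → ℝ} {v : ℝ → Ed d → ℝ} {x₀ : Ed d}

/-- The integrand of the nonlocal bilinear form. -/
def nonlocalForm (K : ℝ → Ed d → Ed d → ℝ) (v : ℝ → Ed d → ℝ) (g : ℝ × Ed d → ℝ)
    (z : ℝ × Ed d × Ed d) : ℝ :=
  (v z.1 z.2.1 - v z.1 z.2.2) * (g (z.1, z.2.1) - g (z.1, z.2.2)) * K z.1 z.2.1 z.2.2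

/-- Pairs of points at distance less than `r`. -/
def nearDiag (d : ℕ) (r : ℝ) : Set (ℝ × Ed d × Ed d) := {z | ‖z.2.2 - z.2.1‖ < r}

lemma measurableSet_nearDiag (r : ℝ) : MeasurableSet (nearDiag d r) :=
  (isOpen_lt (by fun_prop) continuous_const).measurableSet

lemma measurable_nonlocalForm (hK : Measurable fun p : ℝ × Ed d × Ed d => K p.1 p.2.1 p.2.2)
    (hv : Measurable (Function.uncurry v)) {g : ℝ × Ed d → ℝ} (hg : Measurable g) :
    Measurable (nonlocalForm K v g) := by
  have h1 : Measurable fun z : ℝ × Ed d × Ed d => v z.1 z.2.1 :=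
    hv.comp (by fun_prop : Measurable fun z : ℝ × Ed d × Ed d => (z.1, z.2.1))
  have h2 : Measurable fun z : ℝ × Ed d × Ed d => v z.1 z.2.2 :=
    hv.comp (by fun_prop : Measurable fun z : ℝ × Ed d × Ed d => (z.1, z.2.2))
  have h3 : Measurable fun z : ℝ × Ed d × Ed d => g (z.1, z.2.1) := hg.comp (by fun_prop)
  have h4 : Measurable fun z : ℝ × Ed d × Ed d => g (z.1, z.2.2) := hg.comp (by fun_prop)
  exact ((h1.sub h2).mul (h3.sub h4)).mul hK

lemma KernelHyp.nonneg (hK : KernelHyp d s Λ K) (hΛ : 1 ≤ Λ) {t : ℝ} {x y : Ed d} (h : x ≠ y) :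
    0 ≤ K t x y := le_trans (by positivity) (hK.lower t x y h)

lemma KernelHyp.le_kern (hK : KernelHyp d s Λ K) {t : ℝ} {x y : Ed d} (h : x ≠ y) :
    K t x y ≤ Λ * kern s (y - x) := by
  have := hK.upper t x y h
  rwa [norm_sub_rev, div_eq_mul_inv] at this

lemma lintegral_nearDiag_nonlocalForm_le (hK : KernelHyp d s Λ K) (hΛ : 1 ≤ Λ) {ρ ρ' ρ₁ a' b' : ℝ}
    {V : ℝ × Ed d → ℝ}
    (hV : V = (Ioo a b ×ˢ ball x₀ ρ).indicator fun p => v p.1 p.2) (hVm : Measurable V)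
    {g : ℝ × Ed d → ℝ} (hgm : Measurable g)
    (hg : ∀ p ∉ Icc a' b' ×ˢ closedBall x₀ ρ', g p = 0) (hab : Icc a' b' ⊆ Ioo a b)
    (hρ : ρ' + r ≤ ρ₁) (hρ₁ : ρ₁ ≤ ρ) {N₁ N₂ : ℝ≥0∞}
    (h1 : ∀ z : Ed d, ‖z‖ < r → ∫⁻ p in Icc a' b' ×ˢ ball x₀ ρ₁,
      ‖V (p.1, p.2 + z) - V p‖ₑ ^ 2 ≤ ENNReal.ofReal (‖z‖ ^ 2) * N₁)
    (h2 : ∀ z : Ed d, ∫⁻ p, ‖g (p.1, p.2 + z) - g p‖ₑ ^ 2 ≤ ENNReal.ofReal (‖z‖ ^ 2) * N₂)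
    (S : Set ℝ) :
    ∫⁻ z in nearDiag d r, ‖nonlocalForm K v g z‖ₑ ∂((volume.restrict S).prod (volume.prod volume))
      ≤ ENNReal.ofReal Λ * (N₁ + N₂) *
        ∫⁻ z in ball (0 : Ed d) r, ENNReal.ofReal (‖z‖ ^ 2 * kern s z) := by
  have hΛ0 : 0 ≤ Λ := by linarith
  have hm1 : MeasurableSet (Icc a' b' ×ˢ ball x₀ ρ₁) :=
    measurableSet_Icc.prod measurableSet_ball
  set H : ℝ × Ed d × Ed d → ℝ≥0∞ := (nearDiag d r).indicator fun z =>
    ENNReal.ofReal (Λ * kern s (z.2.2 - z.2.1)) *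
      ((Icc a' b' ×ˢ ball x₀ ρ₁).indicator (fun _ => 1) (z.1, z.2.1) *
        ‖V (z.1, z.2.2) - V (z.1, z.2.1)‖ₑ ^ 2 + ‖g (z.1, z.2.2) - g (z.1, z.2.1)‖ₑ ^ 2) with hH
  have hHm : Measurable H := by
    refine Measurable.indicator ?_ (measurableSet_nearDiag r)
    have e1 : Measurable fun z : ℝ × Ed d × Ed d => (z.1, z.2.1) := by fun_prop
    have e2 : Measurable fun z : ℝ × Ed d × Ed d => (z.1, z.2.2) := by fun_prop
    have e3 : Measurable fun z : ℝ × Ed d × Ed d => kern s (z.2.2 - z.2.1) :=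
      (measurable_kern s).comp (by fun_prop)
    have e4 : Measurable fun z : ℝ × Ed d × Ed d =>
        (Icc a' b' ×ˢ ball x₀ ρ₁).indicator (fun _ => (1 : ℝ≥0∞)) (z.1, z.2.1) :=
      (measurable_const.indicator hm1).comp e1
    exact (e3.const_mul Λ).ennreal_ofReal.mul
      ((e4.mul (((hVm.comp e2).sub (hVm.comp e1)).enorm.pow_const 2)).add
        (((hgm.comp e2).sub (hgm.comp e1)).enorm.pow_const 2))
  have hpt : ∀ z ∈ nearDiag d r, ‖nonlocalForm K v g z‖ₑ ≤ H z := by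
    rintro ⟨t, x, y⟩ hz
    rw [hH, indicator_of_mem hz]
    simp only [nearDiag, mem_ofPred_eq] at hz
    rcases eq_or_ne x y with rfl | hxy
    · simp [nonlocalForm]
    by_cases hgg : g (t, x) = 0 ∧ g (t, y) = 0
    · simp [nonlocalForm, hgg.1, hgg.2]
    have hmem : (t, x) ∈ Icc a' b' ×ˢ closedBall x₀ ρ' ∨ (t, y) ∈ Icc a' b' ×ˢ closedBall x₀ ρ' := by
      by_contra hcon
      rw [not_or] at hcon
      exact hgg ⟨hg _ hcon.1, hg _ hcon.2⟩
    have hboth : t ∈ Icc a' b' ∧ x ∈ ball x₀ ρ₁ ∧ y ∈ ball x₀ ρ₁ := by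
      have e := norm_sub_rev x y
      rcases hmem with hm | hm
      · have h3 := hm.2
        simp only [mem_closedBall_iff_norm] at h3
        refine ⟨hm.1, ?_, ?_⟩
        · rw [mem_ball_iff_norm]
          linarith [norm_nonneg (y - x)]
        · rw [mem_ball_iff_norm]
          have : y - x₀ = (y - x) + (x - x₀) := by abel
          rw [this]
          linarith [norm_add_le (y - x) (x - x₀)]
      · have h3 := hm.2
        simp only [mem_closedBall_iff_norm] at h3
        refine ⟨hm.1, ?_, ?_⟩
        · rw [mem_ball_iff_norm]
          have : x - x₀ = (x - y) + (y - x₀) := by abel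
          rw [this]
          linarith [norm_add_le (x - y) (y - x₀)]
        · rw [mem_ball_iff_norm]
          linarith [norm_nonneg (y - x)]
    have hVx : V (t, x) = v t x := by
      rw [hV, indicator_of_mem
        (show (t, x) ∈ Ioo a b ×ˢ ball x₀ ρ from ⟨hab hboth.1, ball_subset_ball hρ₁ hboth.2.1⟩)]
    have hVy : V (t, y) = v t y := by
      rw [hV, indicator_of_mem
        (show (t, y) ∈ Ioo a b ×ˢ ball x₀ ρ from ⟨hab hboth.1, ball_subset_ball hρ₁ hboth.2.2⟩)]
    rw [indicator_of_mem (show (t, x) ∈ Icc a' b' ×ˢ ball x₀ ρ₁ from ⟨hboth.1, hboth.2.1⟩),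
      one_mul, hVx, hVy]
    simp only [nonlocalForm]
    rw [← ofReal_norm, ← ofReal_norm, ← ofReal_norm, ← ENNReal.ofReal_pow (norm_nonneg _),
      ← ENNReal.ofReal_pow (norm_nonneg _), ← ENNReal.ofReal_add (by positivity) (by positivity),
      ← ENNReal.ofReal_mul (mul_nonneg hΛ0 (kern_nonneg _ _))]
    refine ENNReal.ofReal_le_ofReal ?_
    rw [norm_mul, norm_mul, Real.norm_of_nonneg (hK.nonneg hΛ hxy), mul_comm,
      norm_sub_rev (v t x), norm_sub_rev (g (t, x))]
    refine mul_le_mul (hK.le_kern hxy) ?_ (by positivity) (mul_nonneg hΛ0 (kern_nonneg _ _))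
    nlinarith [sq_nonneg (‖v t y - v t x‖ - ‖g (t, y) - g (t, x)‖),
      sq_nonneg (‖v t y - v t x‖ + ‖g (t, y) - g (t, x)‖)]
  calc ∫⁻ z in nearDiag d r, ‖nonlocalForm K v g z‖ₑ
        ∂((volume.restrict S).prod (volume.prod volume))
      ≤ ∫⁻ z in nearDiag d r, H z ∂((volume.restrict S).prod (volume.prod volume)) :=
        setLIntegral_mono' (measurableSet_nearDiag r) hpt
    _ ≤ ∫⁻ z, H z ∂(volume.prod (volume.prod volume)) := by
        refine (setLIntegral_le_lintegral _ _).trans (lintegral_mono' ?_ le_rfl)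
        exact Measure.prod_mono Measure.restrict_le_self le_rfl
    _ = ∫⁻ z : Ed d, ∫⁻ p : ℝ × Ed d, H (p.1, p.2, p.2 + z) := lintegral_shear hHm
    _ ≤ ∫⁻ z : Ed d, (ball (0 : Ed d) r).indicator (fun z => ENNReal.ofReal Λ * (N₁ + N₂) *
          ENNReal.ofReal (‖z‖ ^ 2 * kern s z)) z := by
        refine lintegral_mono fun z => ?_
        by_cases hz : z ∈ ball (0 : Ed d) r
        · rw [indicator_of_mem hz]
          rw [mem_ball_zero_iff] at hz
          have e : ∀ p : ℝ × Ed d, H (p.1, p.2, p.2 + z) = ENNReal.ofReal (Λ * kern s z) *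
              ((Icc a' b' ×ˢ ball x₀ ρ₁).indicator (fun p => ‖V (p.1, p.2 + z) - V p‖ₑ ^ 2) p
                + ‖g (p.1, p.2 + z) - g p‖ₑ ^ 2) := by
            intro p
            rw [hH, indicator_of_mem (by simpa [nearDiag] using hz)]
            simp only [add_sub_cancel_left, Prod.mk.eta]
            by_cases hp : p ∈ Icc a' b' ×ˢ ball x₀ ρ₁
            · rw [indicator_of_mem hp, indicator_of_mem hp, one_mul]
            · rw [indicator_of_notMem hp, indicator_of_notMem hp, zero_mul]
          have hVm' : Measurable fun p : ℝ × Ed d => ‖V (p.1, p.2 + z) - V p‖ₑ ^ 2 :=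
            (((hVm.comp (by fun_prop : Measurable fun p : ℝ × Ed d => (p.1, p.2 + z))).sub
              hVm).enorm.pow_const 2)
          simp only [e]
          rw [lintegral_const_mul' _ _ ENNReal.ofReal_ne_top,
            lintegral_add_left (hVm'.indicator hm1), lintegral_indicator hm1]
          calc _ ≤ ENNReal.ofReal (Λ * kern s z) *
                (ENNReal.ofReal (‖z‖ ^ 2) * N₁ + ENNReal.ofReal (‖z‖ ^ 2) * N₂) := by
                gcongr
                · exact h1 z hz
                · exact h2 z
            _ = _ := by
                rw [ENNReal.ofReal_mul hΛ0, ENNReal.ofReal_mul (sq_nonneg _)]; ring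
        · rw [indicator_of_notMem hz]
          have e : ∀ p : ℝ × Ed d, H (p.1, p.2, p.2 + z) = 0 := by
            intro p
            rw [hH, indicator_of_notMem (by simpa [nearDiag] using hz)]
          simp [e]
    _ = _ := by
        rw [lintegral_indicator measurableSet_ball, lintegral_const_mul]
        exact (((measurable_norm.pow_const 2).mul (measurable_kern s))).ennreal_ofReal

end NonlocalTerm

section FarPart

lemma exists_kern_le_weight {s r ρ : ℝ} (hs : 0 < s) (hr : 0 < r) (hρ : 0 < ρ) (x₀ : Ed d) :
    ∃ C : ℝ, 0 ≤ C ∧ ∀ x ∈ ball x₀ ρ, ∀ y, r ≤ ‖y - x‖ →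
      kern s (y - x) ≤ C / (1 + ‖y‖ ^ ((d : ℝ) + 2 * s)) := by
  set p : ℝ := (d : ℝ) + 2 * s with hp
  have hp0 : 0 < p := by positivity
  set c : ℝ := 1 + (‖x₀‖ + ρ) / r with hc
  have hc0 : 0 ≤ c := by positivity
  refine ⟨r ^ (-p) + c ^ p, by positivity, fun x hx y hy => ?_⟩
  rw [mem_ball_iff_norm] at hx
  have hy0 : 0 < ‖y - x‖ := hr.trans_le hy
  have h1 : ‖y‖ ≤ c * ‖y - x‖ := by
    have e : y = (y - x) + (x - x₀) + x₀ := by abel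
    have h2 : ‖y‖ ≤ ‖y - x‖ + ‖x - x₀‖ + ‖x₀‖ := by
      conv_lhs => rw [e]
      exact (norm_add_le _ _).trans (by gcongr; exact norm_add_le _ _)
    have h3 : ‖x₀‖ + ρ ≤ (‖x₀‖ + ρ) / r * ‖y - x‖ := by
      rw [div_mul_eq_mul_div, le_div_iff₀ hr]
      gcongr
    rw [hc]; linarith
  have h2 : ‖y‖ ^ p ≤ c ^ p * ‖y - x‖ ^ p := by
    rw [← Real.mul_rpow hc0 hy0.le]
    exact Real.rpow_le_rpow (norm_nonneg _) h1 hp0.le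
  have h3 : 1 ≤ r ^ (-p) * ‖y - x‖ ^ p := by
    rw [Real.rpow_neg hr.le, inv_mul_eq_div, le_div_iff₀ (by positivity), one_mul]
    exact Real.rpow_le_rpow hr.le hy hp0.le
  rw [kern, ← hp, inv_eq_one_div, div_le_div_iff₀ (by positivity) (by positivity)]
  linarith

variable {T s Λ a b r ρ M : ℝ} {Ω : Set (Ed d)} {K : ℝ → Ed d → Ed d → ℝ} {v : ℝ → Ed d → ℝ}
  {Dv : ℝ → Ed d → Ed d} {x₀ : Ed d}

/-- Majorant for the nonlocal form away from the diagonal. -/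
def farWeight (s r : ℝ) (Q : Set (ℝ × Ed d)) (v : ℝ → Ed d → ℝ) (z : ℝ × Ed d × Ed d) : ℝ :=
  (nearDiag d r)ᶜ.indicator (fun z => (Q.indicator 1 (z.1, z.2.1) + Q.indicator 1 (z.1, z.2.2)) *
    ((|v z.1 z.2.1| + |v z.1 z.2.2|) * kern s (z.2.2 - z.2.1))) z

lemma measurable_farWeight {Q : Set (ℝ × Ed d)} (hQ : MeasurableSet Q)
    (hv : Measurable (Function.uncurry v)) : Measurable (farWeight s r Q v) := by
  have e1 : Measurable fun z : ℝ × Ed d × Ed d => (z.1, z.2.1) := by fun_prop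
  have e2 : Measurable fun z : ℝ × Ed d × Ed d => (z.1, z.2.2) := by fun_prop
  have h1 : Measurable fun z : ℝ × Ed d × Ed d => |v z.1 z.2.1| := (hv.comp e1).abs
  have h2 : Measurable fun z : ℝ × Ed d × Ed d => |v z.1 z.2.2| := (hv.comp e2).abs
  have hi : Measurable (Q.indicator (1 : ℝ × Ed d → ℝ)) := measurable_one.indicator hQ
  have hk : Measurable fun z : ℝ × Ed d × Ed d => kern s (z.2.2 - z.2.1) :=
    (measurable_kern s).comp (by fun_prop)
  exact (((hi.comp e1).add (hi.comp e2)).mul ((h1.add h2).mul hk)).indicator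
    (measurableSet_nearDiag r).compl

lemma lintegral_prod_mul_tail_lt_top (hreg : LocalWeakReg d s (Ioo 0 T) Ω v Dv)
    (hJ : Icc a b ⊆ Ioo 0 T) :
    ∫⁻ t in Ioo a b, ∫⁻ y : Ed d, ENNReal.ofReal (|v t y| / (1 + ‖y‖ ^ ((d : ℝ) + 2 * s))) < ⊤ := by
  set τ : ℝ → ℝ := fun t => ∫ y : Ed d, |v t y| / (1 + ‖y‖ ^ ((d : ℝ) + 2 * s)) with hτ
  have hm : Measurable fun p : ℝ × Ed d => |v p.1 p.2| / (1 + ‖p.2‖ ^ ((d : ℝ) + 2 * s)) :=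
    (hreg.meas.abs).div ((measurable_snd.norm.pow_const _).const_add 1)
  have hτm : StronglyMeasurable τ := hm.stronglyMeasurable.integral_prod_right'
  have h2 : MemLp τ 2 (volume.restrict (Ioo a b)) :=
    (memLp_two_iff_integrable_sq hτm.aestronglyMeasurable).2 (hreg.tail_l2 a b hJ)
  have h1 : Integrable τ (volume.restrict (Ioo a b)) := h2.integrable (by norm_num)
  have h3 : ∀ᵐ t ∂(volume.restrict (Ioo a b)),
      ∫⁻ y : Ed d, ENNReal.ofReal (|v t y| / (1 + ‖y‖ ^ ((d : ℝ) + 2 * s)))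
        = ENNReal.ofReal (τ t) := by
    filter_upwards [ae_restrict_of_ae hreg.tail_ae, ae_restrict_mem measurableSet_Ioo] with t h ht
    exact (ofReal_integral_eq_lintegral_ofReal (h (hJ (Ioo_subset_Icc_self ht)))
      (ae_of_all _ fun y => by positivity)).symm
  rw [lintegral_congr_ae h3]
  exact h1.lintegral_lt_top

lemma integrable_farWeight (hreg : LocalWeakReg d s (Ioo 0 T) Ω v Dv) (hs : 0 < s)
    (hJ : Icc a b ⊆ Ioo 0 T) (hr : 0 < r) (hρ : 0 < ρ)
    (hV : Integrable ((Ioo a b ×ˢ ball x₀ ρ).indicator fun p => v p.1 p.2)) :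
    Integrable (farWeight s r (Ioo a b ×ˢ ball x₀ ρ) v) := by
  set Q : Set (ℝ × Ed d) := Ioo a b ×ˢ ball x₀ ρ with hQ
  have hQm : MeasurableSet Q := measurableSet_Ioo.prod measurableSet_ball
  have hVm : Measurable (Q.indicator fun p => v p.1 p.2) := hreg.meas.indicator hQm
  obtain ⟨C, hC0, hC⟩ := exists_kern_le_weight hs hr hρ x₀
  obtain ⟨C', hC'0, hC'⟩ := exists_lintegral_kern_compl_le (d := d) hs
  have e1 : Measurable fun z : ℝ × Ed d × Ed d => (z.1, z.2.1) := by fun_prop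
  set E₁ : ℝ × Ed d × Ed d → ℝ≥0∞ := fun z =>
    ‖Q.indicator (fun p => v p.1 p.2) (z.1, z.2.1)‖ₑ *
      (ball (0 : Ed d) r)ᶜ.indicator (fun w => ENNReal.ofReal (kern s w)) (z.2.2 - z.2.1) with hE₁
  set E₂ : ℝ × Ed d × Ed d → ℝ≥0∞ := fun z => ENNReal.ofReal C *
    ((Ioo a b).indicator 1 z.1 * ((ball x₀ ρ).indicator 1 z.2.1 *
      ENNReal.ofReal (|v z.1 z.2.2| / (1 + ‖z.2.2‖ ^ ((d : ℝ) + 2 * s))))) with hE₂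
  have hkm : Measurable ((ball (0 : Ed d) r)ᶜ.indicator fun w => ENNReal.ofReal (kern s w)) :=
    (measurable_kern s).ennreal_ofReal.indicator measurableSet_ball.compl
  have hE₁m : Measurable E₁ := (hVm.comp e1).enorm.mul (hkm.comp (by fun_prop))
  have hwm : Measurable fun p : ℝ × Ed d =>
      ENNReal.ofReal (|v p.1 p.2| / (1 + ‖p.2‖ ^ ((d : ℝ) + 2 * s))) :=
    ((hreg.meas.abs).div ((measurable_snd.norm.pow_const _).const_add 1)).ennreal_ofReal
  have hi1 : Measurable ((Ioo a b).indicator (1 : ℝ → ℝ≥0∞)) :=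
    measurable_one.indicator measurableSet_Ioo
  have hi2 : Measurable ((ball x₀ ρ).indicator (1 : Ed d → ℝ≥0∞)) :=
    measurable_one.indicator measurableSet_ball
  have hE₂m : Measurable E₂ := by
    refine ((hi1.comp measurable_fst).mul ((hi2.comp (by fun_prop)).mul ?_)).const_mul _
    exact hwm.comp (by fun_prop : Measurable fun z : ℝ × Ed d × Ed d => (z.1, z.2.2))
  have hE₁fin : ∫⁻ z, E₁ z < ⊤ := by
    rw [lintegral_shear hE₁m]
    simp only [hE₁, add_sub_cancel_left, Prod.mk.eta]
    rw [lintegral_congr fun z => lintegral_mul_const _ hVm.enorm, lintegral_const_mul _ hkm,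
      lintegral_indicator measurableSet_ball.compl]
    exact ENNReal.mul_lt_top hV.2 ((hC' r hr).trans_lt ENNReal.ofReal_lt_top)
  have hE₂fin : ∫⁻ z, E₂ z < ⊤ := by
    rw [hE₂, lintegral_const_mul' _ _ ENNReal.ofReal_ne_top, Measure.volume_eq_prod,
      lintegral_prod]
    swap
    · refine ((hi1.comp measurable_fst).mul ((hi2.comp (by fun_prop)).mul ?_)).aemeasurable
      exact hwm.comp (by fun_prop : Measurable fun z : ℝ × Ed d × Ed d => (z.1, z.2.2))
    refine ENNReal.mul_lt_top ENNReal.ofReal_lt_top ?_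
    have h : ∀ t : ℝ, ∫⁻ w : Ed d × Ed d, (Ioo a b).indicator (1 : ℝ → ℝ≥0∞) t *
        ((ball x₀ ρ).indicator 1 w.1 *
          ENNReal.ofReal (|v t w.2| / (1 + ‖w.2‖ ^ ((d : ℝ) + 2 * s))))
        = (Ioo a b).indicator (fun t => volume (ball x₀ ρ) * ∫⁻ y : Ed d,
          ENNReal.ofReal (|v t y| / (1 + ‖y‖ ^ ((d : ℝ) + 2 * s)))) t := by
      intro t
      have ht : Measurable fun y : Ed d =>
          ENNReal.ofReal (|v t y| / (1 + ‖y‖ ^ ((d : ℝ) + 2 * s))) :=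
        hwm.comp measurable_prodMk_left
      by_cases hm : t ∈ Ioo a b
      · simp only [indicator_of_mem hm, Pi.one_apply, one_mul]
        rw [Measure.volume_eq_prod, lintegral_prod_mul hi2.aemeasurable ht.aemeasurable,
          lintegral_indicator_one measurableSet_ball]
      · simp [indicator_of_notMem hm]
    rw [lintegral_congr h, lintegral_indicator measurableSet_Ioo, lintegral_const_mul']
    · exact ENNReal.mul_lt_top measure_ball_lt_top (lintegral_prod_mul_tail_lt_top hreg hJ)
    · exact measure_ball_lt_top.ne
  have hpt : ∀ z, ‖farWeight s r Q v z‖ₑ ≤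
      (E₁ z + E₂ z) + (E₁ (z.1, z.2.2, z.2.1) + E₂ (z.1, z.2.2, z.2.1)) := by
    have key : ∀ (t : ℝ) (x y : Ed d), r ≤ ‖y - x‖ → (t, x) ∈ Q →
        ENNReal.ofReal ((|v t x| + |v t y|) * kern s (y - x)) ≤ E₁ (t, x, y) + E₂ (t, x, y) := by
      intro t x y hxy hx
      rw [add_mul, ENNReal.ofReal_add (mul_nonneg (abs_nonneg _) (kern_nonneg _ _))
        (mul_nonneg (abs_nonneg _) (kern_nonneg _ _))]
      refine add_le_add ?_ ?_
      · simp only [hE₁]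
        rw [indicator_of_mem hx, indicator_of_mem (by simpa using hxy),
          ENNReal.ofReal_mul (abs_nonneg _), ← Real.enorm_eq_ofReal_abs]
      · simp only [hE₂]
        rw [indicator_of_mem hx.1, indicator_of_mem (show x ∈ ball x₀ ρ from hx.2),
          Pi.one_apply, Pi.one_apply, one_mul, one_mul, ← ENNReal.ofReal_mul hC0]
        refine ENNReal.ofReal_le_ofReal ?_
        calc |v t y| * kern s (y - x) ≤ |v t y| * (C / (1 + ‖y‖ ^ ((d : ℝ) + 2 * s))) := by
              gcongr
              exact hC x hx.2 y hxy
          _ = _ := by ring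
    rintro ⟨t, x, y⟩
    by_cases hz : (t, x, y) ∈ (nearDiag d r)ᶜ
    · have hxy : r ≤ ‖y - x‖ := by simpa [nearDiag] using hz
      have hk : kern s (x - y) = kern s (y - x) := by rw [← kern_neg, neg_sub]
      have hyx : r ≤ ‖x - y‖ := by rwa [norm_sub_rev]
      rw [farWeight, indicator_of_mem hz, add_mul]
      refine (enorm_add_le _ _).trans (add_le_add ?_ ?_)
      · by_cases hx : (t, x) ∈ Q
        · rw [indicator_of_mem hx, Pi.one_apply, one_mul, Real.enorm_of_nonneg
            (mul_nonneg (by positivity) (kern_nonneg _ _))]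
          exact key t x y hxy hx
        · simp [indicator_of_notMem hx]
      · by_cases hy : (t, y) ∈ Q
        · rw [indicator_of_mem hy, Pi.one_apply, one_mul, Real.enorm_of_nonneg
            (mul_nonneg (by positivity) (kern_nonneg _ _)), add_comm |v t x|, ← hk]
          exact key t y x hyx hy
        · simp [indicator_of_notMem hy]
    · rw [farWeight, indicator_of_notMem hz]; simp
  refine ⟨(measurable_farWeight hQm hreg.meas).aestronglyMeasurable, ?_⟩
  refine (lintegral_mono hpt).trans_lt ?_
  rw [lintegral_add_left (f := fun z => E₁ z + E₂ z) (hE₁m.add hE₂m), lintegral_swap_space (fun z => E₁ z + E₂ z)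
    (hE₁m.add hE₂m), lintegral_add_left hE₁m]
  simp [hE₁fin, hE₂fin]

lemma norm_nonlocalForm_le_farWeight (hK : KernelHyp d s Λ K) (hΛ : 1 ≤ Λ) (hr : 0 < r)
    {Q : Set (ℝ × Ed d)} {g : ℝ × Ed d → ℝ} (hM : 0 ≤ M) (hg : ∀ p, |g p| ≤ M)
    (hgQ : ∀ p ∉ Q, g p = 0) {z : ℝ × Ed d × Ed d} (hz : z ∈ (nearDiag d r)ᶜ) :
    ‖nonlocalForm K v g z‖ ≤ M * Λ * farWeight s r Q v z := by
  obtain ⟨t, x, y⟩ := z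
  have hxy : r ≤ ‖y - x‖ := by simpa [nearDiag] using hz
  have hne : x ≠ y := by
    rintro rfl
    rw [sub_self, norm_zero] at hxy
    linarith
  have h1 : ∀ p, |g p| ≤ M * Q.indicator 1 p := fun p => by
    by_cases hp : p ∈ Q
    · rw [indicator_of_mem hp, Pi.one_apply, mul_one]; exact hg p
    · rw [hgQ p hp, indicator_of_notMem hp]; simp
  have h2 : ∀ p, (0 : ℝ) ≤ Q.indicator 1 p := fun p =>
    indicator_nonneg (fun _ _ => zero_le_one) p
  rw [farWeight, indicator_of_mem hz]
  simp only [nonlocalForm]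
  rw [norm_mul, norm_mul, Real.norm_of_nonneg (hK.nonneg hΛ hne), Real.norm_eq_abs,
    Real.norm_eq_abs]
  have e1 := abs_sub (v t x) (v t y)
  have e2 := abs_sub (g (t, x)) (g (t, y))
  have e3 := hK.le_kern (t := t) hne
  have e4 : |g (t, x) - g (t, y)| ≤ M * (Q.indicator 1 (t, x) + Q.indicator 1 (t, y)) := by
    linarith [h1 (t, x), h1 (t, y)]
  calc _ ≤ (|v t x| + |v t y|) * (M * (Q.indicator 1 (t, x) + Q.indicator 1 (t, y))) *
        (Λ * kern s (y - x)) := by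
        have := h2 (t, x)
        have := h2 (t, y)
        refine mul_le_mul (mul_le_mul e1 e4 (abs_nonneg _) (by positivity)) e3
          (hK.nonneg hΛ hne) (by positivity)
    _ = _ := by ring

lemma ae_space_pair {P : ℝ × Ed d → Prop} (h : ∀ᵐ p, P p) (S : Set ℝ) :
    ∀ᵐ z ∂((volume.restrict S).prod ((volume : Measure (Ed d)).prod (volume : Measure (Ed d)))),
      P (z.1, z.2.1) ∧ P (z.1, z.2.2) := by
  have hac : (volume.restrict S).prod ((volume : Measure (Ed d)).prod (volume : Measure (Ed d))) ≪
      (volume : Measure ℝ).prod ((volume : Measure (Ed d)).prod (volume : Measure (Ed d))) :=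
    Measure.AbsolutelyContinuous.prod Measure.restrict_le_self.absolutelyContinuous
      Measure.AbsolutelyContinuous.rfl
  have h1 : Measure.QuasiMeasurePreserving (fun z : ℝ × Ed d × Ed d => (z.1, z.2.1)) :=
    QuasiMeasurePreserving.prodMap
      (Measure.QuasiMeasurePreserving.id _) Measure.quasiMeasurePreserving_fst
  have h2 : Measure.QuasiMeasurePreserving (fun z : ℝ × Ed d × Ed d => (z.1, z.2.2)) :=
    QuasiMeasurePreserving.prodMap
      (Measure.QuasiMeasurePreserving.id _) Measure.quasiMeasurePreserving_snd
  exact hac.ae_le ((h1.ae h).and (h2.ae h))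

lemma integrable_nonlocalForm_far (hK : KernelHyp d s Λ K) (hΛ : 1 ≤ Λ) (hr : 0 < r)
    (hv : Measurable (Function.uncurry v)) {Q : Set (ℝ × Ed d)}
    (hfar : Integrable (farWeight s r Q v)) {g : ℝ × Ed d → ℝ} (hgm : Measurable g)
    (hM : 0 ≤ M) (hg : ∀ p, |g p| ≤ M) (hgQ : ∀ p ∉ Q, g p = 0) (S : Set ℝ) :
    IntegrableOn (nonlocalForm K v g) (nearDiag d r)ᶜ
      ((volume.restrict S).prod (volume.prod volume)) := by
  have h1 : Integrable (farWeight s r Q v) ((volume.restrict S).prod (volume.prod volume)) :=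
    hfar.mono_measure (Measure.prod_mono Measure.restrict_le_self le_rfl)
  refine Integrable.mono' (h1.integrableOn.const_mul (M * Λ))
    (measurable_nonlocalForm hK.meas hv hgm).aestronglyMeasurable ?_
  filter_upwards [ae_restrict_mem (measurableSet_nearDiag r).compl] with z hz
  exact norm_nonlocalForm_le_farWeight hK hΛ hr hM hg hgQ hz

lemma tendsto_integral_nonlocalForm_far (hK : KernelHyp d s Λ K) (hΛ : 1 ≤ Λ) (hr : 0 < r)
    (hv : Measurable (Function.uncurry v)) {Q : Set (ℝ × Ed d)}
    (hfar : Integrable (farWeight s r Q v)) {g : ℕ → ℝ × Ed d → ℝ} {g₀ : ℝ × Ed d → ℝ}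
    (hgm : ∀ n, Measurable (g n)) (hM : 0 ≤ M) (hg : ∀ᶠ n in atTop, ∀ p, |g n p| ≤ M)
    (hgQ : ∀ᶠ n in atTop, ∀ p ∉ Q, g n p = 0)
    (hlim : ∀ᵐ p, Tendsto (fun n => g n p) atTop (𝓝 (g₀ p))) (S : Set ℝ) :
    Tendsto (fun n => ∫ z in (nearDiag d r)ᶜ, nonlocalForm K v (g n) z
        ∂((volume.restrict S).prod (volume.prod volume))) atTop
      (𝓝 (∫ z in (nearDiag d r)ᶜ, nonlocalForm K v g₀ z
        ∂((volume.restrict S).prod (volume.prod volume)))) := by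
  have h1 : Integrable (farWeight s r Q v) ((volume.restrict S).prod (volume.prod volume)) :=
    hfar.mono_measure (Measure.prod_mono Measure.restrict_le_self le_rfl)
  refine tendsto_integral_filter_of_dominated_convergence (fun z => M * Λ * farWeight s r Q v z)
    (Eventually.of_forall fun n =>
      (measurable_nonlocalForm hK.meas hv (hgm n)).aestronglyMeasurable) ?_
    (h1.integrableOn.const_mul (M * Λ)) ?_
  · filter_upwards [hg, hgQ] with n hn hnQ
    filter_upwards [ae_restrict_mem (measurableSet_nearDiag r).compl] with z hz
    exact norm_nonlocalForm_le_farWeight hK hΛ hr hM hn hnQ hz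
  · filter_upwards [ae_restrict_of_ae (ae_space_pair hlim S)] with z hz
    exact ((hz.1.sub hz.2).const_mul _).mul_const _

end FarPart

section Cutoffs

/-- A smooth cutoff in time supported in `[a', b'] ⊂ (a, b)`, whose derivative is bounded from
above by a function `m` of mass at most one. -/
structure IsTimeCutoff (a b a' b' : ℝ) (ζ m : ℝ → ℝ) : Prop where
  smooth : ContDiff ℝ (⊤ : ℕ∞) ζ
  nonneg : ∀ t, 0 ≤ ζ t
  le_one : ∀ t, ζ t ≤ 1
  eq_zero : ∀ t ∉ Icc a' b', ζ t = 0
  subset : Icc a' b' ⊆ Ioo a b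
  deriv_le : ∀ t, deriv ζ t ≤ m t
  majorant_nonneg : ∀ t, 0 ≤ m t
  majorant_integrable : IntegrableOn m (Ioo a b)
  majorant_mass : ∫ t in Ioo a b, m t ≤ 1

/-- A smooth cutoff in space supported in a ball of radius `ρ`, with Lipschitz constant `L`. -/
structure IsSpaceCutoff (x₀ : Ed d) (ρ L : ℝ) (η : Ed d → ℝ) : Prop where
  smooth : ContDiff ℝ (⊤ : ℕ∞) η
  nonneg : ∀ x, 0 ≤ η x
  le_one : ∀ x, η x ≤ 1
  eq_zero : ∀ x ∉ closedBall x₀ ρ, η x = 0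
  lip : ∀ x y, |η x - η y| ≤ L * ‖x - y‖
  norm_gradient_le : ∀ x, ‖gradient η x‖ ≤ L

lemma exists_isSpaceCutoff (d : ℕ) : ∃ C : ℝ, 0 < C ∧ ∀ (x₀ : Ed d) (R : ℝ), 0 < R →
    ∃ η : Ed d → ℝ, IsSpaceCutoff x₀ (3 * R / 2) (C / R) η ∧ ∀ x ∈ ball x₀ R, η x = 1 := by
  let f : ContDiffBump (0 : Ed d) := ⟨1, 3 / 2, by norm_num, by norm_num⟩
  have hf : ContDiff ℝ 1 (f : Ed d → ℝ) := f.contDiff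
  obtain ⟨C, hC⟩ := hf.lipschitzWith_of_hasCompactSupport f.hasCompactSupport (by norm_num)
  refine ⟨C + 1, by positivity, fun x₀ R hR => ⟨fun x => f (R⁻¹ • (x - x₀)), ?_, fun x hx => ?_⟩⟩
  · have hlip : ∀ x y, |f (R⁻¹ • (x - x₀)) - f (R⁻¹ • (y - x₀))| ≤ (C + 1) / R * ‖x - y‖ := by
      intro x y
      have h := hC.dist_le_mul (R⁻¹ • (x - x₀)) (R⁻¹ • (y - x₀))
      rw [Real.dist_eq, dist_eq_norm, ← smul_sub, sub_sub_sub_cancel_right, norm_smul,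
        Real.norm_of_nonneg (by positivity)] at h
      refine h.trans ?_
      rw [div_eq_mul_inv, mul_assoc]
      gcongr
      linarith
    have hsm : ContDiff ℝ (⊤ : ℕ∞) fun x => f (R⁻¹ • (x - x₀)) :=
      f.contDiff.comp ((contDiff_id.sub contDiff_const).const_smul R⁻¹)
    refine ⟨hsm, fun x => f.nonneg, fun x => f.le_one, fun x hx => ?_, hlip, fun x => ?_⟩
    · refine f.zero_of_le_dist ?_
      rw [mem_closedBall_iff_norm, not_le] at hx
      rw [dist_zero_right, norm_smul, Real.norm_of_nonneg (by positivity), inv_mul_eq_div,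
        le_div_iff₀ hR]
      have : f.rOut = 3 / 2 := rfl
      rw [this]; linarith
    · rw [gradient, LinearIsometryEquiv.norm_map]
      have hL : LipschitzWith (Real.toNNReal ((C + 1) / R)) fun x => f (R⁻¹ • (x - x₀)) :=
        LipschitzWith.of_dist_le_mul fun x y => by
          rw [Real.dist_eq, dist_eq_norm, Real.coe_toNNReal _ (by positivity)]
          exact hlip x y
      have := norm_fderiv_le_of_lipschitz ℝ (x₀ := x) hL
      rwa [Real.coe_toNNReal _ (by positivity)] at this
  · refine f.one_of_mem_closedBall ?_
    rw [mem_ball_iff_norm] at hx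
    rw [mem_closedBall_zero_iff, norm_smul, Real.norm_of_nonneg (by positivity), inv_mul_eq_div,
      div_le_iff₀ hR]
    have : f.rIn = 1 := rfl
    rw [this]; linarith

lemma exists_isTimeCutoff {b R κ : ℝ} (hR : 0 < R) (hκ : 0 < κ) :
    ∃ ζ m : ℝ → ℝ, IsTimeCutoff (b - 4 * R ^ 2) b (b - 3 * R ^ 2) (b - κ) ζ m ∧
      ∀ t ∈ Icc (b - R ^ 2) (b - 2 * κ), ζ t = 1 := by
  have hR2 : 0 < R ^ 2 := by positivity
  set μ : ℝ → ℝ := fun t => Real.smoothTransition ((t - (b - 3 * R ^ 2)) / (2 * R ^ 2)) with hμ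
  set ν : ℝ → ℝ := fun t => Real.smoothTransition ((b - κ - t) / κ) with hν
  have hμs : ContDiff ℝ (⊤ : ℕ∞) μ :=
    Real.smoothTransition.contDiff.comp ((contDiff_id.sub contDiff_const).div_const _)
  have hνs : ContDiff ℝ (⊤ : ℕ∞) ν :=
    Real.smoothTransition.contDiff.comp ((contDiff_const.sub contDiff_id).div_const _)
  have hμm : Monotone μ := fun x y hxy => Real.smoothTransition.monotone (by gcongr)
  have hνm : Antitone ν := fun x y hxy => Real.smoothTransition.monotone (by gcongr)
  have hμd : Differentiable ℝ μ := hμs.differentiable (by simp)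
  have hνd : Differentiable ℝ ν := hνs.differentiable (by simp)
  have hμ' : ∀ t, 0 ≤ deriv μ t := fun t => hμm.deriv_nonneg
  have hν' : ∀ t, deriv ν t ≤ 0 := fun t => hνm.deriv_nonpos
  have hc : Continuous (deriv μ) := hμs.continuous_deriv (by simp)
  refine ⟨fun t => μ t * ν t, deriv μ, ⟨hμs.mul hνs, fun t => ?_, fun t => ?_, fun t ht => ?_,
    fun t ht => ⟨by linarith [ht.1], by linarith [ht.2]⟩, fun t => ?_, hμ', ?_, ?_⟩, fun t ht => ?_⟩
  · exact mul_nonneg (Real.smoothTransition.nonneg _) (Real.smoothTransition.nonneg _)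
  · exact mul_le_one₀ (Real.smoothTransition.le_one _) (Real.smoothTransition.nonneg _)
      (Real.smoothTransition.le_one _)
  · rw [mem_Icc, not_and_or, not_le, not_le] at ht
    rcases ht with ht | ht
    · have : μ t = 0 := Real.smoothTransition.zero_of_nonpos
        (div_nonpos_of_nonpos_of_nonneg (by linarith) (by positivity))
      rw [this, zero_mul]
    · have : ν t = 0 := Real.smoothTransition.zero_of_nonpos
        (div_nonpos_of_nonpos_of_nonneg (by linarith) (by positivity))
      rw [this, mul_zero]
  · have h := ((hμd t).hasDerivAt.mul (hνd t).hasDerivAt).deriv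
    change deriv (μ * ν) t ≤ _
    rw [h]
    have h1 : ν t ≤ 1 := Real.smoothTransition.le_one _
    have h2 : 0 ≤ μ t := Real.smoothTransition.nonneg _
    nlinarith [hμ' t, hν' t, mul_nonneg h2 (neg_nonneg.2 (hν' t))]
  · exact (hc.integrableOn_Icc).mono_set Ioo_subset_Icc_self
  · rw [← integral_Ioc_eq_integral_Ioo, ← intervalIntegral.integral_of_le (by linarith),
      intervalIntegral.integral_deriv_eq_sub (fun t _ => hμd t) (hc.intervalIntegrable _ _)]
    have h1 : μ b ≤ 1 := Real.smoothTransition.le_one _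
    have h2 : 0 ≤ μ (b - 4 * R ^ 2) := Real.smoothTransition.nonneg _
    linarith
  · have h1 : μ t = 1 := Real.smoothTransition.one_of_one_le (by
      rw [le_div_iff₀ (by positivity)]; linarith [ht.1])
    have h2 : ν t = 1 := Real.smoothTransition.one_of_one_le (by
      rw [le_div_iff₀ hκ]; linarith [ht.2])
    simp only [h1, h2, mul_one]

end Cutoffs

section PotentialTest

variable {ζ m : ℝ → ℝ} {η : Ed d → ℝ} {ε h : ℝ} {a b a' b' ρ ρ' L : ℝ} {x₀ : Ed d}

/-- The test function `ζ η² F(u)`. -/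
def potTest (ζ : ℝ → ℝ) (η : Ed d → ℝ) (ε h : ℝ) (u : ℝ × Ed d → ℝ) (p : ℝ × Ed d) : ℝ :=
  ζ p.1 * (η p.2 ^ 2 * potF ε h (u p))

/-- The spatial gradient of `ζ η² F(u)`, where `w` is the spatial gradient of `u`. -/
def potGrad (ζ : ℝ → ℝ) (η : Ed d → ℝ) (ε h : ℝ) (u : ℝ × Ed d → ℝ) (w : ℝ × Ed d → Ed d)
    (p : ℝ × Ed d) : Ed d :=
  ζ p.1 • ((2 * η p.2 * potF ε h (u p)) • gradient η p.2 - (η p.2 ^ 2 * potF' ε h (u p)) • w p)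

lemma contDiff_potTest {k : WithTop ℕ∞} (hζ : ContDiff ℝ k ζ) (hη : ContDiff ℝ k η)
    {u : ℝ × Ed d → ℝ} (hu : ContDiff ℝ k u) (hu0 : ∀ p, 0 ≤ u p) (hε : 0 < ε) (hh : ε ≤ h) :
    ContDiff ℝ k (potTest ζ η ε h u) := by
  have h1 : ContDiff ℝ k fun p => (u p + ε)⁻¹ :=
    (hu.add contDiff_const).inv fun p => by linarith [hu0 p]
  have h2 : ContDiff ℝ k fun p => (u p + h)⁻¹ :=
    (hu.add contDiff_const).inv fun p => by linarith [hu0 p]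
  exact (hζ.comp contDiff_fst).mul (((hη.comp contDiff_snd).pow 2).mul (h1.sub h2))

lemma fderiv_potTest (hζ : ContDiff ℝ 1 ζ) (hη : ContDiff ℝ 1 η)
    {u : ℝ × Ed d → ℝ} (hu : ContDiff ℝ 1 u) (hu0 : ∀ p, 0 ≤ u p) (hε : 0 < ε) (hh : ε ≤ h)
    (p : ℝ × Ed d) (τ : ℝ) (e : Ed d) :
    fderiv ℝ (potTest ζ η ε h u) p (τ, e) =
      τ * deriv ζ p.1 * (η p.2 ^ 2 * potF ε h (u p)) +
        ζ p.1 * (2 * η p.2 * potF ε h (u p) * ⟪gradient η p.2, e⟫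
          - η p.2 ^ 2 * potF' ε h (u p) * fderiv ℝ u p (τ, e)) := by
  have h1 : HasFDerivAt (fun p : ℝ × Ed d => ζ p.1)
      ((ContinuousLinearMap.toSpanSingleton ℝ (deriv ζ p.1)).comp
        (ContinuousLinearMap.fst ℝ ℝ (Ed d))) p :=
    (hζ.differentiable (by norm_num) p.1).hasDerivAt.hasFDerivAt.comp p hasFDerivAt_fst
  have h2 : HasFDerivAt (fun p : ℝ × Ed d => η p.2)
      ((fderiv ℝ η p.2).comp (ContinuousLinearMap.snd ℝ ℝ (Ed d))) p :=
    (hη.differentiable (by norm_num) p.2).hasFDerivAt.comp p hasFDerivAt_snd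
  have h3 : HasFDerivAt (fun p => potF ε h (u p)) ((-potF' ε h (u p)) • fderiv ℝ u p) p :=
    (hasDerivAt_potF hε hh (hu0 p)).comp_hasFDerivAt p
      (hu.differentiable (by norm_num) p).hasFDerivAt
  have h4 := h1.mul ((h2.pow 2).mul h3)
  have h5 : fderiv ℝ (potTest ζ η ε h u) p = _ := h4.fderiv
  have h6 : ⟪gradient η p.2, e⟫ = fderiv ℝ η p.2 e := by
    rw [gradient, InnerProductSpace.toDual_symm_apply]
  rw [h5, h6]
  simp
  ring

lemma fderiv_potTest_space (hζ : ContDiff ℝ 1 ζ) (hη : ContDiff ℝ 1 η)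
    {u : ℝ × Ed d → ℝ} (hu : ContDiff ℝ 1 u) (hu0 : ∀ p, 0 ≤ u p) (hε : 0 < ε) (hh : ε ≤ h)
    {w : ℝ × Ed d → Ed d} {p : ℝ × Ed d} (e : Ed d)
    (hw : ζ p.1 ≠ 0 → η p.2 ≠ 0 → fderiv ℝ u p (0, e) = ⟪w p, e⟫) :
    fderiv ℝ (potTest ζ η ε h u) p (0, e) = ⟪potGrad ζ η ε h u w p, e⟫ := by
  rw [fderiv_potTest hζ hη hu hu0 hε hh, potGrad, real_inner_smul_left, inner_sub_left,
    real_inner_smul_left, real_inner_smul_left]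
  by_cases h1 : ζ p.1 = 0
  · simp [h1]
  by_cases h2 : η p.2 = 0
  · simp [h2]
  rw [hw h1 h2]
  ring

lemma potTest_eq_zero (hζ : IsTimeCutoff a b a' b' ζ m) (hη : IsSpaceCutoff x₀ ρ' L η)
    {u : ℝ × Ed d → ℝ} {p : ℝ × Ed d} (hp : p ∉ Icc a' b' ×ˢ closedBall x₀ ρ') :
    potTest ζ η ε h u p = 0 := by
  rw [mem_prod, not_and_or] at hp
  rcases hp with hp | hp
  · simp [potTest, hζ.eq_zero _ hp]
  · simp [potTest, hη.eq_zero _ hp]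

lemma isCompact_cylinder (a' b' ρ' : ℝ) (x₀ : Ed d) :
    IsCompact (Icc a' b' ×ˢ closedBall x₀ ρ') :=
  isCompact_Icc.prod (isCompact_closedBall x₀ ρ')

lemma potTest_nonneg (hζ : IsTimeCutoff a b a' b' ζ m) {u : ℝ × Ed d → ℝ} {p : ℝ × Ed d}
    (hu0 : 0 ≤ u p) (hε : 0 < ε) (hh : ε ≤ h) : 0 ≤ potTest ζ η ε h u p :=
  mul_nonneg (hζ.nonneg _) (mul_nonneg (sq_nonneg _) (potF_nonneg hε hh hu0))

lemma potTest_le (hζ : IsTimeCutoff a b a' b' ζ m) (hη : IsSpaceCutoff x₀ ρ' L η)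
    {u : ℝ × Ed d → ℝ} {p : ℝ × Ed d} (hu0 : 0 ≤ u p) (hε : 0 < ε) (hh : ε ≤ h) :
    potTest ζ η ε h u p ≤ ε⁻¹ := by
  have h1 : η p.2 ^ 2 ≤ 1 := pow_le_one₀ (hη.nonneg _) (hη.le_one _)
  have h2 := potF_nonneg hε hh hu0
  have h3 := potF_le hε hh hu0
  calc potTest ζ η ε h u p ≤ 1 * (1 * potF ε h (u p)) := by
        refine mul_le_mul (hζ.le_one _) (mul_le_mul_of_nonneg_right h1 h2)
          (mul_nonneg (sq_nonneg _) h2) zero_le_one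
    _ ≤ _ := by linarith

lemma neg_log_mul_volume_le_integral_time (hζ : IsTimeCutoff a b a' b' ζ m)
    (hη : IsSpaceCutoff x₀ ρ' L η) (hρ : ρ' < ρ) {u : ℝ × Ed d → ℝ} (hu : ContDiff ℝ 1 u)
    (hu0 : ∀ p, 0 ≤ u p) (hε : 0 < ε) (hh : ε ≤ h) :
    -Real.log (h / ε) * volume.real (ball x₀ ρ) ≤
      ∫ p, u p * fderiv ℝ (potTest ζ η ε h u) p (1, 0) := by
  set ψ := potTest ζ η ε h u with hψ
  have hζ1 : ContDiff ℝ 1 ζ := hζ.smooth.of_le (by exact_mod_cast le_top)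
  have hη1 : ContDiff ℝ 1 η := hη.smooth.of_le (by exact_mod_cast le_top)
  have hψ1 : ContDiff ℝ 1 ψ := contDiff_potTest hζ1 hη1 hu hu0 hε hh
  have hS := isCompact_cylinder a' b' ρ' x₀
  have hψc : HasCompactSupport ψ := HasCompactSupport.intro hS fun p hp => potTest_eq_zero hζ hη hp
  have hud : Differentiable ℝ u := hu.differentiable (by norm_num)
  have hψd : Differentiable ℝ ψ := hψ1.differentiable (by norm_num)
  have cu' : Continuous fun p => fderiv ℝ u p (1, 0) :=
    (hu.continuous_fderiv (by norm_num)).clm_apply continuous_const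
  have cψ' : Continuous fun p => fderiv ℝ ψ p (1, 0) :=
    (hψ1.continuous_fderiv (by norm_num)).clm_apply continuous_const
  have hψc' : HasCompactSupport fun p => fderiv ℝ ψ p (1, 0) := hψc.fderiv_apply ℝ _
  have hdG : ∀ p, HasFDerivAt (fun p => potG ε h (u p)) (potF ε h (u p) • fderiv ℝ u p) p :=
    fun p => (hasDerivAt_potG hε hh (hu0 p)).comp_hasFDerivAt p (hud p).hasFDerivAt
  have cG : Continuous fun p => potG ε h (u p) :=
    continuous_iff_continuousAt.2 fun p => (hdG p).continuousAt
  have cF : Continuous fun p => potF ε h (u p) := continuous_iff_continuousAt.2 fun p =>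
    ((hasDerivAt_potF hε hh (hu0 p)).continuousAt).comp (f := u) hud.continuous.continuousAt
  set χ : ℝ × Ed d → ℝ := fun p => ζ p.1 * (η p.2 ^ 2 * potG ε h (u p)) with hχ
  have hsupp : ∀ f : ℝ × Ed d → ℝ, (∀ p, ζ p.1 = 0 → f p = 0) → (∀ p, η p.2 = 0 → f p = 0) →
      HasCompactSupport f := fun f h1 h2 => HasCompactSupport.intro hS fun p hp => by
    rw [mem_prod, not_and_or] at hp
    rcases hp with hp | hp
    · exact h1 p (hζ.eq_zero _ hp)
    · exact h2 p (hη.eq_zero _ hp)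
  have cζ : Continuous fun p : ℝ × Ed d => ζ p.1 := hζ.smooth.continuous.comp continuous_fst
  have cη : Continuous fun p : ℝ × Ed d => η p.2 := hη.smooth.continuous.comp continuous_snd
  have cζ' : Continuous fun p : ℝ × Ed d => deriv ζ p.1 :=
    (hζ1.continuous_deriv le_rfl).comp continuous_fst
  have hζ'0 : ∀ t ∉ Icc a' b', deriv ζ t = 0 := fun t ht => by
    have : ζ =ᶠ[𝓝 t] fun _ => 0 := by
      filter_upwards [isClosed_Icc.isOpen_compl.mem_nhds ht] with q hq using hζ.eq_zero q hq
    rw [this.deriv_eq]; simp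
  have cχ : Continuous χ := cζ.mul ((cη.pow 2).mul cG)
  have hdχ : ∀ p, HasFDerivAt χ (fderiv ℝ χ p) p ∧ fderiv ℝ χ p (1, 0) =
      deriv ζ p.1 * (η p.2 ^ 2 * potG ε h (u p)) + fderiv ℝ u p (1, 0) * ψ p := by
    intro p
    have h1 : HasFDerivAt (fun p : ℝ × Ed d => ζ p.1)
        ((ContinuousLinearMap.toSpanSingleton ℝ (deriv ζ p.1)).comp
          (ContinuousLinearMap.fst ℝ ℝ (Ed d))) p :=
      (hζ1.differentiable (by norm_num) p.1).hasDerivAt.hasFDerivAt.comp p hasFDerivAt_fst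
    have h2 : HasFDerivAt (fun p : ℝ × Ed d => η p.2)
        ((fderiv ℝ η p.2).comp (ContinuousLinearMap.snd ℝ ℝ (Ed d))) p :=
      (hη1.differentiable (by norm_num) p.2).hasFDerivAt.comp p hasFDerivAt_snd
    have h4 := h1.mul ((h2.pow 2).mul (hdG p))
    have h5 : fderiv ℝ χ p = _ := h4.fderiv
    refine ⟨h4.differentiableAt.hasFDerivAt, ?_⟩
    rw [h5, hψ, potTest]
    simp
    ring
  have cT : Continuous fun p : ℝ × Ed d => deriv ζ p.1 * (η p.2 ^ 2 * potG ε h (u p)) :=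
    cζ'.mul ((cη.pow 2).mul cG)
  have hT : Integrable fun p : ℝ × Ed d => deriv ζ p.1 * (η p.2 ^ 2 * potG ε h (u p)) := by
    refine cT.integrable_of_hasCompactSupport (HasCompactSupport.intro hS fun p hp => ?_)
    rw [mem_prod, not_and_or] at hp
    rcases hp with hp | hp
    · rw [hζ'0 _ hp, zero_mul]
    · rw [hη.eq_zero _ hp]; simp
  have hUψ : Integrable fun p => fderiv ℝ u p (1, 0) * ψ p :=
    (cu'.mul hψ1.continuous).integrable_of_hasCompactSupport hψc.mul_left
  have hχ' : Integrable fun p => fderiv ℝ χ p (1, 0) :=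
    (hT.add hUψ).congr (ae_of_all _ fun p => ((hdχ p).2).symm)
  have hχi : Integrable χ := cχ.integrable_of_hasCompactSupport
    (hsupp χ (fun p hp => by simp [hχ, hp]) fun p hp => by simp [hχ, hp])
  have hzero : ∫ p, fderiv ℝ χ p (1, 0) = 0 := by
    have := integral_mul_fderiv_eq_neg_fderiv_mul_of_integrable (μ := volume)
      (f := fun _ : ℝ × Ed d => (1 : ℝ)) (g := χ) (v := ((1 : ℝ), (0 : Ed d)))
      (by simp) (by simpa using hχ') (by simpa using hχi)
      (fun _ _ => differentiableAt_const _) (fun p _ => (hdχ p).1.differentiableAt)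
    simpa using this
  have hparts : ∫ p, u p * fderiv ℝ ψ p (1, 0) = -∫ p, fderiv ℝ u p (1, 0) * ψ p :=
    integral_mul_fderiv_eq_neg_fderiv_mul_of_integrable hUψ
      ((hu.continuous.mul cψ').integrable_of_hasCompactSupport hψc'.mul_left)
      ((hu.continuous.mul hψ1.continuous).integrable_of_hasCompactSupport hψc.mul_left) (fun p _ => hud p)
      (fun p _ => hψd p)
  have hsum : ∫ p, u p * fderiv ℝ ψ p (1, 0)
      = ∫ p : ℝ × Ed d, deriv ζ p.1 * (η p.2 ^ 2 * potG ε h (u p)) := by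
    rw [integral_congr_ae (ae_of_all _ fun p => (hdχ p).2), integral_add hT hUψ] at hzero
    rw [hparts]; linarith
  rw [hsum]
  have hlog : 0 ≤ Real.log (h / ε) := Real.log_nonneg (by rwa [le_div_iff₀ hε, one_mul])
  have hmi : Integrable fun p : ℝ × Ed d =>
      (Ioo a b).indicator m p.1 * (ball x₀ ρ).indicator 1 p.2 := by
    refine Integrable.mul_prod ((integrable_indicator_iff measurableSet_Ioo).2
      hζ.majorant_integrable) ?_
    exact (integrable_indicator_iff measurableSet_ball).2
      (integrableOn_const measure_ball_lt_top.ne)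
  calc -Real.log (h / ε) * volume.real (ball x₀ ρ)
      ≤ -Real.log (h / ε) * ((∫ t in Ioo a b, m t) * volume.real (ball x₀ ρ)) := by
        have := hζ.majorant_mass
        have h0 : 0 ≤ volume.real (ball x₀ ρ) := measureReal_nonneg
        nlinarith [mul_nonneg hlog h0]
    _ = ∫ p : ℝ × Ed d, -Real.log (h / ε) *
          ((Ioo a b).indicator m p.1 * (ball x₀ ρ).indicator 1 p.2) := by
        rw [integral_const_mul, Measure.volume_eq_prod, integral_prod_mul
          ((Ioo a b).indicator m) ((ball x₀ ρ).indicator (1 : Ed d → ℝ)),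
          integral_indicator measurableSet_Ioo, integral_indicator_one measurableSet_ball]
    _ ≤ _ := by
        refine integral_mono (hmi.const_mul _) hT fun p => ?_
        have hG := neg_log_le_potG hε hh (hu0 p)
        have hG0 := potG_nonpos hε hh (hu0 p)
        by_cases hp : p ∈ Icc a' b' ×ˢ closedBall x₀ ρ'
        · have e1 := hζ.subset hp.1
          have e2 : p.2 ∈ ball x₀ ρ := closedBall_subset_ball hρ hp.2
          simp only
          rw [indicator_of_mem e1, indicator_of_mem e2, Pi.one_apply, mul_one]
          have e3 : η p.2 ^ 2 ≤ 1 := pow_le_one₀ (hη.nonneg _) (hη.le_one _)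
          have e4 := hζ.deriv_le p.1
          have e5 := hζ.majorant_nonneg p.1
          have e6 : η p.2 ^ 2 * potG ε h (u p) ≤ 0 :=
            mul_nonpos_of_nonneg_of_nonpos (sq_nonneg _) hG0
          have e7 : -Real.log (h / ε) ≤ η p.2 ^ 2 * potG ε h (u p) := by
            nlinarith [sq_nonneg (η p.2)]
          nlinarith [mul_nonneg (sub_nonneg.2 e4) (neg_nonneg.2 e6)]
        · have h0 : deriv ζ p.1 * (η p.2 ^ 2 * potG ε h (u p)) = 0 := by
            rw [mem_prod, not_and_or] at hp
            rcases hp with hp | hp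
            · rw [hζ'0 _ hp, zero_mul]
            · rw [hη.eq_zero _ hp]; simp
          simp only [h0]
          refine mul_nonpos_of_nonpos_of_nonneg (by linarith) (mul_nonneg ?_ ?_)
          · exact indicator_nonneg (fun t _ => hζ.majorant_nonneg t) _
          · exact indicator_nonneg (fun _ _ => zero_le_one) _

end PotentialTest

section LocalSupersolution

lemma tendsto_mol_L2_of_tendsto {X F : Type*} [NormedAddCommGroup X] [NormedSpace ℝ X]
    [FiniteDimensional ℝ X] [MeasureSpace X] [BorelSpace X] [(volume : Measure X).IsAddHaarMeasure]
    [NormedAddCommGroup F] [NormedSpace ℝ F] [CompleteSpace F] {f : ℕ → X → F} {g : X → F}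
    (hf : ∀ n, MemLp (f n) 2) (hg : MemLp g 2)
    (h : Tendsto (fun n => ∫⁻ p, ‖f n p - g p‖ₑ ^ 2) atTop (𝓝 0)) :
    Tendsto (fun n => ∫⁻ p, ‖mol n (f n) p - g p‖ₑ ^ 2) atTop (𝓝 0) := by
  have hle : ∀ n, ∫⁻ p, ‖mol n (f n) p - g p‖ₑ ^ 2 ≤
      (2 * ∫⁻ p, ‖f n p - g p‖ₑ ^ 2) + 2 * ∫⁻ p, ‖mol n g p - g p‖ₑ ^ 2 := by
    intro n
    have hfl := (hf n).locallyIntegrable (by norm_num)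
    have hgl := hg.locallyIntegrable (by norm_num)
    have hc : Continuous (mol n fun q => f n q - g q) :=
      (contDiff_mol n (hfl.sub hgl)).continuous
    calc ∫⁻ p, ‖mol n (f n) p - g p‖ₑ ^ 2
        ≤ ∫⁻ p, (2 * ‖mol n (fun q => f n q - g q) p‖ₑ ^ 2 + 2 * ‖mol n g p - g p‖ₑ ^ 2) := by
          refine lintegral_mono fun p => ?_
          have e : mol n (f n) p - g p =
              mol n (fun q => f n q - g q) p + (mol n g p - g p) := by
            rw [mol_sub n hfl hgl]; abel
          rw [e]
          exact enorm_add_sq_le _ _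
      _ = (2 * ∫⁻ p, ‖mol n (fun q => f n q - g q) p‖ₑ ^ 2) +
            2 * ∫⁻ p, ‖mol n g p - g p‖ₑ ^ 2 := by
          have hm : AEMeasurable (fun p => 2 * ‖mol n (fun q => f n q - g q) p‖ₑ ^ 2) volume :=
            (hc.enorm.aemeasurable.pow_const 2).const_mul 2
          rw [lintegral_add_left' hm, lintegral_const_mul' _ _ (by norm_num),
            lintegral_const_mul' _ _ (by norm_num)]
      _ ≤ _ := by
          have := lintegral_mol_sq_le n ((hf n).1.sub hg.1)
          exact add_le_add (mul_le_mul_right this 2) le_rfl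
  refine tendsto_of_tendsto_of_tendsto_of_le_of_le tendsto_const_nhds ?_ (fun _ => zero_le)
    hle
  have h1 := ENNReal.Tendsto.const_mul (a := 2) h (Or.inr (by norm_num))
  have h2 := ENNReal.Tendsto.const_mul (a := 2) (tendsto_mol_L2 hg) (Or.inr (by norm_num))
  simpa using h1.add h2

lemma exists_subseq_tendsto_ae_of_lintegral_sq {α F : Type*} [MeasurableSpace α]
    [NormedAddCommGroup F] {μ : Measure α} {f : ℕ → α → F} {g : α → F}
    (hf : ∀ n, AEStronglyMeasurable (f n) μ) (hg : AEStronglyMeasurable g μ)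
    (h : Tendsto (fun n => ∫⁻ p, ‖f n p - g p‖ₑ ^ 2 ∂μ) atTop (𝓝 0)) :
    ∃ ns : ℕ → ℕ, StrictMono ns ∧ ∀ᵐ p ∂μ, Tendsto (fun n => f (ns n) p) atTop (𝓝 (g p)) := by
  refine (tendstoInMeasure_of_tendsto_eLpNorm (p := 2) (by norm_num) hf hg ?_).exists_seq_tendsto_ae
  have e : ∀ n, eLpNorm (f n - g) 2 μ = (∫⁻ p, ‖f n p - g p‖ₑ ^ 2 ∂μ) ^ (1 / 2 : ℝ) := fun n => by
    rw [← eLpNorm_two_sq μ fun p => f n p - g p, ← ENNReal.rpow_natCast, ← ENNReal.rpow_mul]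
    simp only [Nat.cast_ofNat, one_div, mul_inv_cancel_of_invertible, ENNReal.rpow_one]
    rfl
  simp only [e]
  have := (ENNReal.continuous_rpow_const (y := (1 / 2 : ℝ))).tendsto 0
  rw [ENNReal.zero_rpow_of_pos (by norm_num)] at this
  exact this.comp h

lemma mol_inner {X H : Type*} [NormedAddCommGroup X] [NormedSpace ℝ X] [FiniteDimensional ℝ X]
    [MeasureSpace X] [BorelSpace X] [(volume : Measure X).IsAddHaarMeasure]
    [NormedAddCommGroup H] [InnerProductSpace ℝ H] [CompleteSpace H] (n : ℕ) {f : X → H}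
    (hf : LocallyIntegrable f) (e : H) (p : X) :
    mol n (fun q => ⟪f q, e⟫) p = ⟪mol n f p, e⟫ := by
  rw [mol_apply', mol_apply', real_inner_comm, ← integral_inner (integrable_rho_smul n hf p)]
  refine integral_congr_ae (ae_of_all _ fun q => ?_)
  simp only [real_inner_smul_right, smul_eq_mul]
  rw [real_inner_comm]

/-- Restriction of a space-time function to a cylinder, extended by zero. -/
def onCyl {F : Type*} [Zero F] (a b ρ : ℝ) (x₀ : Ed d) (f : ℝ → Ed d → F) : ℝ × Ed d → F :=
  (Ioo a b ×ˢ ball x₀ ρ).indicator fun p => f p.1 p.2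

/-- A local weak supersolution that is nonnegative in a cylinder compactly contained in the
domain. -/
structure NonnegSupersolution (s Λ T : ℝ) (Ω : Set (Ed d)) (A : ℝ → Ed d → Ed d → Ed d)
    (K : ℝ → Ed d → Ed d → ℝ) (v : ℝ → Ed d → ℝ) (Dv : ℝ → Ed d → Ed d) (a b ρ : ℝ)
    (x₀ : Ed d) : Prop where
  dim : 1 ≤ d
  order : s ∈ Ioo (0 : ℝ) 1
  ellip : 1 ≤ Λ
  field : VectorFieldHyp d Λ A
  kernel : KernelHyp d s Λ K
  reg : LocalWeakReg d s (Ioo 0 T) Ω v Dv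
  super : IsLocalWeakSupersolutionHom A K (Ioo 0 T) Ω v Dv
  lt : a < b
  radius_pos : 0 < ρ
  time_subset : Icc a b ⊆ Ioo 0 T
  space_subset : closedBall x₀ ρ ⊆ Ω
  nonneg : ∀ᵐ p : ℝ × Ed d, p ∈ Ioo a b ×ˢ ball x₀ ρ → 0 ≤ v p.1 p.2

variable {s Λ T a b ρ : ℝ} {Ω : Set (Ed d)} {A : ℝ → Ed d → Ed d → Ed d}
  {K : ℝ → Ed d → Ed d → ℝ} {v : ℝ → Ed d → ℝ} {Dv : ℝ → Ed d → Ed d} {x₀ : Ed d}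

lemma measurable_onCyl {F : Type*} [Zero F] [MeasurableSpace F] {f : ℝ → Ed d → F}
    (hf : Measurable (Function.uncurry f)) : Measurable (onCyl a b ρ x₀ f) :=
  hf.indicator (measurableSet_Ioo.prod measurableSet_ball)

lemma VectorFieldHyp.norm_inner (hA : VectorFieldHyp d Λ A) (t : ℝ) (x ξ : Ed d) :
    Λ⁻¹ * ‖ξ‖ ^ 2 ≤ ⟪A t x ξ, ξ⟫ := by
  have h0 : A t x 0 = 0 := by
    have := hA.growth t x 0
    rw [norm_zero, mul_zero] at this
    exact norm_le_zero_iff.1 this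
  have := hA.monotone t x 0 ξ
  rwa [h0, sub_zero, sub_zero] at this

lemma integrable_of_memLp_two_onCyl {F : Type*} [NormedAddCommGroup F] {f : ℝ → Ed d → F}
    (hf : MemLp (onCyl a b ρ x₀ f) 2) : Integrable (onCyl a b ρ x₀ f) := by
  have hm : MeasurableSet (Ioo a b ×ˢ ball x₀ ρ) := measurableSet_Ioo.prod measurableSet_ball
  have hfin : volume (Ioo a b ×ˢ ball x₀ ρ) ≠ ⊤ := by
    rw [Measure.volume_eq_prod, Measure.prod_prod]
    exact ENNReal.mul_ne_top measure_Ioo_lt_top.ne measure_ball_lt_top.ne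
  have : Fact (volume (Ioo a b ×ˢ ball x₀ ρ) < ⊤) := ⟨hfin.lt_top⟩
  have h1 : IntegrableOn (onCyl a b ρ x₀ f) (Ioo a b ×ˢ ball x₀ ρ) :=
    (hf.restrict _).integrable (by norm_num)
  exact (integrableOn_iff_integrable_of_support_subset (fun p hp => by
    by_contra h
    exact hp (indicator_of_notMem h _))).1 h1

namespace NonnegSupersolution

lemma memLp_pair (H : NonnegSupersolution s Λ T Ω A K v Dv a b ρ x₀) :
    MemLp (onCyl a b ρ x₀ v) 2 ∧ MemLp (onCyl a b ρ x₀ Dv) 2 := by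
  have hI : IntegrableOn (fun p : ℝ × Ed d => (v p.1 p.2) ^ 2 + ‖Dv p.1 p.2‖ ^ 2)
      (Ioo a b ×ˢ ball x₀ ρ) :=
    (H.reg.l2w12 a b H.time_subset _ (isCompact_closedBall x₀ ρ) H.space_subset).mono_set
      (prod_mono_right ball_subset_closedBall)
  have hm : MeasurableSet (Ioo a b ×ˢ ball x₀ ρ) := measurableSet_Ioo.prod measurableSet_ball
  have hlt := hI.2
  constructor
  · rw [memLp_two_iff (measurable_onCyl H.reg.meas).aestronglyMeasurable]
    refine lt_of_le_of_lt ?_ hlt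
    rw [← lintegral_indicator hm]
    refine lintegral_mono fun p => ?_
    by_cases hp : p ∈ Ioo a b ×ˢ ball x₀ ρ
    · rw [onCyl, indicator_of_mem hp, indicator_of_mem hp, ← enorm_pow]
      rw [Real.enorm_of_nonneg (sq_nonneg _), Real.enorm_of_nonneg (by positivity)]
      exact ENNReal.ofReal_le_ofReal (by simp)
    · rw [onCyl, indicator_of_notMem hp, indicator_of_notMem hp]; simp
  · rw [memLp_two_iff (measurable_onCyl H.reg.measD).aestronglyMeasurable]
    refine lt_of_le_of_lt ?_ hlt
    rw [← lintegral_indicator hm]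
    refine lintegral_mono fun p => ?_
    by_cases hp : p ∈ Ioo a b ×ˢ ball x₀ ρ
    · rw [onCyl, indicator_of_mem hp, indicator_of_mem hp, ← ofReal_norm,
        ← ENNReal.ofReal_pow (norm_nonneg _), Real.enorm_of_nonneg (by positivity)]
      exact ENNReal.ofReal_le_ofReal (by nlinarith [sq_nonneg (v p.1 p.2)])
    · rw [onCyl, indicator_of_notMem hp, indicator_of_notMem hp]; simp

lemma measurable_flux (H : NonnegSupersolution s Λ T Ω A K v Dv a b ρ x₀) :
    Measurable (Function.uncurry fun t x => A t x (Dv t x)) := by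
  have h1 : Measurable (Function.uncurry fun (ξ : Ed d) (p : ℝ × Ed d) => A p.1 p.2 ξ) :=
    measurable_uncurry_of_continuous_of_measurable (fun p => H.field.cont p.1 p.2) H.field.meas
  exact h1.comp (H.reg.measD.prodMk measurable_id)

lemma norm_flux_le (H : NonnegSupersolution s Λ T Ω A K v Dv a b ρ x₀) (p : ℝ × Ed d) :
    ‖onCyl a b ρ x₀ (fun t x => A t x (Dv t x)) p‖ ≤ Λ * ‖onCyl a b ρ x₀ Dv p‖ := by
  by_cases hp : p ∈ Ioo a b ×ˢ ball x₀ ρ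
  · rw [onCyl, onCyl, indicator_of_mem hp, indicator_of_mem hp]
    exact H.field.growth _ _ _
  · rw [onCyl, onCyl, indicator_of_notMem hp, indicator_of_notMem hp]; simp

lemma le_inner_flux (H : NonnegSupersolution s Λ T Ω A K v Dv a b ρ x₀) (p : ℝ × Ed d) :
    Λ⁻¹ * ‖onCyl a b ρ x₀ Dv p‖ ^ 2 ≤
      ⟪onCyl a b ρ x₀ (fun t x => A t x (Dv t x)) p, onCyl a b ρ x₀ Dv p⟫ := by
  by_cases hp : p ∈ Ioo a b ×ˢ ball x₀ ρ
  · rw [onCyl, onCyl, indicator_of_mem hp, indicator_of_mem hp]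
    exact H.field.norm_inner _ _ _
  · rw [onCyl, onCyl, indicator_of_notMem hp, indicator_of_notMem hp]; simp

lemma memLp_flux (H : NonnegSupersolution s Λ T Ω A K v Dv a b ρ x₀) :
    MemLp (onCyl a b ρ x₀ fun t x => A t x (Dv t x)) 2 :=
  (H.memLp_pair.2).of_le_mul (measurable_onCyl H.measurable_flux).aestronglyMeasurable
    (ae_of_all _ H.norm_flux_le)

lemma onCyl_nonneg (H : NonnegSupersolution s Λ T Ω A K v Dv a b ρ x₀) :
    ∀ᵐ p, 0 ≤ onCyl a b ρ x₀ v p := by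
  filter_upwards [H.nonneg] with p hp
  exact indicator_apply_nonneg hp

end NonnegSupersolution

end LocalSupersolution

section Translates

variable {s Λ T a b ρ : ℝ} {Ω : Set (Ed d)} {A : ℝ → Ed d → Ed d → Ed d}
  {K : ℝ → Ed d → Ed d → ℝ} {v : ℝ → Ed d → ℝ} {Dv : ℝ → Ed d → Ed d} {x₀ : Ed d}

namespace NonnegSupersolution

lemma fderiv_mol_onCyl (H : NonnegSupersolution s Λ T Ω A K v Dv a b ρ x₀) {n : ℕ}
    {p : ℝ × Ed d} (hp : ball p (1 / ((n : ℝ) + 1)) ⊆ Ioo a b ×ˢ ball x₀ ρ) (e : Ed d) :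
    fderiv ℝ (mol n (onCyl a b ρ x₀ v)) p (0, e) = ⟪mol n (onCyl a b ρ x₀ Dv) p, e⟫ :=
  fderiv_mol_indicator_apply rfl rfl (integrable_of_memLp_two_onCyl H.memLp_pair.1)
    (integrable_of_memLp_two_onCyl H.memLp_pair.2) H.space_subset
    (fun t ht => H.reg.grad t (H.time_subset (Ioo_subset_Icc_self ht))) hp e

lemma mol_onCyl_nonneg (H : NonnegSupersolution s Λ T Ω A K v Dv a b ρ x₀) (n : ℕ)
    (p : ℝ × Ed d) : 0 ≤ mol n (onCyl a b ρ x₀ v) p :=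
  mol_nonneg n H.onCyl_nonneg p

lemma contDiff_mol_onCyl (H : NonnegSupersolution s Λ T Ω A K v Dv a b ρ x₀) (n : ℕ) :
    ContDiff ℝ (⊤ : ℕ∞) (mol n (onCyl a b ρ x₀ v)) :=
  contDiff_mol n (H.memLp_pair.1.locallyIntegrable (by norm_num))

lemma continuous_mol_onCyl_grad (H : NonnegSupersolution s Λ T Ω A K v Dv a b ρ x₀) (n : ℕ) :
    Continuous (mol n (onCyl a b ρ x₀ Dv)) :=
  (contDiff_mol n (H.memLp_pair.2.locallyIntegrable (by norm_num))).continuous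

lemma tendsto_mol_onCyl (H : NonnegSupersolution s Λ T Ω A K v Dv a b ρ x₀) :
    ∀ᵐ p, Tendsto (fun n => mol n (onCyl a b ρ x₀ v) p) atTop (𝓝 (onCyl a b ρ x₀ v p)) :=
  tendsto_mol_ae (H.memLp_pair.1.locallyIntegrable (by norm_num))

lemma aestronglyMeasurable_comp_onCyl (H : NonnegSupersolution s Λ T Ω A K v Dv a b ρ x₀)
    {g : ℝ → ℝ} (hgc : ∀ c, 0 ≤ c → ContinuousAt g c) :
    AEStronglyMeasurable fun p => g (onCyl a b ρ x₀ v p) := by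
  refine aestronglyMeasurable_of_tendsto_ae atTop (f := fun n p => g (mol n (onCyl a b ρ x₀ v) p))
    (fun n => ?_) ?_
  · exact (continuous_iff_continuousAt.2 fun p => (hgc _ (H.mol_onCyl_nonneg n p)).comp
      (f := mol n (onCyl a b ρ x₀ v))
      (H.contDiff_mol_onCyl n).continuous.continuousAt).aestronglyMeasurable
  · filter_upwards [H.tendsto_mol_onCyl, H.onCyl_nonneg] with p hp h0
    exact (hgc _ h0).tendsto.comp hp

/-- The chain rule, in the form of a bound for the translates of `Γ ∘ v`. -/
lemma lintegral_comp_translate_sq_le (H : NonnegSupersolution s Λ T Ω A K v Dv a b ρ x₀)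
    {γ M : ℝ} (hγ : 0 < γ) {S S' : Set (ℝ × Ed d)} (hS : MeasurableSet S) (hS' : MeasurableSet S')
    (z : Ed d) (hSS : ∀ p ∈ S, ∀ θ ∈ Icc (0 : ℝ) 1, p + θ • ((0, z) : ℝ × Ed d) ∈ S')
    (hSQ : ∀ p ∈ S', ball p γ ⊆ Ioo a b ×ˢ ball x₀ ρ) {Γ g : ℝ → ℝ}
    (hΓ : ∀ c, 0 ≤ c → HasDerivAt Γ (g c) c) (hgc : ∀ c, 0 ≤ c → ContinuousAt g c)
    (hgM : ∀ c, 0 ≤ c → |g c| ≤ M) :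
    ∫⁻ p in S, ‖Γ (onCyl a b ρ x₀ v (p.1, p.2 + z)) - Γ (onCyl a b ρ x₀ v p)‖ₑ ^ 2 ≤
      ENNReal.ofReal (‖z‖ ^ 2) *
        ∫⁻ p in S', ‖g (onCyl a b ρ x₀ v p) • onCyl a b ρ x₀ Dv p‖ₑ ^ 2 := by
  set V := onCyl a b ρ x₀ v with hV
  set W := onCyl a b ρ x₀ Dv with hW
  have hu0 := H.mol_onCyl_nonneg
  have hu := fun n => (H.contDiff_mol_onCyl n).of_le (m := 1) (by exact_mod_cast le_top)
  have hud : ∀ n, Differentiable ℝ (mol n V) := fun n => (hu n).differentiable (by norm_num)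
  have hder : ∀ n p, HasFDerivAt (fun p => Γ (mol n V p)) (g (mol n V p) • fderiv ℝ (mol n V) p) p :=
    fun n p => (hΓ _ (hu0 n p)).comp_hasFDerivAt p (hud n p).hasFDerivAt
  have hgcont : ∀ n, Continuous fun p => g (mol n V p) := fun n =>
    continuous_iff_continuousAt.2 fun p => (hgc _ (hu0 n p)).comp (f := mol n V)
      (hud n).continuous.continuousAt
  have hC1 : ∀ n, ContDiff ℝ 1 fun p => Γ (mol n V p) := fun n => by
    rw [contDiff_one_iff_fderiv]
    refine ⟨fun p => (hder n p).differentiableAt, ?_⟩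
    rw [show fderiv ℝ (fun p => Γ (mol n V p)) = fun p => g (mol n V p) • fderiv ℝ (mol n V) p from
      funext fun p => (hder n p).fderiv]
    exact (hgcont n).smul ((hu n).continuous_fderiv (by norm_num))
  have hgm : AEStronglyMeasurable (fun p => g (V p)) := H.aestronglyMeasurable_comp_onCyl hgc
  have hlim := H.tendsto_mol_onCyl
  have hlim' : ∀ᵐ p : ℝ × Ed d, Tendsto (fun n => mol n V (p.1, p.2 + z)) atTop
      (𝓝 (V (p.1, p.2 + z))) ∧ 0 ≤ V (p.1, p.2 + z) := by
    have h := (measurePreserving_add_right (volume : Measure (ℝ × Ed d))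
      ((0, z) : ℝ × Ed d)).quasiMeasurePreserving.ae (hlim.and H.onCyl_nonneg)
    filter_upwards [h] with p hp
    simpa [Prod.add_def, hV] using hp
  have hb : ∀ᶠ n : ℕ in atTop, ∫⁻ p in S, ‖Γ (mol n V (p.1, p.2 + z)) - Γ (mol n V p)‖ₑ ^ 2 ≤
      ENNReal.ofReal (‖z‖ ^ 2) * ∫⁻ p in S', ‖g (mol n V p) • mol n W p‖ₑ ^ 2 := by
    filter_upwards [(tendsto_one_div_add_atTop_nhds_zero_nat (𝕜 := ℝ)).eventually
      (Iio_mem_nhds hγ)] with n hn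
    have h := lintegral_translation_sq_le ((0, z) : ℝ × Ed d) hS hS' hSS (hC1 n)
    simp only [Prod.add_def, add_zero] at h
    refine h.trans ?_
    rw [← lintegral_const_mul' _ _ ENNReal.ofReal_ne_top]
    refine setLIntegral_mono' hS' fun p hp => ?_
    rw [(hder n p).fderiv, _root_.smul_apply,
      H.fderiv_mol_onCyl ((ball_subset_ball (le_of_lt hn)).trans (hSQ p hp)), smul_eq_mul,
      ← real_inner_smul_left, Real.enorm_eq_ofReal_abs, ← ENNReal.ofReal_pow (abs_nonneg _),
      ← ofReal_norm, ← ENNReal.ofReal_pow (norm_nonneg _), ← ENNReal.ofReal_mul (by positivity),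
      ← mul_pow]
    refine ENNReal.ofReal_le_ofReal (pow_le_pow_left₀ (abs_nonneg _) ?_ 2)
    rw [mul_comm]
    exact abs_real_inner_le_norm _ _
  have hL2 : Tendsto (fun n => ∫⁻ p in S', ‖g (mol n V p) • mol n W p‖ₑ ^ 2) atTop
      (𝓝 (∫⁻ p in S', ‖g (V p) • W p‖ₑ ^ 2)) := by
    have hMW : MemLp (fun p => g (V p) • W p) 2 (volume.restrict S') := by
      refine (H.memLp_pair.2.restrict S').of_le_mul (c := M)
        (hgm.restrict.smul (H.memLp_pair.2.restrict S').1) ?_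
      filter_upwards [ae_restrict_of_ae H.onCyl_nonneg] with p hp
      rw [norm_smul, Real.norm_eq_abs]
      exact mul_le_mul_of_nonneg_right (hgM _ hp) (norm_nonneg _)
    refine tendsto_lintegral_sq_of_tendsto
      (fun n => ((hgcont n).smul (H.continuous_mol_onCyl_grad n)).aestronglyMeasurable) hMW ?_
    refine lintegral_norm_sq_smul_tendsto (M := M) (fun n => (hgcont n).aestronglyMeasurable)
      hgm.restrict (fun n => ae_of_all _ fun p => hgM _ (hu0 n p)) ?_
      (fun n => (H.continuous_mol_onCyl_grad n).aestronglyMeasurable)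
      (H.memLp_pair.2.restrict S') ?_
    · filter_upwards [ae_restrict_of_ae hlim, ae_restrict_of_ae H.onCyl_nonneg] with p hp h0
      exact (hgc _ h0).tendsto.comp hp
    · refine tendsto_of_tendsto_of_tendsto_of_le_of_le tendsto_const_nhds
        (tendsto_mol_L2 H.memLp_pair.2) (fun _ => zero_le) fun n => setLIntegral_le_lintegral _ _
  calc ∫⁻ p in S, ‖Γ (V (p.1, p.2 + z)) - Γ (V p)‖ₑ ^ 2
      = ∫⁻ p in S, liminf (fun n => ‖Γ (mol n V (p.1, p.2 + z)) - Γ (mol n V p)‖ₑ ^ 2) atTop := by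
        refine lintegral_congr_ae ?_
        filter_upwards [ae_restrict_of_ae hlim, ae_restrict_of_ae hlim',
          ae_restrict_of_ae H.onCyl_nonneg] with p h1 h2 h3
        have t1 := (hΓ _ h3).continuousAt.tendsto.comp h1
        have t2 := (hΓ _ h2.2).continuousAt.tendsto.comp h2.1
        exact (((ENNReal.continuous_pow 2).tendsto _).comp
          ((t2.sub t1).enorm)).liminf_eq.symm
    _ ≤ liminf (fun n => ∫⁻ p in S, ‖Γ (mol n V (p.1, p.2 + z)) - Γ (mol n V p)‖ₑ ^ 2) atTop := by
        refine lintegral_liminf_le fun n => ?_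
        have c1 : Continuous fun p : ℝ × Ed d => Γ (mol n V (p.1, p.2 + z)) :=
          (hC1 n).continuous.comp (by fun_prop : Continuous fun p : ℝ × Ed d => (p.1, p.2 + z))
        exact ((ENNReal.continuous_pow 2).comp (c1.sub (hC1 n).continuous).enorm).measurable
    _ ≤ liminf (fun n => ENNReal.ofReal (‖z‖ ^ 2) *
          ∫⁻ p in S', ‖g (mol n V p) • mol n W p‖ₑ ^ 2) atTop := liminf_le_liminf hb
    _ = _ := (ENNReal.Tendsto.const_mul hL2 (Or.inr ENNReal.ofReal_ne_top)).liminf_eq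

end NonnegSupersolution

end Translates

section LimitInequality

variable {s Λ T a b ρ a' b' ρ' L γ ε h : ℝ} {Ω : Set (Ed d)} {A : ℝ → Ed d → Ed d → Ed d}
  {K : ℝ → Ed d → Ed d → ℝ} {v : ℝ → Ed d → ℝ} {Dv : ℝ → Ed d → Ed d} {x₀ : Ed d}
  {ζ m : ℝ → ℝ} {η : Ed d → ℝ}

lemma continuous_gradient_of_contDiff (hη : ContDiff ℝ (⊤ : ℕ∞) η) : Continuous (gradient η) :=
  (InnerProductSpace.toDual ℝ (Ed d)).symm.continuous.comp
    (hη.continuous_fderiv (by simp))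

lemma memLp_cutoff (hζ : IsTimeCutoff a b a' b' ζ m) {F : Type*} [NormedAddCommGroup F]
    [NormedSpace ℝ F] {f : Ed d → F} (hf : Continuous f)
    (hf0 : ∀ x ∉ closedBall x₀ ρ', f x = 0) :
    MemLp (fun p : ℝ × Ed d => ζ p.1 • f p.2) 2 := by
  refine Continuous.memLp_of_hasCompactSupport
    ((hζ.smooth.continuous.comp continuous_fst).smul (hf.comp continuous_snd))
    (HasCompactSupport.intro (isCompact_cylinder a' b' ρ' x₀) fun p hp => ?_)
  rw [mem_prod, not_and_or] at hp
  rcases hp with hp | hp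
  · rw [hζ.eq_zero _ hp, zero_smul]
  · rw [hf0 _ hp, smul_zero]

lemma memLp_cutoff_gradient (hζ : IsTimeCutoff a b a' b' ζ m) (hη : IsSpaceCutoff x₀ ρ' L η) :
    MemLp (fun p : ℝ × Ed d => ζ p.1 • gradient η p.2) 2 :=
  memLp_cutoff hζ (continuous_gradient_of_contDiff hη.smooth) fun x hx => by
    rw [gradient, fderiv_eq_zero_of_notMem isClosed_closedBall hη.eq_zero hx, map_zero]

lemma potGrad_eq (u : ℝ × Ed d → ℝ) (w : ℝ × Ed d → Ed d) (p : ℝ × Ed d) :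
    potGrad ζ η ε h u w p = (2 * η p.2 * potF ε h (u p)) • (ζ p.1 • gradient η p.2) -
      (ζ p.1 * (η p.2 ^ 2 * potF' ε h (u p))) • w p := by
  rw [potGrad, smul_sub, smul_smul, smul_smul, smul_smul, mul_comm (ζ p.1)]

lemma abs_coeff_gradient_le (hη : IsSpaceCutoff x₀ ρ' L η) (hε : 0 < ε) (hh : ε ≤ h) {c : ℝ}
    (hc : 0 ≤ c) (x : Ed d) : |2 * η x * potF ε h c| ≤ 2 * ε⁻¹ := by
  have h0 := potF_nonneg hε hh hc
  have h1 := hη.nonneg x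
  rw [abs_of_nonneg (by positivity)]
  calc 2 * η x * potF ε h c ≤ 2 * 1 * ε⁻¹ := by
        gcongr
        · exact hη.le_one x
        · exact potF_le hε hh hc
    _ = 2 * ε⁻¹ := by ring

lemma abs_coeff_le (hζ : IsTimeCutoff a b a' b' ζ m) (hη : IsSpaceCutoff x₀ ρ' L η)
    (hε : 0 < ε) (hh : ε ≤ h) {c : ℝ} (hc : 0 ≤ c) (t : ℝ) (x : Ed d) :
    |ζ t * (η x ^ 2 * potF' ε h c)| ≤ ε⁻¹ ^ 2 := by
  have h0 := potF'_nonneg hε hh hc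
  have h1 := hη.nonneg x
  have h2 := hζ.nonneg t
  rw [abs_of_nonneg (by positivity)]
  calc ζ t * (η x ^ 2 * potF' ε h c) ≤ 1 * (1 ^ 2 * ε⁻¹ ^ 2) := by
        gcongr
        · exact hζ.le_one t
        · exact hη.le_one x
        · exact potF'_le hε hc
    _ = ε⁻¹ ^ 2 := by ring

lemma memLp_potGrad (hζ : IsTimeCutoff a b a' b' ζ m) (hη : IsSpaceCutoff x₀ ρ' L η)
    (hε : 0 < ε) (hh : ε ≤ h) {u : ℝ × Ed d → ℝ} {w : ℝ × Ed d → Ed d} (hu : ∀ᵐ p, 0 ≤ u p)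
    (hF : AEStronglyMeasurable fun p => potF ε h (u p))
    (hF' : AEStronglyMeasurable fun p => potF' ε h (u p)) (hw : MemLp w 2) :
    MemLp (potGrad ζ η ε h u w) 2 := by
  have cζ : Continuous fun p : ℝ × Ed d => ζ p.1 := hζ.smooth.continuous.comp continuous_fst
  have cη : Continuous fun p : ℝ × Ed d => η p.2 := hη.smooth.continuous.comp continuous_snd
  have hD := memLp_cutoff_gradient hζ hη
  rw [funext (potGrad_eq u w)]
  refine MemLp.sub (hD.of_le_mul (c := 2 * ε⁻¹)
    (((cη.aestronglyMeasurable.const_mul 2).mul hF).smul hD.1) ?_)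
    (hw.of_le_mul (c := ε⁻¹ ^ 2) ((cζ.aestronglyMeasurable.mul
      ((cη.pow 2).aestronglyMeasurable.mul hF')).smul hw.1) ?_)
  · filter_upwards [hu] with p hp
    rw [norm_smul]
    exact mul_le_mul_of_nonneg_right (abs_coeff_gradient_le hη hε hh hp _) (norm_nonneg _)
  · filter_upwards [hu] with p hp
    rw [norm_smul]
    exact mul_le_mul_of_nonneg_right (abs_coeff_le hζ hη hε hh hp _ _) (norm_nonneg _)

lemma memLp_cutoff_sq (hζ : IsTimeCutoff a b a' b' ζ m) (hη : IsSpaceCutoff x₀ ρ' L η) :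
    MemLp (fun p : ℝ × Ed d => ζ p.1 • η p.2 ^ 2) 2 :=
  memLp_cutoff (x₀ := x₀) (ρ' := ρ') hζ (f := fun x => η x ^ 2) (hη.smooth.continuous.pow 2) fun x hx => by
    simp only [hη.eq_zero _ hx, zero_pow two_ne_zero]

lemma abs_potF_le (hε : 0 < ε) (hh : ε ≤ h) {c : ℝ} (hc : 0 ≤ c) : |potF ε h c| ≤ ε⁻¹ := by
  rw [abs_of_nonneg (potF_nonneg hε hh hc)]
  exact potF_le hε hh hc

lemma potTest_eq (u : ℝ × Ed d → ℝ) (p : ℝ × Ed d) :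
    potTest ζ η ε h u p = potF ε h (u p) • (ζ p.1 • η p.2 ^ 2) := by
  simp only [potTest, smul_eq_mul]
  ring

lemma memLp_potTest (hζ : IsTimeCutoff a b a' b' ζ m) (hη : IsSpaceCutoff x₀ ρ' L η)
    (hε : 0 < ε) (hh : ε ≤ h) {u : ℝ × Ed d → ℝ} (hu : ∀ᵐ p, 0 ≤ u p)
    (hF : AEStronglyMeasurable fun p => potF ε h (u p)) : MemLp (potTest ζ η ε h u) 2 := by
  have hD := memLp_cutoff_sq hζ hη
  rw [funext (potTest_eq u)]
  refine hD.of_le_mul (c := ε⁻¹) (hF.smul hD.1) ?_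
  filter_upwards [hu] with p hp
  rw [norm_smul]
  exact mul_le_mul_of_nonneg_right (abs_potF_le hε hh hp) (norm_nonneg _)

lemma continuousAt_potF (hε : 0 < ε) (hh : ε ≤ h) (c : ℝ) (hc : 0 ≤ c) :
    ContinuousAt (potF ε h) c :=
  (hasDerivAt_potF hε hh hc).continuousAt

lemma continuousAt_potF' (hε : 0 < ε) (hh : ε ≤ h) (c : ℝ) (hc : 0 ≤ c) :
    ContinuousAt (potF' ε h) c := by
  have h1 : c + ε ≠ 0 := by linarith
  have h2 : c + h ≠ 0 := by linarith
  unfold potF'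
  fun_prop (disch := assumption)

namespace NonnegSupersolution

lemma memLp_mol_onCyl_grad (H : NonnegSupersolution s Λ T Ω A K v Dv a b ρ x₀) (n : ℕ) :
    MemLp (mol n (onCyl a b ρ x₀ Dv)) 2 :=
  (memLp_two_iff (H.continuous_mol_onCyl_grad n).aestronglyMeasurable).2
    ((lintegral_mol_sq_le n H.memLp_pair.2.1).trans_lt
      ((memLp_two_iff H.memLp_pair.2.1).1 H.memLp_pair.2))

lemma continuous_comp_mol (H : NonnegSupersolution s Λ T Ω A K v Dv a b ρ x₀) (n : ℕ)
    {g : ℝ → ℝ} (hg : ∀ c, 0 ≤ c → ContinuousAt g c) :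
    Continuous fun p => g (mol n (onCyl a b ρ x₀ v) p) :=
  continuous_iff_continuousAt.2 fun p => (hg _ (H.mol_onCyl_nonneg n p)).comp
    (f := mol n (onCyl a b ρ x₀ v)) (H.contDiff_mol_onCyl n).continuous.continuousAt

lemma memLp_potGrad_mol (H : NonnegSupersolution s Λ T Ω A K v Dv a b ρ x₀)
    (hζ : IsTimeCutoff a b a' b' ζ m) (hη : IsSpaceCutoff x₀ ρ' L η) (hε : 0 < ε) (hh : ε ≤ h)
    (n : ℕ) :
    MemLp (potGrad ζ η ε h (mol n (onCyl a b ρ x₀ v)) (mol n (onCyl a b ρ x₀ Dv))) 2 :=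
  memLp_potGrad hζ hη hε hh (ae_of_all _ (H.mol_onCyl_nonneg n))
    (H.continuous_comp_mol n (continuousAt_potF hε hh)).aestronglyMeasurable
    (H.continuous_comp_mol n (continuousAt_potF' hε hh)).aestronglyMeasurable
    (H.memLp_mol_onCyl_grad n)

lemma memLp_potGrad_onCyl (H : NonnegSupersolution s Λ T Ω A K v Dv a b ρ x₀)
    (hζ : IsTimeCutoff a b a' b' ζ m) (hη : IsSpaceCutoff x₀ ρ' L η) (hε : 0 < ε) (hh : ε ≤ h) :
    MemLp (potGrad ζ η ε h (onCyl a b ρ x₀ v) (onCyl a b ρ x₀ Dv)) 2 :=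
  memLp_potGrad hζ hη hε hh H.onCyl_nonneg
    (H.aestronglyMeasurable_comp_onCyl (continuousAt_potF hε hh))
    (H.aestronglyMeasurable_comp_onCyl (continuousAt_potF' hε hh)) H.memLp_pair.2

lemma tendsto_potGrad_mol (H : NonnegSupersolution s Λ T Ω A K v Dv a b ρ x₀)
    (hζ : IsTimeCutoff a b a' b' ζ m) (hη : IsSpaceCutoff x₀ ρ' L η) (hε : 0 < ε) (hh : ε ≤ h) :
    Tendsto (fun n => ∫⁻ p, ‖potGrad ζ η ε h (mol n (onCyl a b ρ x₀ v))
        (mol n (onCyl a b ρ x₀ Dv)) p -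
      potGrad ζ η ε h (onCyl a b ρ x₀ v) (onCyl a b ρ x₀ Dv) p‖ₑ ^ 2) atTop (𝓝 0) := by
  set V := onCyl a b ρ x₀ v
  set W := onCyl a b ρ x₀ Dv
  have cζ : Continuous fun p : ℝ × Ed d => ζ p.1 := hζ.smooth.continuous.comp continuous_fst
  have cη : Continuous fun p : ℝ × Ed d => η p.2 := hη.smooth.continuous.comp continuous_snd
  have hD := memLp_cutoff_gradient hζ hη
  have c1 : ∀ n, Continuous fun p : ℝ × Ed d => 2 * η p.2 * potF ε h (mol n V p) := fun n =>
    (continuous_const.mul cη).mul (H.continuous_comp_mol n (continuousAt_potF hε hh))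
  have c2 : ∀ n, Continuous fun p : ℝ × Ed d =>
      ζ p.1 * (η p.2 ^ 2 * potF' ε h (mol n V p)) := fun n =>
    cζ.mul ((cη.pow 2).mul (H.continuous_comp_mol n (continuousAt_potF' hε hh)))
  have t1 := lintegral_norm_sq_smul_tendsto (μ := volume) (M := 2 * ε⁻¹)
    (m := fun n (p : ℝ × Ed d) => 2 * η p.2 * potF ε h (mol n V p))
    (m' := fun p => 2 * η p.2 * potF ε h (V p)) (f := fun _ p => ζ p.1 • gradient η p.2)
    (f' := fun p => ζ p.1 • gradient η p.2)
    (fun n => (c1 n).aestronglyMeasurable)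
    ((cη.aestronglyMeasurable.const_mul 2).mul
      (H.aestronglyMeasurable_comp_onCyl (continuousAt_potF hε hh)))
    (fun n => ae_of_all _ fun p => abs_coeff_gradient_le hη hε hh (H.mol_onCyl_nonneg n p) _)
    (by
      filter_upwards [H.tendsto_mol_onCyl, H.onCyl_nonneg] with p hp h0
      exact (((continuousAt_potF hε hh _ h0).tendsto.comp hp)).const_mul _)
    (fun _ => hD.1) hD (by simp)
  have t2 := lintegral_norm_sq_smul_tendsto (μ := volume) (M := ε⁻¹ ^ 2)
    (m := fun n (p : ℝ × Ed d) => ζ p.1 * (η p.2 ^ 2 * potF' ε h (mol n V p)))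
    (m' := fun p => ζ p.1 * (η p.2 ^ 2 * potF' ε h (V p))) (f := fun n => mol n W)
    (f' := W)
    (fun n => (c2 n).aestronglyMeasurable)
    (cζ.aestronglyMeasurable.mul ((cη.pow 2).aestronglyMeasurable.mul
      (H.aestronglyMeasurable_comp_onCyl (continuousAt_potF' hε hh))))
    (fun n => ae_of_all _ fun p => abs_coeff_le hζ hη hε hh (H.mol_onCyl_nonneg n p) _ _)
    (by
      filter_upwards [H.tendsto_mol_onCyl, H.onCyl_nonneg] with p hp h0
      exact (((continuousAt_potF' hε hh _ h0).tendsto.comp hp).const_mul _).const_mul _)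
    (fun n => (H.continuous_mol_onCyl_grad n).aestronglyMeasurable) H.memLp_pair.2
    (tendsto_mol_L2 H.memLp_pair.2)
  have t3 := (ENNReal.Tendsto.const_mul (a := 2) t1 (Or.inr (by norm_num))).add
    (ENNReal.Tendsto.const_mul (a := 2) t2 (Or.inr (by norm_num)))
  rw [mul_zero, add_zero] at t3
  refine tendsto_of_tendsto_of_tendsto_of_le_of_le tendsto_const_nhds t3 (fun _ => zero_le)
    fun n => ?_
  have hae : AEMeasurable (fun p : ℝ × Ed d => 2 *
      ‖(2 * η p.2 * potF ε h (mol n V p)) • (ζ p.1 • gradient η p.2) -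
        (2 * η p.2 * potF ε h (V p)) • (ζ p.1 • gradient η p.2)‖ₑ ^ 2) := by
    refine AEMeasurable.const_mul (AEMeasurable.pow_const ?_ 2) 2
    exact ((c1 n).aestronglyMeasurable.smul hD.1).sub
      (((cη.aestronglyMeasurable.const_mul 2).mul
        (H.aestronglyMeasurable_comp_onCyl (continuousAt_potF hε hh))).smul hD.1) |>.enorm
  rw [← lintegral_const_mul' _ _ (by norm_num), ← lintegral_const_mul' _ _ (by norm_num),
    ← lintegral_add_left' hae]
  refine lintegral_mono fun p => ?_
  rw [potGrad_eq, potGrad_eq, sub_sub_sub_comm, sub_eq_add_neg]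
  refine (enorm_add_sq_le _ _).trans ?_
  rw [enorm_neg]

lemma tendsto_potTest_mol (H : NonnegSupersolution s Λ T Ω A K v Dv a b ρ x₀)
    (hζ : IsTimeCutoff a b a' b' ζ m) (hη : IsSpaceCutoff x₀ ρ' L η) (hε : 0 < ε) (hh : ε ≤ h) :
    Tendsto (fun n => ∫⁻ p, ‖potTest ζ η ε h (mol n (onCyl a b ρ x₀ v)) p -
      potTest ζ η ε h (onCyl a b ρ x₀ v) p‖ₑ ^ 2) atTop (𝓝 0) := by
  have hD := memLp_cutoff_sq hζ hη
  have h1 := lintegral_norm_sq_smul_tendsto (μ := volume) (M := ε⁻¹)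
    (m := fun n (p : ℝ × Ed d) => potF ε h (mol n (onCyl a b ρ x₀ v) p))
    (m' := fun p => potF ε h (onCyl a b ρ x₀ v p))
    (f := fun _ p => ζ p.1 • η p.2 ^ 2) (f' := fun p => ζ p.1 • η p.2 ^ 2)
    (fun n => (H.continuous_comp_mol n (continuousAt_potF hε hh)).aestronglyMeasurable)
    (H.aestronglyMeasurable_comp_onCyl (continuousAt_potF hε hh))
    (fun n => ae_of_all _ fun p => abs_potF_le hε hh (H.mol_onCyl_nonneg n p))
    (by
      filter_upwards [H.tendsto_mol_onCyl, H.onCyl_nonneg] with p hp h0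
      exact (continuousAt_potF hε hh _ h0).tendsto.comp hp)
    (fun _ => hD.1) hD (by simp)
  refine h1.congr fun n => lintegral_congr fun p => ?_
  rw [potTest_eq, potTest_eq]

end NonnegSupersolution

end LimitInequality

section LimitInequality

variable {s Λ T a b ρ a' b' ρ' L γ ε h : ℝ} {Ω : Set (Ed d)} {A : ℝ → Ed d → Ed d → Ed d}
  {K : ℝ → Ed d → Ed d → ℝ} {v : ℝ → Ed d → ℝ} {Dv : ℝ → Ed d → Ed d} {x₀ : Ed d}
  {ζ m : ℝ → ℝ} {η : Ed d → ℝ}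

lemma ball_subset_cylinder {α β ρ₁ : ℝ} (hα : a + γ ≤ α) (hβ : β + γ ≤ b) (hρ₁ : ρ₁ + γ ≤ ρ)
    {p : ℝ × Ed d} (hp : p ∈ Icc α β ×ˢ closedBall x₀ ρ₁) :
    ball p γ ⊆ Ioo a b ×ˢ ball x₀ ρ := by
  intro q hq
  rw [mem_ball, Prod.dist_eq, max_lt_iff, Real.dist_eq, abs_lt] at hq
  have h1 := hp.1
  have h2 := mem_closedBall.1 hp.2
  refine ⟨⟨by linarith [h1.1], by linarith [h1.2]⟩, mem_ball.2 ?_⟩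
  linarith [dist_triangle q.2 p.2 x₀]

/-- The mollified test function. -/
def molTest (ζ : ℝ → ℝ) (η : Ed d → ℝ) (ε h : ℝ) (V : ℝ × Ed d → ℝ) (n : ℕ) : ℝ × Ed d → ℝ :=
  mol n (potTest ζ η ε h (mol n V))

namespace NonnegSupersolution

lemma contDiff_potTest_mol (H : NonnegSupersolution s Λ T Ω A K v Dv a b ρ x₀)
    (hζ : IsTimeCutoff a b a' b' ζ m) (hη : IsSpaceCutoff x₀ ρ' L η) (hε : 0 < ε) (hh : ε ≤ h)
    (n : ℕ) : ContDiff ℝ 1 (potTest ζ η ε h (mol n (onCyl a b ρ x₀ v))) :=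
  contDiff_potTest (hζ.smooth.of_le (by exact_mod_cast le_top))
    (hη.smooth.of_le (by exact_mod_cast le_top))
    ((H.contDiff_mol_onCyl n).of_le (by exact_mod_cast le_top)) (H.mol_onCyl_nonneg n) hε hh

lemma hasCompactSupport_potTest (hζ : IsTimeCutoff a b a' b' ζ m) (hη : IsSpaceCutoff x₀ ρ' L η)
    (u : ℝ × Ed d → ℝ) : HasCompactSupport (potTest ζ η ε h u) :=
  HasCompactSupport.intro (isCompact_cylinder a' b' ρ' x₀) fun _ hp => potTest_eq_zero hζ hη hp

lemma contDiff_molTest (H : NonnegSupersolution s Λ T Ω A K v Dv a b ρ x₀)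
    (hζ : IsTimeCutoff a b a' b' ζ m) (hη : IsSpaceCutoff x₀ ρ' L η) (hε : 0 < ε) (hh : ε ≤ h)
    (n : ℕ) : ContDiff ℝ (⊤ : ℕ∞) (molTest ζ η ε h (onCyl a b ρ x₀ v) n) :=
  contDiff_mol n (H.contDiff_potTest_mol hζ hη hε hh n).continuous.locallyIntegrable

lemma molTest_nonneg (H : NonnegSupersolution s Λ T Ω A K v Dv a b ρ x₀)
    (hζ : IsTimeCutoff a b a' b' ζ m) (hε : 0 < ε) (hh : ε ≤ h) (n : ℕ) (p : ℝ × Ed d) :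
    0 ≤ molTest ζ η ε h (onCyl a b ρ x₀ v) n p :=
  mol_nonneg n (ae_of_all _ fun _ => potTest_nonneg hζ (H.mol_onCyl_nonneg n _) hε hh) p

lemma abs_molTest_le (H : NonnegSupersolution s Λ T Ω A K v Dv a b ρ x₀)
    (hζ : IsTimeCutoff a b a' b' ζ m) (hη : IsSpaceCutoff x₀ ρ' L η) (hε : 0 < ε) (hh : ε ≤ h)
    (n : ℕ) (p : ℝ × Ed d) : |molTest ζ η ε h (onCyl a b ρ x₀ v) n p| ≤ ε⁻¹ :=
  norm_mol_le n (fun q => by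
    rw [Real.norm_eq_abs, abs_of_nonneg (potTest_nonneg hζ (H.mol_onCyl_nonneg n q) hε hh)]
    exact potTest_le hζ hη (H.mol_onCyl_nonneg n q) hε hh) p

lemma molTest_eq_zero (hζ : IsTimeCutoff a b a' b' ζ m) (hη : IsSpaceCutoff x₀ ρ' L η)
    (V : ℝ × Ed d → ℝ) {n : ℕ} (hn : 1 / ((n : ℝ) + 1) ≤ γ) {p : ℝ × Ed d}
    (hp : p ∉ Icc (a' - γ) (b' + γ) ×ˢ closedBall x₀ (ρ' + γ)) : molTest ζ η ε h V n p = 0 := by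
  refine mol_eq_zero fun q hq => potTest_eq_zero hζ hη fun hq' => hp ?_
  have h1 := (norm_fst_le (p - q)).trans_lt (hq.trans_le hn)
  have h2 := (norm_snd_le (p - q)).trans_lt (hq.trans_le hn)
  rw [Prod.fst_sub, Real.norm_eq_abs, abs_lt] at h1
  rw [Prod.snd_sub, ← dist_eq_norm] at h2
  refine ⟨⟨by linarith [hq'.1.1], by linarith [hq'.1.2]⟩, mem_closedBall.2 ?_⟩
  linarith [dist_triangle p.2 q.2 x₀, mem_closedBall.1 hq'.2]

lemma neg_log_le_integral_molTest (H : NonnegSupersolution s Λ T Ω A K v Dv a b ρ x₀)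
    (hζ : IsTimeCutoff a b a' b' ζ m) (hη : IsSpaceCutoff x₀ ρ' L η) (hε : 0 < ε) (hh : ε ≤ h)
    (hρ : ρ' < ρ) (n : ℕ) :
    -Real.log (h / ε) * volume.real (ball x₀ ρ) ≤
      ∫ p, onCyl a b ρ x₀ v p *
        fderiv ℝ (molTest ζ η ε h (onCyl a b ρ x₀ v) n) p (1, 0) := by
  have hψ := H.contDiff_potTest_mol hζ hη hε hh n
  have hc := hasCompactSupport_potTest (ε := ε) (h := h) hζ hη (mol n (onCyl a b ρ x₀ v))
  have hcont : Continuous fun q => fderiv ℝ (potTest ζ η ε h (mol n (onCyl a b ρ x₀ v))) q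
      ((1, 0) : ℝ × Ed d) := (hψ.continuous_fderiv (by norm_num)).clm_apply continuous_const
  have hi := hcont.integrable_of_hasCompactSupport (μ := volume) (hc.fderiv_apply ℝ _)
  have e : ∀ p, fderiv ℝ (molTest ζ η ε h (onCyl a b ρ x₀ v) n) p ((1, 0) : ℝ × Ed d) =
      mol n (fun q => fderiv ℝ (potTest ζ η ε h (mol n (onCyl a b ρ x₀ v))) q (1, 0)) p :=
    fun p => fderiv_mol_apply n hψ hc p _
  simp only [e]
  rw [integral_mul_mol n (integrable_of_memLp_two_onCyl H.memLp_pair.1) hi]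
  exact neg_log_mul_volume_le_integral_time hζ hη hρ
    ((H.contDiff_mol_onCyl n).of_le (by exact_mod_cast le_top)) (H.mol_onCyl_nonneg n) hε hh

lemma fderiv_molTest_space (H : NonnegSupersolution s Λ T Ω A K v Dv a b ρ x₀)
    (hζ : IsTimeCutoff a b a' b' ζ m) (hη : IsSpaceCutoff x₀ ρ' L η) (hε : 0 < ε) (hh : ε ≤ h)
    (ha : a + γ ≤ a') (hb : b' + γ ≤ b) (hρ : ρ' + γ ≤ ρ) {n : ℕ}
    (hn : 1 / ((n : ℝ) + 1) ≤ γ) (p : ℝ × Ed d) (e : Ed d) :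
    fderiv ℝ (molTest ζ η ε h (onCyl a b ρ x₀ v) n) p (0, e) =
      ⟪mol n (potGrad ζ η ε h (mol n (onCyl a b ρ x₀ v)) (mol n (onCyl a b ρ x₀ Dv))) p, e⟫ := by
  rw [molTest, fderiv_mol_apply n (H.contDiff_potTest_mol hζ hη hε hh n)
    (hasCompactSupport_potTest hζ hη _),
    ← mol_inner n ((H.memLp_potGrad_mol hζ hη hε hh n).locallyIntegrable (by norm_num))]
  congr 1
  ext q
  refine fderiv_potTest_space (hζ.smooth.of_le (by exact_mod_cast le_top))
    (hη.smooth.of_le (by exact_mod_cast le_top))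
    ((H.contDiff_mol_onCyl n).of_le (by exact_mod_cast le_top)) (H.mol_onCyl_nonneg n) hε hh e
    fun h1 h2 => H.fderiv_mol_onCyl ((ball_subset_ball hn).trans
      (ball_subset_cylinder ha hb hρ (p := q) ⟨?_, ?_⟩)) e
  · by_contra h0; exact h1 (hζ.eq_zero _ h0)
  · by_contra h0; exact h2 (hη.eq_zero _ h0)

lemma lintegral_onCyl_translate_sq_le (H : NonnegSupersolution s Λ T Ω A K v Dv a b ρ x₀)
    (hγ : 0 < γ) {α β ρ₁ : ℝ} (hα : a + γ ≤ α) (hβ : β + γ ≤ b) {z : Ed d}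
    (hρ₁ : ρ₁ + ‖z‖ + γ ≤ ρ) :
    ∫⁻ p in Icc α β ×ˢ ball x₀ ρ₁,
      ‖onCyl a b ρ x₀ v (p.1, p.2 + z) - onCyl a b ρ x₀ v p‖ₑ ^ 2 ≤
      ENNReal.ofReal (‖z‖ ^ 2) * ∫⁻ p, ‖onCyl a b ρ x₀ Dv p‖ₑ ^ 2 := by
  refine (H.lintegral_comp_translate_sq_le (Γ := fun c => c) (g := fun _ => 1) (M := 1) hγ
    (S' := Icc α β ×ˢ closedBall x₀ (ρ₁ + ‖z‖)) (measurableSet_Icc.prod measurableSet_ball)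
    (measurableSet_Icc.prod measurableSet_closedBall) z (fun p hp θ hθ => ⟨?_, ?_⟩)
    (fun p hp => ball_subset_cylinder hα hβ hρ₁ hp) (fun c _ => hasDerivAt_id c)
    (fun c _ => continuousAt_const) fun c _ => by simp).trans ?_
  · simpa using hp.1
  · rw [mem_closedBall, dist_eq_norm]
    have h1 := mem_ball.1 hp.2
    rw [dist_eq_norm] at h1
    calc ‖(p + θ • ((0, z) : ℝ × Ed d)).2 - x₀‖ = ‖(p.2 - x₀) + θ • z‖ := by
          congr 1; simp only [Prod.snd_add, Prod.smul_snd]; abel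
      _ ≤ ‖p.2 - x₀‖ + θ * ‖z‖ := (norm_add_le _ _).trans_eq (by
          rw [norm_smul, Real.norm_of_nonneg hθ.1])
      _ ≤ ρ₁ + ‖z‖ := by nlinarith [hθ.2, norm_nonneg z]
  · refine mul_le_mul_right ?_ _
    simp only [one_smul]
    exact setLIntegral_le_lintegral _ _

lemma lintegral_molTest_translate_sq_le (H : NonnegSupersolution s Λ T Ω A K v Dv a b ρ x₀)
    (hζ : IsTimeCutoff a b a' b' ζ m) (hη : IsSpaceCutoff x₀ ρ' L η) (hε : 0 < ε) (hh : ε ≤ h)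
    (ha : a + γ ≤ a') (hb : b' + γ ≤ b) (hρ : ρ' + γ ≤ ρ) {n : ℕ}
    (hn : 1 / ((n : ℝ) + 1) ≤ γ) (z : Ed d) :
    ∫⁻ p, ‖molTest ζ η ε h (onCyl a b ρ x₀ v) n (p.1, p.2 + z) -
        molTest ζ η ε h (onCyl a b ρ x₀ v) n p‖ₑ ^ 2 ≤
      ENNReal.ofReal (‖z‖ ^ 2) * ∫⁻ p, ‖potGrad ζ η ε h (mol n (onCyl a b ρ x₀ v))
        (mol n (onCyl a b ρ x₀ Dv)) p‖ₑ ^ 2 := by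
  have h1 := lintegral_translation_sq_le (f := molTest ζ η ε h (onCyl a b ρ x₀ v) n)
    ((0, z) : ℝ × Ed d) MeasurableSet.univ MeasurableSet.univ (fun _ _ _ _ => mem_univ _)
    ((H.contDiff_molTest hζ hη hε hh n).of_le (by exact_mod_cast le_top))
  simp only [setLIntegral_univ, Prod.add_def, add_zero] at h1
  refine h1.trans ?_
  refine le_trans ?_ (mul_le_mul_right (lintegral_mol_sq_le n
    (H.memLp_potGrad_mol hζ hη hε hh n).1) _)
  rw [← lintegral_const_mul' _ _ ENNReal.ofReal_ne_top]
  refine lintegral_mono fun p => ?_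
  rw [H.fderiv_molTest_space hζ hη hε hh ha hb hρ hn, Real.enorm_eq_ofReal_abs,
    ← ENNReal.ofReal_pow (abs_nonneg _), ← ofReal_norm, ← ENNReal.ofReal_pow (norm_nonneg _),
    ← ENNReal.ofReal_mul (by positivity), ← mul_pow]
  refine ENNReal.ofReal_le_ofReal (pow_le_pow_left₀ (abs_nonneg _) ?_ 2)
  rw [mul_comm]
  exact abs_real_inner_le_norm _ _

/-- The estimate obtained by testing the equation with the mollified test function. -/
lemma neg_log_le_molTest (H : NonnegSupersolution s Λ T Ω A K v Dv a b ρ x₀)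
    (hζ : IsTimeCutoff a b a' b' ζ m) (hη : IsSpaceCutoff x₀ ρ' L η) (hε : 0 < ε) (hh : ε ≤ h)
    (hγ : 0 < γ) (ha : a + 4 * γ ≤ a') (hb : b' + 4 * γ ≤ b) (hρ : ρ' + 4 * γ ≤ ρ) :
    ∃ N : ℝ, 0 ≤ N ∧ ∀ᶠ n : ℕ in atTop, ∀ r ∈ Ioc 0 γ,
      -Real.log (h / ε) * volume.real (ball x₀ ρ) ≤
        (∫ p, ⟪onCyl a b ρ x₀ (fun t x => A t x (Dv t x)) p,
          mol n (potGrad ζ η ε h (mol n (onCyl a b ρ x₀ v)) (mol n (onCyl a b ρ x₀ Dv))) p⟫) +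
        (∫ z in (nearDiag d r)ᶜ, nonlocalForm K v (molTest ζ η ε h (onCyl a b ρ x₀ v) n) z
          ∂((volume.restrict (Ioc a b)).prod (volume.prod volume))) + N * r ^ (2 - 2 * s) := by
  obtain ⟨C, hC, hCk⟩ := exists_lintegral_sq_kern_le (d := d) H.dim H.order
  set V := onCyl a b ρ x₀ v with hV
  set W := onCyl a b ρ x₀ Dv with hW
  set P := potGrad ζ η ε h V W with hP
  set N₁ := ∫⁻ p, ‖W p‖ₑ ^ 2 with hN₁
  set N₂ := (∫⁻ p, ‖P p‖ₑ ^ 2) + 1 with hN₂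
  have hN₁f : N₁ ≠ ⊤ := ((memLp_two_iff H.memLp_pair.2.1).1 H.memLp_pair.2).ne
  have hPm := H.memLp_potGrad_onCyl hζ hη hε hh
  have hPf : (∫⁻ p, ‖P p‖ₑ ^ 2) ≠ ⊤ := ((memLp_two_iff hPm.1).1 hPm).ne
  have hN₂f : N₂ ≠ ⊤ := ENNReal.add_ne_top.2 ⟨hPf, ENNReal.one_ne_top⟩
  set N₀ := ENNReal.ofReal Λ * (N₁ + N₂) with hN₀
  have hN₀f : N₀ ≠ ⊤ := ENNReal.mul_ne_top ENNReal.ofReal_ne_top (ENNReal.add_ne_top.2 ⟨hN₁f, hN₂f⟩)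
  refine ⟨N₀.toReal * C, by positivity, ?_⟩
  have hev := (tendsto_lintegral_sq_of_tendsto (fun n => (H.memLp_potGrad_mol hζ hη hε hh n).1)
    hPm (H.tendsto_potGrad_mol hζ hη hε hh)).eventually
    (Iio_mem_nhds (ENNReal.lt_add_right hPf one_ne_zero))
  filter_upwards [hev, (tendsto_one_div_add_atTop_nhds_zero_nat (𝕜 := ℝ)).eventually
    (Iio_mem_nhds hγ)] with n hn₂ hn r hr
  have hn' : 1 / ((n : ℝ) + 1) ≤ γ := le_of_lt hn
  set g := molTest ζ η ε h V n with hg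
  have hgs := H.contDiff_molTest hζ hη hε hh n
  have hgm : Measurable g := hgs.continuous.measurable
  have hgS : ∀ p ∉ Icc (a' - γ) (b' + γ) ×ˢ closedBall x₀ (ρ' + γ), g p = 0 :=
    fun p hp => molTest_eq_zero hζ hη V hn' hp
  have hSQ : Icc (a' - γ) (b' + γ) ×ˢ closedBall x₀ (ρ' + γ) ⊆ Ioo a b ×ˢ ball x₀ ρ :=
    prod_mono (Icc_subset_Ioo (by linarith) (by linarith)) (closedBall_subset_ball (by linarith))
  have hgQ : ∀ p ∉ Ioo a b ×ˢ ball x₀ ρ, g p = 0 := fun p hp => hgS p fun h' => hp (hSQ h')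
  have hVi := integrable_of_memLp_two_onCyl H.memLp_pair.1
  have hnear : ∫⁻ z in nearDiag d r, ‖nonlocalForm K v g z‖ₑ
      ∂((volume.restrict (Ioc a b)).prod (volume.prod volume)) ≤
      N₀ * ENNReal.ofReal (C * r ^ (2 - 2 * s)) := by
    refine (lintegral_nearDiag_nonlocalForm_le H.kernel H.ellip (N₁ := N₁) (N₂ := N₂) (ρ := ρ)
      (ρ₁ := ρ' + 2 * γ) (V := V) rfl (measurable_onCyl H.reg.meas) hgm hgS
      (Icc_subset_Ioo (by linarith) (by linarith)) (by linarith [hr.2]) (by linarith)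
      (fun z hz => ?_) (fun z => ?_) _).trans (mul_le_mul_right (hCk r hr.1) _)
    · exact H.lintegral_onCyl_translate_sq_le hγ (by linarith) (by linarith)
        (by linarith [hr.2])
    · refine (H.lintegral_molTest_translate_sq_le hζ hη hε hh (by linarith) (by linarith)
        (by linarith) hn' z).trans (mul_le_mul_right (le_of_lt hn₂) _)
  have hnearf : IntegrableOn (nonlocalForm K v g) (nearDiag d r)
      ((volume.restrict (Ioc a b)).prod (volume.prod volume)) :=
    ⟨(measurable_nonlocalForm H.kernel.meas H.reg.meas hgm).aestronglyMeasurable,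
      hnear.trans_lt (ENNReal.mul_lt_top hN₀f.lt_top ENNReal.ofReal_lt_top)⟩
  have hfar : IntegrableOn (nonlocalForm K v g) (nearDiag d r)ᶜ
      ((volume.restrict (Ioc a b)).prod (volume.prod volume)) :=
    integrable_nonlocalForm_far H.kernel H.ellip hr.1 H.reg.meas
      (integrable_farWeight H.reg H.order.1 H.time_subset hr.1 H.radius_pos hVi) hgm
      (by positivity) (H.abs_molTest_le hζ hη hε hh n) hgQ _
  have hint : Integrable (nonlocalForm K v g)
      ((volume.restrict (Ioc a b)).prod (volume.prod volume)) := by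
    rw [← integrableOn_univ, ← union_compl_self (nearDiag d r)]
    exact hnearf.union hfar
  have htest := supersolution_tested H.super H.lt H.time_subset H.space_subset (V := V) rfl rfl hVi
    (integrable_of_memLp_two_onCyl H.memLp_flux) hgs (H.molTest_nonneg hζ hε hh n)
    (isCompact_cylinder _ _ _ _) hSQ hgS hint
  have hnear' : ∫ z in nearDiag d r, nonlocalForm K v g z
      ∂((volume.restrict (Ioc a b)).prod (volume.prod volume)) ≤
      N₀.toReal * C * r ^ (2 - 2 * s) := by
    refine (le_abs_self _).trans ?_
    rw [← Real.norm_eq_abs, ← toReal_enorm]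
    refine (ENNReal.toReal_mono (ENNReal.mul_ne_top hN₀f ENNReal.ofReal_ne_top)
      ((enorm_integral_le_lintegral_enorm _).trans hnear)).trans_eq ?_
    rw [ENNReal.toReal_mul, ENNReal.toReal_ofReal (by have := hr.1; positivity), mul_assoc]
  have hsplit := integral_add_compl (measurableSet_nearDiag r) hint
  have hspace : ∀ p, fderiv ℝ g p (0, onCyl a b ρ x₀ (fun t x => A t x (Dv t x)) p) =
      ⟪onCyl a b ρ x₀ (fun t x => A t x (Dv t x)) p,
        mol n (potGrad ζ η ε h (mol n V) (mol n W)) p⟫ := fun p => by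
    rw [real_inner_comm]
    exact H.fderiv_molTest_space hζ hη hε hh (by linarith) (by linarith) (by linarith) hn' p _
  have htime := H.neg_log_le_integral_molTest hζ hη hε hh (by linarith : ρ' < ρ) n
  have e1 : (∫ p, fderiv ℝ g p (0, (Ioo a b ×ˢ ball x₀ ρ).indicator
      (fun p => A p.1 p.2 (Dv p.1 p.2)) p)) = ∫ p, ⟪onCyl a b ρ x₀ (fun t x => A t x (Dv t x)) p,
        mol n (potGrad ζ η ε h (mol n V) (mol n W)) p⟫ := integral_congr_ae (ae_of_all _ hspace)
  rw [e1] at htest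
  have e2 : (∫ z : ℝ × Ed d × Ed d, (v z.1 z.2.1 - v z.1 z.2.2) *
      (g (z.1, z.2.1) - g (z.1, z.2.2)) * K z.1 z.2.1 z.2.2
        ∂((volume.restrict (Ioc a b)).prod (volume.prod volume))) =
      ∫ z, nonlocalForm K v g z ∂((volume.restrict (Ioc a b)).prod (volume.prod volume)) := rfl
  rw [e2, ← hsplit] at htest
  linarith

/-- The weak inequality with test function `ζ η² F(v)`, up to an error near the diagonal. -/
lemma neg_log_le_potTest (H : NonnegSupersolution s Λ T Ω A K v Dv a b ρ x₀)
    (hζ : IsTimeCutoff a b a' b' ζ m) (hη : IsSpaceCutoff x₀ ρ' L η) (hε : 0 < ε) (hh : ε ≤ h)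
    (hγ : 0 < γ) (ha : a + 4 * γ ≤ a') (hb : b' + 4 * γ ≤ b) (hρ : ρ' + 4 * γ ≤ ρ) :
    ∃ N : ℝ, 0 ≤ N ∧ ∀ r ∈ Ioc 0 γ,
      -Real.log (h / ε) * volume.real (ball x₀ ρ) ≤
        (∫ p, ⟪onCyl a b ρ x₀ (fun t x => A t x (Dv t x)) p,
          potGrad ζ η ε h (onCyl a b ρ x₀ v) (onCyl a b ρ x₀ Dv) p⟫) +
        (∫ z in (nearDiag d r)ᶜ, nonlocalForm K v (potTest ζ η ε h (onCyl a b ρ x₀ v)) z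
          ∂((volume.restrict (Ioc a b)).prod (volume.prod volume))) + N * r ^ (2 - 2 * s) := by
  obtain ⟨N, hN, hev⟩ := H.neg_log_le_molTest hζ hη hε hh hγ ha hb hρ
  refine ⟨N, hN, fun r hr => ?_⟩
  set V := onCyl a b ρ x₀ v with hV
  set W := onCyl a b ρ x₀ Dv with hW
  have hψn := fun n => memLp_potTest hζ hη hε hh (ae_of_all volume (H.mol_onCyl_nonneg n))
    (H.continuous_comp_mol n (continuousAt_potF hε hh)).aestronglyMeasurable
  have hψ := memLp_potTest hζ hη hε hh H.onCyl_nonneg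
    (H.aestronglyMeasurable_comp_onCyl (continuousAt_potF hε hh))
  obtain ⟨ns, hns, hae⟩ := exists_subseq_tendsto_ae_of_lintegral_sq
    (fun n => (H.contDiff_molTest hζ hη hε hh n).continuous.aestronglyMeasurable) hψ.1
    (tendsto_mol_L2_of_tendsto hψn hψ (H.tendsto_potTest_mol hζ hη hε hh))
  have hmolP : ∀ n, MemLp (mol n (potGrad ζ η ε h (mol n V) (mol n W))) 2 := fun n => by
    have hP := H.memLp_potGrad_mol hζ hη hε hh n
    exact (memLp_two_iff (contDiff_mol n
      (hP.locallyIntegrable (by norm_num))).continuous.aestronglyMeasurable).2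
      ((lintegral_mol_sq_le n hP.1).trans_lt ((memLp_two_iff hP.1).1 hP))
  have t1 := (tendsto_integral_inner hmolP (H.memLp_potGrad_onCyl hζ hη hε hh) H.memLp_flux
    (tendsto_mol_L2_of_tendsto (H.memLp_potGrad_mol hζ hη hε hh)
      (H.memLp_potGrad_onCyl hζ hη hε hh) (H.tendsto_potGrad_mol hζ hη hε hh))).comp
      hns.tendsto_atTop
  have hsmall : ∀ᶠ k : ℕ in atTop, 1 / ((ns k : ℝ) + 1) ≤ γ :=
    hns.tendsto_atTop.eventually (((tendsto_one_div_add_atTop_nhds_zero_nat (𝕜 := ℝ)).eventually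
      (Iio_mem_nhds hγ)).mono fun n hn => le_of_lt hn)
  have t2 := tendsto_integral_nonlocalForm_far H.kernel H.ellip hr.1 H.reg.meas
    (integrable_farWeight H.reg H.order.1 H.time_subset hr.1 H.radius_pos
      (integrable_of_memLp_two_onCyl H.memLp_pair.1)) (M := ε⁻¹)
    (g := fun k => molTest ζ η ε h V (ns k))
    (fun k => (H.contDiff_molTest hζ hη hε hh (ns k)).continuous.measurable)
    (by positivity) (Eventually.of_forall fun k => H.abs_molTest_le hζ hη hε hh (ns k))
    (hsmall.mono fun k hk p hp => molTest_eq_zero hζ hη V hk fun h' => hp (prod_mono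
      (Icc_subset_Ioo (by linarith) (by linarith)) (closedBall_subset_ball (by linarith)) h'))
    hae (Ioc a b)
  refine ge_of_tendsto ((t1.add t2).add_const (N * r ^ (2 - 2 * s))) ?_
  exact (hns.tendsto_atTop.eventually hev).mono fun k hk => hk r hr

end NonnegSupersolution

end LimitInequality

section NonlocalBounds

variable {s Λ T a b ρ a' b' ρ' L ε h R : ℝ} {K : ℝ → Ed d → Ed d → ℝ} {v : ℝ → Ed d → ℝ}
  {x₀ : Ed d} {ζ m : ℝ → ℝ} {η : Ed d → ℝ} {S : Set ℝ}

/-- Pairs of points of `B_R` at which `v` is at least `h/2` and at most `ε`, respectively. -/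
def transitionPairs (S : Set ℝ) (x₀ : Ed d) (R ε h : ℝ) (v : ℝ → Ed d → ℝ) :
    Set (ℝ × Ed d × Ed d) :=
  {z | z.1 ∈ S ∧ (z.2.1 ∈ ball x₀ R ∧ h / 2 ≤ v z.1 z.2.1) ∧
    (z.2.2 ∈ ball x₀ R ∧ v z.1 z.2.2 ≤ ε)}

/-- Majorant for the interaction between points of the cylinder. -/
def innerMajorant (s Λ L ρ : ℝ) (x₀ : Ed d) (z : ℝ × Ed d × Ed d) : ℝ :=
  (ball x₀ ρ).indicator 1 z.2.1 *
    (3 * Λ * L ^ 2 * (ball (0 : Ed d) (2 * ρ)).indicator (fun w => ‖w‖ ^ 2 * kern s w)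
      (z.2.2 - z.2.1))

/-- Majorant for the interaction between a point of the cylinder and a point outside. -/
def outerMajorant (s Λ ρ' ρ ε : ℝ) (x₀ : Ed d) (v : ℝ → Ed d → ℝ) (z : ℝ × Ed d × Ed d) : ℝ :=
  (closedBall x₀ ρ').indicator 1 z.2.1 * (Λ * 4 ^ ((d : ℝ) + 2 * s) *
    (ball x₀ ρ)ᶜ.indicator (fun y => (1 + ε⁻¹ * max (-v z.1 y) 0) * kern s (y - x₀)) z.2.2)

lemma innerMajorant_nonneg (hΛ : 1 ≤ Λ) (z : ℝ × Ed d × Ed d) :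
    0 ≤ innerMajorant s Λ L ρ x₀ z := by
  have hk := fun w : Ed d => kern_nonneg s w
  refine mul_nonneg (indicator_nonneg (fun _ _ => zero_le_one) _) (mul_nonneg (by positivity)
    (indicator_nonneg (fun w _ => mul_nonneg (by positivity) (hk w)) _))

lemma outerMajorant_nonneg (hΛ : 1 ≤ Λ) (hε : 0 < ε) (z : ℝ × Ed d × Ed d) :
    0 ≤ outerMajorant s Λ ρ' ρ ε x₀ v z := by
  have hk := fun w : Ed d => kern_nonneg s w
  refine mul_nonneg (indicator_nonneg (fun _ _ => zero_le_one) _) (mul_nonneg (by positivity)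
    (indicator_nonneg (fun y _ => mul_nonneg ?_ (hk _)) _))
  have : 0 ≤ max (-v z.1 y) 0 := le_max_right _ _
  positivity

lemma nonlocalForm_swap (hK : KernelHyp d s Λ K) (g : ℝ × Ed d → ℝ) (t : ℝ) (x y : Ed d) :
    nonlocalForm K v g (t, x, y) = nonlocalForm K v g (t, y, x) := by
  simp only [nonlocalForm, hK.symm t x y]
  ring

lemma kern_le_four_rpow_mul (hs : 0 < s) {x y : Ed d} (h1 : ‖y - x₀‖ ≤ 4 * ‖y - x‖)
    (h2 : 0 < ‖y - x₀‖) : kern s (y - x) ≤ 4 ^ ((d : ℝ) + 2 * s) * kern s (y - x₀) := by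
  have h3 : 0 < ‖y - x‖ := by linarith
  have hp : (0 : ℝ) ≤ (d : ℝ) + 2 * s := by positivity
  have h4 := Real.rpow_le_rpow h2.le h1 hp
  rw [Real.mul_rpow (by norm_num) h3.le] at h4
  rw [kern, kern, ← div_eq_mul_inv, inv_eq_one_div,
    div_le_div_iff₀ (Real.rpow_pos_of_pos h3 _) (Real.rpow_pos_of_pos h2 _), one_mul]
  exact h4

lemma nonlocalForm_le_outerMajorant (hK : KernelHyp d s Λ K) (hΛ : 1 ≤ Λ) (hs : 0 < s)
    (hζ : IsTimeCutoff a b a' b' ζ m) (hη : IsSpaceCutoff x₀ ρ' L η) (hε : 0 < ε) (hh : ε ≤ h)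
    (hρ' : 4 * ρ' ≤ 3 * ρ) (hρ : 0 < ρ) {t : ℝ} {x y : Ed d} (ht : t ∈ Ioo a b)
    (hx : x ∈ ball x₀ ρ) (hy : y ∉ ball x₀ ρ) (hvx : 0 ≤ v t x) :
    nonlocalForm K v (potTest ζ η ε h (onCyl a b ρ x₀ v)) (t, x, y) ≤
      outerMajorant s Λ ρ' ρ ε x₀ v (t, x, y) := by
  have hVx : onCyl a b ρ x₀ v (t, x) = v t x := indicator_of_mem (mk_mem_prod ht hx) _
  have hyx : ρ ≤ ‖y - x₀‖ := by rwa [mem_ball, not_lt, dist_eq_norm] at hy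
  have hψy : potTest ζ η ε h (onCyl a b ρ x₀ v) (t, y) = 0 :=
    potTest_eq_zero hζ hη fun h' => by
      have := mem_closedBall.1 h'.2
      rw [dist_eq_norm] at this
      linarith
  by_cases hx' : x ∈ closedBall x₀ ρ'
  swap
  · have hψx : potTest ζ η ε h (onCyl a b ρ x₀ v) (t, x) = 0 :=
      potTest_eq_zero hζ hη fun h' => hx' h'.2
    simp only [nonlocalForm, hψx, hψy, sub_zero, mul_zero, zero_mul]
    exact outerMajorant_nonneg hΛ hε _
  have hxx : ‖x - x₀‖ ≤ ρ' := by rwa [mem_closedBall, dist_eq_norm] at hx'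
  have htri : ‖y - x₀‖ ≤ ‖y - x‖ + ‖x - x₀‖ := by simpa using norm_add_le (y - x) (x - x₀)
  have h0 : 0 < ‖y - x‖ := by linarith
  have hne : x ≠ y := fun h' => by simp [h'] at h0
  set ψ := potTest ζ η ε h (onCyl a b ρ x₀ v) (t, x) with hψ
  have hF0 : 0 ≤ potF ε h (v t x) := potF_nonneg hε hh hvx
  have hη2 : η x ^ 2 ≤ 1 := pow_le_one₀ (hη.nonneg x) (hη.le_one x)
  have hcut : ζ t * η x ^ 2 ≤ 1 := mul_le_one₀ (hζ.le_one t) (sq_nonneg _) hη2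
  have hcut0 : 0 ≤ ζ t * η x ^ 2 := mul_nonneg (hζ.nonneg t) (sq_nonneg _)
  have hψe : ψ = ζ t * η x ^ 2 * potF ε h (v t x) := by rw [hψ, potTest, hVx]; ring
  have hψ0 : 0 ≤ ψ := by rw [hψe]; positivity
  have hψ1 : v t x * ψ ≤ 1 := by
    have h1 := mul_potF_le hε hh hvx
    have h2 : 0 ≤ v t x * potF ε h (v t x) := mul_nonneg hvx hF0
    rw [hψe]
    nlinarith
  have hψ2 : ψ ≤ ε⁻¹ := by
    rw [hψe]
    exact (mul_le_of_le_one_left hF0 hcut).trans (potF_le hε hh hvx)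
  have hm0 : 0 ≤ max (-v t y) 0 := le_max_right _ _
  have hm1 : -v t y ≤ max (-v t y) 0 := le_max_left _ _
  have hK1 : K t x y ≤ Λ * (4 ^ ((d : ℝ) + 2 * s) * kern s (y - x₀)) :=
    (hK.le_kern hne).trans (mul_le_mul_of_nonneg_left
      (kern_le_four_rpow_mul hs (by linarith) (by linarith)) (by linarith))
  have hmain : (v t x - v t y) * ψ ≤ 1 + ε⁻¹ * max (-v t y) 0 := by
    nlinarith [mul_le_mul_of_nonneg_right hψ2 hm0, mul_le_mul_of_nonneg_right hm1 hψ0]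
  rw [outerMajorant, indicator_of_mem hx', indicator_of_mem (show y ∈ (ball x₀ ρ)ᶜ from hy),
    nonlocalForm, hψy, sub_zero, Pi.one_apply, one_mul]
  calc (v t x - v t y) * ψ * K t x y ≤ (1 + ε⁻¹ * max (-v t y) 0) * K t x y :=
        mul_le_mul_of_nonneg_right hmain (hK.nonneg hΛ hne)
    _ ≤ (1 + ε⁻¹ * max (-v t y) 0) * (Λ * (4 ^ ((d : ℝ) + 2 * s) * kern s (y - x₀))) :=
        mul_le_mul_of_nonneg_left hK1 (by positivity)
    _ = _ := by ring

lemma nonlocalForm_le_innerMajorant (hK : KernelHyp d s Λ K) (hΛ : 1 ≤ Λ)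
    (hζ : IsTimeCutoff a b a' b' ζ m) (hη : IsSpaceCutoff x₀ ρ' L η) (hε : 0 < ε) (hh : ε ≤ h)
    {t : ℝ} {x y : Ed d} (ht : t ∈ Ioo a b)
    (hx : x ∈ ball x₀ ρ) (hy : y ∈ ball x₀ ρ) (hvx : 0 ≤ v t x) (hvy : 0 ≤ v t y)
    (hne : x ≠ y) :
    nonlocalForm K v (potTest ζ η ε h (onCyl a b ρ x₀ v)) (t, x, y) ≤
      innerMajorant s Λ L ρ x₀ (t, x, y) := by
  have hVx : onCyl a b ρ x₀ v (t, x) = v t x := indicator_of_mem (mk_mem_prod ht hx) _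
  have hVy : onCyl a b ρ x₀ v (t, y) = v t y := indicator_of_mem (mk_mem_prod ht hy) _
  have hyx : y - x ∈ ball (0 : Ed d) (2 * ρ) := by
    rw [mem_ball_zero_iff, ← dist_eq_norm]
    linarith [dist_triangle_right y x x₀, mem_ball.1 hx, mem_ball.1 hy]
  have h1 := mul_cutoff_potF_sub_le hε hh hvx hvy (η x) (η y)
  have h2 : (η x - η y) ^ 2 ≤ L ^ 2 * ‖y - x‖ ^ 2 := by
    rw [← mul_pow, norm_sub_rev]
    exact sq_le_sq' (abs_le.1 (hη.lip x y)).1 (abs_le.1 (hη.lip x y)).2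
  have h3 : 0 ≤ L ^ 2 * ‖y - x‖ ^ 2 := by positivity
  rw [innerMajorant, indicator_of_mem hx, indicator_of_mem hyx, Pi.one_apply, one_mul]
  simp only [nonlocalForm, potTest, hVx, hVy]
  calc (v t x - v t y) * (ζ t * (η x ^ 2 * potF ε h (v t x)) -
        ζ t * (η y ^ 2 * potF ε h (v t y))) * K t x y
      = ζ t * ((v t x - v t y) * (η x ^ 2 * potF ε h (v t x) - η y ^ 2 * potF ε h (v t y))) *
          K t x y := by ring
    _ ≤ (3 * (L ^ 2 * ‖y - x‖ ^ 2)) * K t x y := by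
        refine mul_le_mul_of_nonneg_right ?_ (hK.nonneg hΛ hne)
        calc _ ≤ ζ t * (3 * (L ^ 2 * ‖y - x‖ ^ 2)) :=
              mul_le_mul_of_nonneg_left (by linarith) (hζ.nonneg t)
          _ ≤ _ := mul_le_of_le_one_left (by positivity) (hζ.le_one t)
    _ ≤ (3 * (L ^ 2 * ‖y - x‖ ^ 2)) * (Λ * kern s (y - x)) :=
        mul_le_mul_of_nonneg_left (hK.le_kern hne) (by positivity)
    _ = _ := by ring

lemma nonlocalForm_le_neg_of_mem_transitionPairs (hK : KernelHyp d s Λ K) (hΛ : 1 ≤ Λ)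
    (hs : 0 < s) (hε : 0 < ε) (hh : 8 * ε ≤ h) (hRρ : R ≤ ρ) (hS : S ⊆ Ioo a b)
    (hζS : ∀ t ∈ S, ζ t = 1) (hηR : ∀ x ∈ ball x₀ R, η x = 1) {t : ℝ} {x y : Ed d}
    (hz : (t, x, y) ∈ transitionPairs S x₀ R ε h v) (hvy : 0 ≤ v t y) (hne : x ≠ y) :
    nonlocalForm K v (potTest ζ η ε h (onCyl a b ρ x₀ v)) (t, x, y) ≤
      -(Λ⁻¹ * (h / ε / 64) * ((2 * R) ^ ((d : ℝ) + 2 * s))⁻¹) := by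
  obtain ⟨ht, ⟨hx, hvx⟩, hy, hvy'⟩ := hz
  simp only at ht hx hvx hy hvy'
  have hVx : onCyl a b ρ x₀ v (t, x) = v t x :=
    indicator_of_mem (mk_mem_prod (hS ht) (ball_subset_ball hRρ hx)) _
  have hVy : onCyl a b ρ x₀ v (t, y) = v t y :=
    indicator_of_mem (mk_mem_prod (hS ht) (ball_subset_ball hRρ hy)) _
  have h1 := mul_potF_sub_ge hε hh hvy hvy' hvx
  have hxy : ‖x - y‖ ≤ 2 * R := by
    rw [← dist_eq_norm]
    linarith [dist_triangle_right x y x₀, mem_ball.1 hx, mem_ball.1 hy]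
  have h0 : 0 < ‖x - y‖ := norm_pos_iff.2 (sub_ne_zero.2 hne)
  have hK1 : Λ⁻¹ * ((2 * R) ^ ((d : ℝ) + 2 * s))⁻¹ ≤ K t x y := by
    refine le_trans ?_ (hK.lower t x y hne)
    rw [div_eq_mul_inv]
    refine mul_le_mul_of_nonneg_left (inv_anti₀ (Real.rpow_pos_of_pos h0 _)
      (Real.rpow_le_rpow h0.le hxy (by positivity))) (by positivity)
  have hK0 : 0 ≤ K t x y := hK.nonneg hΛ hne
  simp only [nonlocalForm, potTest, hVx, hVy, hζS t ht, hηR x hx, hηR y hy, one_pow, one_mul]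
  have h2 : 0 < h / ε / 64 := by
    have : 0 < h := by linarith
    positivity
  nlinarith [mul_le_mul_of_nonneg_right h1 hK0, mul_le_mul_of_nonneg_left hK1 h2.le]

lemma nonlocalForm_potTest_le (hK : KernelHyp d s Λ K) (hΛ : 1 ≤ Λ) (hs : 0 < s)
    (hζ : IsTimeCutoff a b a' b' ζ m) (hη : IsSpaceCutoff x₀ ρ' L η) (hε : 0 < ε)
    (hh : 8 * ε ≤ h) (hρ' : 4 * ρ' ≤ 3 * ρ) (hρ : 0 < ρ) (hRρ : R ≤ ρ) (hS : S ⊆ Ioo a b)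
    (hζS : ∀ t ∈ S, ζ t = 1) (hηR : ∀ x ∈ ball x₀ R, η x = 1) {t : ℝ} {x y : Ed d}
    (ht : t ∈ Ioo a b) (hvx : x ∈ ball x₀ ρ → 0 ≤ v t x) (hvy : y ∈ ball x₀ ρ → 0 ≤ v t y)
    (hne : x ≠ y) :
    nonlocalForm K v (potTest ζ η ε h (onCyl a b ρ x₀ v)) (t, x, y) ≤
      innerMajorant s Λ L ρ x₀ (t, x, y) + outerMajorant s Λ ρ' ρ ε x₀ v (t, x, y) +
        outerMajorant s Λ ρ' ρ ε x₀ v (t, y, x) -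
        (transitionPairs S x₀ R ε h v).indicator
          (fun _ => Λ⁻¹ * (h / ε / 64) * ((2 * R) ^ ((d : ℝ) + 2 * s))⁻¹) (t, x, y) := by
  have hh' : ε ≤ h := by linarith
  have i0 := innerMajorant_nonneg (s := s) (L := L) (ρ := ρ) (x₀ := x₀) hΛ (t, x, y)
  have o0 := outerMajorant_nonneg (s := s) (ρ' := ρ') (ρ := ρ) (x₀ := x₀) (v := v) hΛ hε (t, x, y)
  have o1 := outerMajorant_nonneg (s := s) (ρ' := ρ') (ρ := ρ) (x₀ := x₀) (v := v) hΛ hε (t, y, x)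
  by_cases hz : (t, x, y) ∈ transitionPairs S x₀ R ε h v
  · rw [indicator_of_mem hz]
    linarith [nonlocalForm_le_neg_of_mem_transitionPairs hK hΛ hs hε hh hRρ hS hζS hηR hz
      (hvy (ball_subset_ball hRρ hz.2.2.1)) hne]
  rw [indicator_of_notMem hz]
  by_cases hx : x ∈ ball x₀ ρ <;> by_cases hy : y ∈ ball x₀ ρ
  · linarith [nonlocalForm_le_innerMajorant hK hΛ hζ hη hε hh' ht hx hy (hvx hx) (hvy hy) hne]
  · linarith [nonlocalForm_le_outerMajorant hK hΛ hs hζ hη hε hh' hρ' hρ ht hx hy (hvx hx)]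
  · rw [nonlocalForm_swap hK]
    linarith [nonlocalForm_le_outerMajorant hK hΛ hs hζ hη hε hh' hρ' hρ ht hy hx (hvy hy)]
  · have hout : ∀ w ∉ ball x₀ ρ, potTest ζ η ε h (onCyl a b ρ x₀ v) (t, w) = 0 :=
      fun w hw => potTest_eq_zero hζ hη fun h' =>
        hw (closedBall_subset_ball (by linarith) h'.2)
    simp only [nonlocalForm, hout x hx, hout y hy, sub_zero, mul_zero, zero_mul]
    linarith

end NonlocalBounds

section MajorantIntegrals

variable {s Λ a b ρ ρ' L ε h R C M : ℝ} {v : ℝ → Ed d → ℝ} {x₀ : Ed d} {S : Set ℝ}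

lemma measurable_innerMajorant : Measurable (innerMajorant s Λ L ρ x₀) := by
  have h1 : Measurable ((ball x₀ ρ).indicator (1 : Ed d → ℝ)) :=
    measurable_one.indicator measurableSet_ball
  have h2 : Measurable ((ball (0 : Ed d) (2 * ρ)).indicator fun w => ‖w‖ ^ 2 * kern s w) :=
    ((measurable_norm.pow_const 2).mul (measurable_kern s)).indicator measurableSet_ball
  exact (h1.comp (by fun_prop : Measurable fun z : ℝ × Ed d × Ed d => z.2.1)).mul
    ((h2.comp (by fun_prop : Measurable fun z : ℝ × Ed d × Ed d => z.2.2 - z.2.1)).const_mul _)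

lemma measurable_outerMajorant (hv : Measurable (Function.uncurry v)) :
    Measurable (outerMajorant s Λ ρ' ρ ε x₀ v) := by
  have h1 : Measurable ((closedBall x₀ ρ').indicator (1 : Ed d → ℝ)) :=
    measurable_one.indicator measurableSet_closedBall
  have h2 : Measurable fun z : ℝ × Ed d × Ed d => max (-v z.1 z.2.2) 0 :=
    ((hv.comp (by fun_prop : Measurable fun z : ℝ × Ed d × Ed d => (z.1, z.2.2))).neg).max
      measurable_const
  have h3 : Measurable fun z : ℝ × Ed d × Ed d => kern s (z.2.2 - x₀) :=
    (measurable_kern s).comp (by fun_prop)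
  have h4 := (((h2.const_mul ε⁻¹).const_add 1).mul h3).indicator
    (measurableSet_ball.compl.preimage
      (by fun_prop : Measurable fun z : ℝ × Ed d × Ed d => z.2.2) (t := (ball x₀ ρ)ᶜ))
  exact (h1.comp (by fun_prop : Measurable fun z : ℝ × Ed d × Ed d => z.2.1)).mul
    (h4.const_mul _)

lemma lintegral_innerMajorant_le (hΛ : 1 ≤ Λ)
    (hC : ∫⁻ z in ball (0 : Ed d) (2 * ρ), ENNReal.ofReal (‖z‖ ^ 2 * kern s z) ≤
      ENNReal.ofReal C) (hC0 : 0 ≤ C) :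
    ∫⁻ z, ENNReal.ofReal (innerMajorant s Λ L ρ x₀ z)
        ∂((volume.restrict (Ioc a b)).prod (volume.prod volume)) ≤
      ENNReal.ofReal (volume.real (ball x₀ ρ) * (3 * Λ * L ^ 2 * ((b - a) * C))) := by
  have hm := (measurable_innerMajorant (s := s) (Λ := Λ) (L := L) (ρ := ρ)
    (x₀ := x₀)).ennreal_ofReal
  have hpt : ∀ (t : ℝ) (x : Ed d), ∫⁻ y, ENNReal.ofReal (innerMajorant s Λ L ρ x₀ (t, x, y)) ≤
      (ball x₀ ρ).indicator (fun _ => ENNReal.ofReal (3 * Λ * L ^ 2 * C)) x := by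
    intro t x
    by_cases hx : x ∈ ball x₀ ρ
    swap
    · simp [innerMajorant, hx]
    have e1 : ∀ y, ENNReal.ofReal (innerMajorant s Λ L ρ x₀ (t, x, y)) =
        ENNReal.ofReal (3 * Λ * L ^ 2) * (ball (0 : Ed d) (2 * ρ)).indicator
          (fun w => ENNReal.ofReal (‖w‖ ^ 2 * kern s w)) (y - x) := by
      intro y
      rw [innerMajorant, indicator_of_mem hx, Pi.one_apply, one_mul,
        ENNReal.ofReal_mul (by positivity)]
      congr 1
      by_cases hy : y - x ∈ ball (0 : Ed d) (2 * ρ) <;> simp [hy]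
    simp_rw [e1, indicator_of_mem hx]
    rw [lintegral_const_mul' _ _ ENNReal.ofReal_ne_top, lintegral_sub_right_eq_self
      (fun w => (ball (0 : Ed d) (2 * ρ)).indicator
        (fun w => ENNReal.ofReal (‖w‖ ^ 2 * kern s w)) w) x,
      lintegral_indicator measurableSet_ball,
      ENNReal.ofReal_mul (p := 3 * Λ * L ^ 2) (by positivity)]
    gcongr
  rw [lintegral_prod _ hm.aemeasurable]
  calc _ ≤ ∫⁻ _ in Ioc a b, ENNReal.ofReal (3 * Λ * L ^ 2 * C) * volume (ball x₀ ρ) := by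
        refine lintegral_mono fun t => ?_
        rw [lintegral_prod (fun q : Ed d × Ed d => ENNReal.ofReal
          (innerMajorant s Λ L ρ x₀ (t, q))) (hm.comp measurable_prodMk_left).aemeasurable]
        refine (lintegral_mono (hpt t)).trans_eq ?_
        rw [lintegral_indicator measurableSet_ball, setLIntegral_const]
    _ = _ := by
        rw [setLIntegral_const, Real.volume_Ioc, ← ofReal_measureReal measure_ball_lt_top.ne,
          ← ENNReal.ofReal_mul (by positivity), ← ENNReal.ofReal_mul (by positivity)]
        congr 1
        ring

lemma lintegral_outerMajorant_le (hv : Measurable (Function.uncurry v)) (hΛ : 1 ≤ Λ)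
    (hε : 0 < ε) (hab : a ≤ b) (hρ' : ρ' < ρ)
    (hC : ∫⁻ z in (ball (0 : Ed d) ρ)ᶜ, ENNReal.ofReal (kern s z) ≤ ENNReal.ofReal C)
    (hC0 : 0 ≤ C) (hM : 0 ≤ M)
    (htail : ∫⁻ t in Ioo a b, ∫⁻ y in (ball x₀ ρ)ᶜ,
      ENNReal.ofReal (max (-v t y) 0 * kern s (y - x₀)) ≤ ENNReal.ofReal M) :
    ∫⁻ z, ENNReal.ofReal (outerMajorant s Λ ρ' ρ ε x₀ v z)
        ∂((volume.restrict (Ioc a b)).prod (volume.prod volume)) ≤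
      ENNReal.ofReal (volume.real (ball x₀ ρ) *
        (Λ * 4 ^ ((d : ℝ) + 2 * s) * ((b - a) * C + ε⁻¹ * M))) := by
  have hm := (measurable_outerMajorant (s := s) (Λ := Λ) (ρ' := ρ') (ρ := ρ) (ε := ε)
    (x₀ := x₀) hv).ennreal_ofReal
  set J : ℝ → ℝ≥0∞ := fun t => ∫⁻ y in (ball x₀ ρ)ᶜ,
    ENNReal.ofReal (max (-v t y) 0 * kern s (y - x₀)) with hJ
  have hkm : Measurable fun y : Ed d => kern s (y - x₀) := (measurable_kern s).comp (by fun_prop)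
  have hC' : ∫⁻ y in (ball x₀ ρ)ᶜ, ENNReal.ofReal (kern s (y - x₀)) ≤ ENNReal.ofReal C := by
    refine le_trans (le_of_eq ?_) hC
    rw [← lintegral_indicator measurableSet_ball.compl,
      ← lintegral_indicator measurableSet_ball.compl, ← lintegral_sub_right_eq_self
        (fun w => (ball (0 : Ed d) ρ)ᶜ.indicator (fun w => ENNReal.ofReal (kern s w)) w) x₀]
    refine lintegral_congr fun y => ?_
    by_cases hy : y ∈ (ball x₀ ρ)ᶜ
    · rw [indicator_of_mem hy, indicator_of_mem]
      simpa [dist_eq_norm] using hy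
    · rw [indicator_of_notMem hy, indicator_of_notMem]
      simpa [dist_eq_norm] using hy
  have hmax : ∀ t y, 0 ≤ max (-v t y) 0 := fun t y => le_max_right _ _
  have hpt : ∀ (t : ℝ) (x : Ed d),
      ∫⁻ y, ENNReal.ofReal (outerMajorant s Λ ρ' ρ ε x₀ v (t, x, y)) ≤
      (ball x₀ ρ).indicator (fun _ => ENNReal.ofReal (Λ * 4 ^ ((d : ℝ) + 2 * s)) *
        (ENNReal.ofReal C + ENNReal.ofReal ε⁻¹ * J t)) x := by
    intro t x
    by_cases hx : x ∈ closedBall x₀ ρ'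
    swap
    · simp [outerMajorant, hx]
    have e1 : ∀ y, ENNReal.ofReal (outerMajorant s Λ ρ' ρ ε x₀ v (t, x, y)) =
        ENNReal.ofReal (Λ * 4 ^ ((d : ℝ) + 2 * s)) * (ball x₀ ρ)ᶜ.indicator
          (fun y => ENNReal.ofReal (kern s (y - x₀)) + ENNReal.ofReal ε⁻¹ *
            ENNReal.ofReal (max (-v t y) 0 * kern s (y - x₀))) y := by
      intro y
      rw [outerMajorant, indicator_of_mem hx, Pi.one_apply, one_mul,
        ENNReal.ofReal_mul (by positivity)]
      congr 1
      by_cases hy : y ∈ (ball x₀ ρ)ᶜ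
      · rw [indicator_of_mem hy, indicator_of_mem hy, ← ENNReal.ofReal_mul (by positivity),
          ← ENNReal.ofReal_add (kern_nonneg _ _)
            (mul_nonneg (by positivity) (mul_nonneg (hmax t y) (kern_nonneg _ _)))]
        congr 1
        ring
      · rw [indicator_of_notMem hy, indicator_of_notMem hy, ENNReal.ofReal_zero]
    simp_rw [e1, indicator_of_mem (closedBall_subset_ball hρ' hx)]
    rw [lintegral_const_mul' _ _ ENNReal.ofReal_ne_top,
      lintegral_indicator measurableSet_ball.compl, lintegral_add_left hkm.ennreal_ofReal,
      lintegral_const_mul' _ _ ENNReal.ofReal_ne_top]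
    gcongr
  rw [lintegral_prod _ hm.aemeasurable]
  calc _ ≤ ∫⁻ t in Ioc a b, (ENNReal.ofReal (Λ * 4 ^ ((d : ℝ) + 2 * s)) *
        (ENNReal.ofReal C + ENNReal.ofReal ε⁻¹ * J t)) * volume (ball x₀ ρ) := by
        refine lintegral_mono fun t => ?_
        rw [lintegral_prod (fun q : Ed d × Ed d => ENNReal.ofReal
          (outerMajorant s Λ ρ' ρ ε x₀ v (t, q))) (hm.comp measurable_prodMk_left).aemeasurable]
        refine (lintegral_mono (hpt t)).trans_eq ?_
        rw [lintegral_indicator measurableSet_ball, setLIntegral_const]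
    _ = (ENNReal.ofReal (Λ * 4 ^ ((d : ℝ) + 2 * s)) * (ENNReal.ofReal C * ENNReal.ofReal (b - a) +
        ENNReal.ofReal ε⁻¹ * ∫⁻ t in Ioo a b, J t)) * volume (ball x₀ ρ) := by
        rw [lintegral_mul_const' _ _ measure_ball_lt_top.ne,
          lintegral_const_mul' _ _ ENNReal.ofReal_ne_top, lintegral_add_left measurable_const,
          setLIntegral_const, Real.volume_Ioc, lintegral_const_mul' _ _ ENNReal.ofReal_ne_top,
          setLIntegral_congr Ioo_ae_eq_Ioc.symm]
    _ ≤ (ENNReal.ofReal (Λ * 4 ^ ((d : ℝ) + 2 * s)) * (ENNReal.ofReal C * ENNReal.ofReal (b - a) +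
        ENNReal.ofReal ε⁻¹ * ENNReal.ofReal M)) * volume (ball x₀ ρ) := by gcongr
    _ = _ := by
        have hab' : 0 ≤ b - a := by linarith
        rw [← ofReal_measureReal measure_ball_lt_top.ne, ← ENNReal.ofReal_mul hC0,
          ← ENNReal.ofReal_mul (by positivity), ← ENNReal.ofReal_add (by positivity)
          (by positivity), ← ENNReal.ofReal_mul (by positivity),
          ← ENNReal.ofReal_mul (by positivity)]
        congr 1
        ring

lemma measurableSet_transitionPairs (hS : MeasurableSet S)
    (hv : Measurable (Function.uncurry v)) :
    MeasurableSet (transitionPairs S x₀ R ε h v) := by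
  have h1 : Measurable fun z : ℝ × Ed d × Ed d => v z.1 z.2.1 :=
    hv.comp (by fun_prop : Measurable fun z : ℝ × Ed d × Ed d => (z.1, z.2.1))
  have h2 : Measurable fun z : ℝ × Ed d × Ed d => v z.1 z.2.2 :=
    hv.comp (by fun_prop : Measurable fun z : ℝ × Ed d × Ed d => (z.1, z.2.2))
  exact (measurable_fst hS).inter
    (((measurableSet_ball.preimage
        (by fun_prop : Measurable fun z : ℝ × Ed d × Ed d => z.2.1)).inter
      (measurableSet_le measurable_const h1)).inter
    ((measurableSet_ball.preimage
        (by fun_prop : Measurable fun z : ℝ × Ed d × Ed d => z.2.2)).inter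
      (measurableSet_le h2 measurable_const)))

lemma measure_transitionPairs_lt_top (x₀ : Ed d) (R ε h : ℝ) (v : ℝ → Ed d → ℝ)
    (S : Set ℝ) (a b : ℝ) :
    ((volume.restrict (Ioc a b)).prod (volume.prod volume)) (transitionPairs S x₀ R ε h v) < ⊤ := by
  refine (measure_mono (t := univ ×ˢ (ball x₀ R ×ˢ ball x₀ R)) fun z hz =>
    ⟨mem_univ _, hz.2.1.1, hz.2.2.1⟩).trans_lt ?_
  rw [Measure.prod_prod, Measure.prod_prod, Measure.restrict_apply_univ, Real.volume_Ioc]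
  exact ENNReal.mul_lt_top ENNReal.ofReal_lt_top
    (ENNReal.mul_lt_top measure_ball_lt_top measure_ball_lt_top)

/-- Fubini's theorem for pairs of points in which the upper level sets have density at least
`α`. -/
lemma le_measure_transitionPairs (hS : MeasurableSet S) (hSab : S ⊆ Ioc a b)
    (hv : Measurable (Function.uncurry v)) {α : ℝ≥0∞}
    (hα : ∀ᵐ t ∂(volume.restrict S), α ≤ volume {x | x ∈ ball x₀ R ∧ h / 2 ≤ v t x}) :
    α * volume {p : ℝ × Ed d | p ∈ S ×ˢ ball x₀ R ∧ v p.1 p.2 ≤ ε} ≤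
      ((volume.restrict (Ioc a b)).prod (volume.prod volume)) (transitionPairs S x₀ R ε h v) := by
  have hA : MeasurableSet {p : ℝ × Ed d | p ∈ S ×ˢ ball x₀ R ∧ v p.1 p.2 ≤ ε} :=
    (hS.prod measurableSet_ball).inter (measurableSet_le hv measurable_const)
  rw [Measure.prod_apply (measurableSet_transitionPairs hS hv), Measure.volume_eq_prod,
    Measure.prod_apply hA]
  have hAm := measurable_measure_prodMk_left (ν := (volume : Measure (Ed d))) hA
  calc α * ∫⁻ t, volume (Prod.mk t ⁻¹' {p : ℝ × Ed d | p ∈ S ×ˢ ball x₀ R ∧ v p.1 p.2 ≤ ε})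
      = ∫⁻ t in S, α * volume (Prod.mk t ⁻¹' {p : ℝ × Ed d | p ∈ S ×ˢ ball x₀ R ∧
          v p.1 p.2 ≤ ε}) := by
        rw [← lintegral_const_mul _ hAm, ← lintegral_indicator hS]
        refine lintegral_congr fun t => ?_
        by_cases ht : t ∈ S
        · rw [indicator_of_mem ht]
        · rw [indicator_of_notMem ht]
          have : Prod.mk t ⁻¹' {p : ℝ × Ed d | p ∈ S ×ˢ ball x₀ R ∧ v p.1 p.2 ≤ ε} = ∅ := by
            ext x
            simp [ht]
          rw [this, measure_empty, mul_zero]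
    _ ≤ ∫⁻ t in S, (volume.prod volume) (Prod.mk t ⁻¹' transitionPairs S x₀ R ε h v) := by
        refine lintegral_mono_ae ?_
        filter_upwards [hα, ae_restrict_mem hS] with t ht htS
        have : Prod.mk t ⁻¹' transitionPairs S x₀ R ε h v =
            {x | x ∈ ball x₀ R ∧ h / 2 ≤ v t x} ×ˢ {x | x ∈ ball x₀ R ∧ v t x ≤ ε} := by
          ext z
          simp [transitionPairs, htS]
        rw [this, Measure.prod_prod]
        refine mul_le_mul' ht (measure_mono fun x hx => ⟨hx.1.2, hx.2⟩)
    _ ≤ _ := lintegral_mono' (Measure.restrict_mono hSab le_rfl) le_rfl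

end MajorantIntegrals

section EnergyEstimate

variable {s Λ T a b ρ a' b' ρ' L γ ε h R : ℝ} {Ω : Set (Ed d)} {A : ℝ → Ed d → Ed d → Ed d}
  {K : ℝ → Ed d → Ed d → ℝ} {v : ℝ → Ed d → ℝ} {Dv : ℝ → Ed d → Ed d} {x₀ : Ed d}
  {ζ m : ℝ → ℝ} {η : Ed d → ℝ} {S : Set ℝ}

lemma measurable_potF (ε h : ℝ) : Measurable (potF ε h) :=
  (measurable_id.add_const ε).inv.sub (measurable_id.add_const h).inv

/-- The density of the energy controlled by the logarithmic estimate. -/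
def potEnergy (ζ : ℝ → ℝ) (η : Ed d → ℝ) (ε h : ℝ) (u : ℝ × Ed d → ℝ) (w : ℝ × Ed d → Ed d)
    (p : ℝ × Ed d) : ℝ :=
  ζ p.1 * (η p.2 ^ 2 * (potF ε h (u p) ^ 2 * ‖w p‖ ^ 2))

lemma potEnergy_nonneg (hζ : IsTimeCutoff a b a' b' ζ m) (u : ℝ × Ed d → ℝ)
    (w : ℝ × Ed d → Ed d) (p : ℝ × Ed d) : 0 ≤ potEnergy ζ η ε h u w p :=
  mul_nonneg (hζ.nonneg _) (by positivity)

lemma ae_mem_and_pair {P : ℝ × Ed d → Prop} (h : ∀ᵐ p, P p) (a b : ℝ) :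
    ∀ᵐ z ∂((volume.restrict (Ioc a b)).prod ((volume : Measure (Ed d)).prod volume)),
      z.1 ∈ Ioo a b ∧ P (z.1, z.2.1) ∧ P (z.1, z.2.2) := by
  have h1 : ∀ᵐ z ∂((volume.restrict (Ioc a b)).prod
      ((volume : Measure (Ed d)).prod (volume : Measure (Ed d)))),
      z.1 ∈ Ioo a b := by
    rw [← Measure.restrict_congr_set (Ioo_ae_eq_Ioc (μ := (volume : Measure ℝ)))]
    exact Measure.quasiMeasurePreserving_fst.ae (ae_restrict_mem measurableSet_Ioo)
  exact h1.and (ae_space_pair h _)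

lemma measurePreserving_swap_space (S : Set ℝ) :
    MeasurePreserving (fun z : ℝ × Ed d × Ed d => (z.1, z.2.2, z.2.1))
      ((volume.restrict S).prod ((volume : Measure (Ed d)).prod (volume : Measure (Ed d))))
      ((volume.restrict S).prod ((volume : Measure (Ed d)).prod (volume : Measure (Ed d)))) :=
  (MeasurePreserving.id (volume.restrict S)).prod
    (Measure.measurePreserving_swap (μ := (volume : Measure (Ed d)))
      (ν := (volume : Measure (Ed d))))

lemma integrable_of_lintegral_ofReal_le {α : Type*} [MeasurableSpace α] {μ : Measure α}
    {f : α → ℝ} (hf : Measurable f) (h0 : ∀ x, 0 ≤ f x) {M : ℝ} (hM : 0 ≤ M)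
    (h : ∫⁻ x, ENNReal.ofReal (f x) ∂μ ≤ ENNReal.ofReal M) :
    Integrable f μ ∧ ∫ x, f x ∂μ ≤ M := by
  refine ⟨⟨hf.aestronglyMeasurable, ?_⟩, ?_⟩
  · rw [hasFiniteIntegral_iff_ofReal (ae_of_all _ h0)]
    exact h.trans_lt ENNReal.ofReal_lt_top
  · rw [integral_eq_lintegral_of_nonneg_ae (ae_of_all _ h0) hf.aestronglyMeasurable]
    exact ENNReal.toReal_le_of_le_ofReal hM h

namespace NonnegSupersolution

lemma integrable_potEnergy (H : NonnegSupersolution s Λ T Ω A K v Dv a b ρ x₀)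
    (hζ : IsTimeCutoff a b a' b' ζ m) (hη : IsSpaceCutoff x₀ ρ' L η) (hε : 0 < ε) (hh : ε ≤ h) :
    Integrable (potEnergy ζ η ε h (onCyl a b ρ x₀ v) (onCyl a b ρ x₀ Dv)) := by
  have hW := (memLp_two_iff_integrable_sq_norm H.memLp_pair.2.1).1 H.memLp_pair.2
  refine (hW.const_mul (ε⁻¹ ^ 2)).mono' ?_ ?_
  · have hVm : Measurable (onCyl a b ρ x₀ v) := measurable_onCyl H.reg.meas
    have hWm : Measurable (onCyl a b ρ x₀ Dv) := measurable_onCyl H.reg.measD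
    exact ((hζ.smooth.continuous.measurable.comp measurable_fst).mul
      (((hη.smooth.continuous.measurable.comp measurable_snd).pow_const 2).mul
      ((((measurable_potF ε h).comp hVm).pow_const 2).mul
        (hWm.norm.pow_const 2)))).aestronglyMeasurable
  · filter_upwards [H.onCyl_nonneg] with p hp
    rw [Real.norm_of_nonneg (potEnergy_nonneg hζ _ _ _), potEnergy]
    have h1 : potF ε h (onCyl a b ρ x₀ v p) ^ 2 ≤ ε⁻¹ ^ 2 :=
      pow_le_pow_left₀ (potF_nonneg hε hh hp) (potF_le hε hh hp) 2
    have h2 : η p.2 ^ 2 ≤ 1 := pow_le_one₀ (hη.nonneg _) (hη.le_one _)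
    calc _ ≤ 1 * (1 * (ε⁻¹ ^ 2 * ‖onCyl a b ρ x₀ Dv p‖ ^ 2)) := by
          gcongr
          exact hζ.le_one _
      _ = _ := by ring

lemma integral_inner_potGrad_le (H : NonnegSupersolution s Λ T Ω A K v Dv a b ρ x₀)
    (hζ : IsTimeCutoff a b a' b' ζ m) (hη : IsSpaceCutoff x₀ ρ' L η) (hε : 0 < ε) (hh : ε ≤ h) :
    ∫ p, ⟪onCyl a b ρ x₀ (fun t x => A t x (Dv t x)) p,
        potGrad ζ η ε h (onCyl a b ρ x₀ v) (onCyl a b ρ x₀ Dv) p⟫ ≤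
      -(Λ⁻¹ / 2) * (∫ p, potEnergy ζ η ε h (onCyl a b ρ x₀ v) (onCyl a b ρ x₀ Dv) p) +
        2 * Λ ^ 3 * L ^ 2 * ((b - a) * volume.real (ball x₀ ρ)) := by
  have hQ : MeasurableSet (Ioo a b ×ˢ ball x₀ ρ) := measurableSet_Ioo.prod measurableSet_ball
  have hQv : volume.real (Ioo a b ×ˢ ball x₀ ρ) = (b - a) * volume.real (ball x₀ ρ) := by
    rw [Measure.volume_eq_prod, measureReal_prod_prod, Real.volume_real_Ioo_of_le H.lt.le]
  have hQf : volume (Ioo a b ×ˢ ball x₀ ρ) < ⊤ := by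
    rw [Measure.volume_eq_prod, Measure.prod_prod]
    exact ENNReal.mul_lt_top (by simp) measure_ball_lt_top
  have hI := (H.integrable_potEnergy hζ hη hε hh).const_mul (-(Λ⁻¹ / 2))
  have hI2 : Integrable ((Ioo a b ×ˢ ball x₀ ρ).indicator fun _ => 2 * Λ ^ 3 * L ^ 2) :=
    (integrable_indicator_iff hQ).2 (integrableOn_const hQf.ne)
  have hΛ := H.ellip
  calc _ ≤ ∫ p, (-(Λ⁻¹ / 2) * potEnergy ζ η ε h (onCyl a b ρ x₀ v) (onCyl a b ρ x₀ Dv) p +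
        (Ioo a b ×ˢ ball x₀ ρ).indicator (fun _ => 2 * Λ ^ 3 * L ^ 2) p) := by
        refine integral_mono_ae (integrable_inner_of_memLp_two H.memLp_flux
          (H.memLp_potGrad_onCyl hζ hη hε hh)) (hI.add hI2) ?_
        filter_upwards [H.onCyl_nonneg] with p hp
        by_cases hpQ : p ∈ Ioo a b ×ˢ ball x₀ ρ
        · have h1 := flux_potF_le (η := η p.2) (D := gradient η p.2) hΛ hε hh hp
            (H.norm_flux_le p) (H.le_inner_flux p)
          have h2 : ‖gradient η p.2‖ ^ 2 ≤ L ^ 2 :=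
            pow_le_pow_left₀ (norm_nonneg _) (hη.norm_gradient_le _) 2
          have h3 := mul_le_mul_of_nonneg_left h1 (hζ.nonneg p.1)
          have h4 : ζ p.1 * (2 * Λ ^ 3 * ‖gradient η p.2‖ ^ 2) ≤ 2 * Λ ^ 3 * L ^ 2 :=
            (mul_le_of_le_one_left (by positivity) (hζ.le_one _)).trans (by gcongr)
          rw [indicator_of_mem hpQ, potGrad, inner_smul_right, potEnergy]
          linarith
        · have hW : onCyl a b ρ x₀ Dv p = 0 := indicator_of_notMem hpQ _
          have hB : onCyl a b ρ x₀ (fun t x => A t x (Dv t x)) p = 0 :=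
            indicator_of_notMem hpQ _
          simp [hW, hB, potEnergy, indicator_of_notMem hpQ]
    _ = _ := by
        rw [integral_add hI hI2, integral_const_mul, integral_indicator_const _ hQ, hQv,
          smul_eq_mul]
        ring

lemma integrable_nonlocalForm_potTest (H : NonnegSupersolution s Λ T Ω A K v Dv a b ρ x₀)
    (hζ : IsTimeCutoff a b a' b' ζ m) (hη : IsSpaceCutoff x₀ ρ' L η) (hε : 0 < ε) (hh : ε ≤ h)
    (hρ : ρ' < ρ) {r : ℝ} (hr : 0 < r) :
    IntegrableOn (nonlocalForm K v (potTest ζ η ε h (onCyl a b ρ x₀ v))) (nearDiag d r)ᶜ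
      ((volume.restrict (Ioc a b)).prod (volume.prod volume)) := by
  have hVm : Measurable (onCyl a b ρ x₀ v) := measurable_onCyl H.reg.meas
  set u : ℝ × Ed d → ℝ := fun p => max (onCyl a b ρ x₀ v p) 0 with hu
  have hu0 : ∀ p, 0 ≤ u p := fun p => le_max_right _ _
  have hgm : Measurable (potTest ζ η ε h u) :=
    (hζ.smooth.continuous.measurable.comp measurable_fst).mul
      (((hη.smooth.continuous.measurable.comp measurable_snd).pow_const 2).mul
        ((measurable_potF ε h).comp (hVm.max measurable_const)))
  have h1 := integrable_nonlocalForm_far H.kernel H.ellip hr H.reg.meas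
    (integrable_farWeight H.reg H.order.1 H.time_subset hr H.radius_pos
      (integrable_of_memLp_two_onCyl H.memLp_pair.1)) hgm (M := ε⁻¹) (by positivity)
    (fun p => by
      rw [abs_of_nonneg (potTest_nonneg hζ (hu0 p) hε hh)]
      exact potTest_le hζ hη (hu0 p) hε hh)
    (fun p hp => potTest_eq_zero hζ hη fun h' => hp (prod_mono hζ.subset
      (closedBall_subset_ball hρ) h')) (Ioc a b)
  refine Integrable.congr h1 (ae_restrict_of_ae ?_)
  filter_upwards [ae_space_pair H.onCyl_nonneg (Ioc a b)] with z hz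
  simp only [nonlocalForm, potTest, hu, max_eq_left hz.1, max_eq_left hz.2]

lemma integral_nonlocalForm_potTest_le (H : NonnegSupersolution s Λ T Ω A K v Dv a b ρ x₀)
    (hζ : IsTimeCutoff a b a' b' ζ m) (hη : IsSpaceCutoff x₀ ρ' L η) (hε : 0 < ε)
    (hh : 8 * ε ≤ h) (hρ' : 4 * ρ' ≤ 3 * ρ) (hRρ : R ≤ ρ) (hSm : MeasurableSet S)
    (hS : S ⊆ Ioo a b) (hζS : ∀ t ∈ S, ζ t = 1) (hηR : ∀ x ∈ ball x₀ R, η x = 1)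
    {C₁ C₂ M r : ℝ}
    (hC₁ : ∫⁻ z in ball (0 : Ed d) (2 * ρ), ENNReal.ofReal (‖z‖ ^ 2 * kern s z) ≤
      ENNReal.ofReal C₁) (hC₁0 : 0 ≤ C₁)
    (hC₂ : ∫⁻ z in (ball (0 : Ed d) ρ)ᶜ, ENNReal.ofReal (kern s z) ≤ ENNReal.ofReal C₂)
    (hC₂0 : 0 ≤ C₂) (hM : 0 ≤ M)
    (htail : ∫⁻ t in Ioo a b, ∫⁻ y in (ball x₀ ρ)ᶜ,
      ENNReal.ofReal (max (-v t y) 0 * kern s (y - x₀)) ≤ ENNReal.ofReal M) (hr : 0 < r) :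
    ∫ z in (nearDiag d r)ᶜ, nonlocalForm K v (potTest ζ η ε h (onCyl a b ρ x₀ v)) z
        ∂((volume.restrict (Ioc a b)).prod (volume.prod volume)) ≤
      volume.real (ball x₀ ρ) * (3 * Λ * L ^ 2 * ((b - a) * C₁)) +
        2 * (volume.real (ball x₀ ρ) *
          (Λ * 4 ^ ((d : ℝ) + 2 * s) * ((b - a) * C₂ + ε⁻¹ * M))) -
        Λ⁻¹ * (h / ε / 64) * ((2 * R) ^ ((d : ℝ) + 2 * s))⁻¹ *
          ((volume.restrict (Ioc a b)).prod (volume.prod volume)).real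
            (transitionPairs S x₀ R ε h v ∩ (nearDiag d r)ᶜ) := by
  set ν := (volume.restrict (Ioc a b)).prod ((volume : Measure (Ed d)).prod
    (volume : Measure (Ed d))) with hν
  have hΛ := H.ellip
  have hab : 0 ≤ b - a := by linarith [H.lt]
  have hρ : 0 < ρ := H.radius_pos
  have hρ'' : ρ' < ρ := by linarith
  set c := Λ⁻¹ * (h / ε / 64) * ((2 * R) ^ ((d : ℝ) + 2 * s))⁻¹ with hc
  obtain ⟨i1, b1⟩ := integrable_of_lintegral_ofReal_le (measurable_innerMajorant (d := d))
    (innerMajorant_nonneg hΛ) (by positivity)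
    (lintegral_innerMajorant_le (L := L) (a := a) (b := b) (x₀ := x₀) hΛ hC₁ hC₁0)
  obtain ⟨i2, b2⟩ := integrable_of_lintegral_ofReal_le (measurable_outerMajorant H.reg.meas)
    (outerMajorant_nonneg hΛ hε) (by positivity)
    (lintegral_outerMajorant_le H.reg.meas hΛ hε H.lt.le hρ'' hC₂ hC₂0 hM htail)
  have hsw := measurePreserving_swap_space (d := d) (Ioc a b)
  have i3 := hsw.integrable_comp_of_integrable i2
  have hswe : MeasurableEmbedding fun z : ℝ × Ed d × Ed d => (z.1, z.2.2, z.2.1) :=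
    ((MeasurableEquiv.refl ℝ).prodCongr MeasurableEquiv.prodComm).measurableEmbedding
  have b3 := hsw.integral_comp hswe (outerMajorant s Λ ρ' ρ ε x₀ v)
  have hD : MeasurableSet (nearDiag d r)ᶜ := (measurableSet_nearDiag r).compl
  have hTm : MeasurableSet (transitionPairs S x₀ R ε h v) :=
    measurableSet_transitionPairs hSm H.reg.meas
  have i4 : Integrable ((transitionPairs S x₀ R ε h v).indicator fun _ => c) ν :=
    (integrable_indicator_iff hTm).2
      (integrableOn_const (measure_transitionPairs_lt_top x₀ R ε h v S a b).ne)
  have b4 : ∫ z in (nearDiag d r)ᶜ, (transitionPairs S x₀ R ε h v).indicator (fun _ => c) z ∂ν =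
      c * ν.real (transitionPairs S x₀ R ε h v ∩ (nearDiag d r)ᶜ) := by
    rw [integral_indicator_const _ hTm, measureReal_restrict_apply hTm, smul_eq_mul, mul_comm]
  set o : ℝ × Ed d × Ed d → ℝ := fun z => outerMajorant s Λ ρ' ρ ε x₀ v (z.1, z.2.2, z.2.1)
    with ho
  have hmono : ∫ z in (nearDiag d r)ᶜ,
        nonlocalForm K v (potTest ζ η ε h (onCyl a b ρ x₀ v)) z ∂ν ≤
      ∫ z in (nearDiag d r)ᶜ, (innerMajorant s Λ L ρ x₀ z + outerMajorant s Λ ρ' ρ ε x₀ v z + o z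
        - (transitionPairs S x₀ R ε h v).indicator (fun _ => c) z) ∂ν := by
    refine integral_mono_ae (H.integrable_nonlocalForm_potTest hζ hη hε (by linarith) hρ'' hr)
      ((((i1.add i2).add i3).sub i4).integrableOn) ?_
    filter_upwards [ae_restrict_of_ae (ae_mem_and_pair H.nonneg a b), ae_restrict_mem hD] with
      z hz hzD
    obtain ⟨t, x, y⟩ := z
    refine nonlocalForm_potTest_le H.kernel hΛ H.order.1 hζ hη hε hh hρ' hρ hRρ hS hζS hηR hz.1
      (fun hx => hz.2.1 ⟨hz.1, hx⟩) (fun hy => hz.2.2 ⟨hz.1, hy⟩) fun hxy => ?_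
    subst hxy
    exact hzD (by simpa [nearDiag] using hr)
  have j3 : Integrable o ν := i3
  have b3' : ∫ z, o z ∂ν = ∫ z, outerMajorant s Λ ρ' ρ ε x₀ v z ∂ν := b3
  have j12 : Integrable (fun z => innerMajorant s Λ L ρ x₀ z + outerMajorant s Λ ρ' ρ ε x₀ v z)
    ν := i1.add i2
  have j123 : Integrable (fun z => innerMajorant s Λ L ρ x₀ z +
    outerMajorant s Λ ρ' ρ ε x₀ v z + o z) ν := j12.add j3
  rw [integral_sub j123.integrableOn i4.integrableOn,
    integral_add j12.integrableOn j3.integrableOn,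
    integral_add i1.integrableOn i2.integrableOn, b4] at hmono
  have s1 := setIntegral_le_integral (s := (nearDiag d r)ᶜ) i1
    (ae_of_all _ (innerMajorant_nonneg hΛ))
  have s2 := setIntegral_le_integral (s := (nearDiag d r)ᶜ) i2
    (ae_of_all _ (outerMajorant_nonneg hΛ hε))
  have s3 := setIntegral_le_integral (s := (nearDiag d r)ᶜ) j3
    (ae_of_all _ fun z => outerMajorant_nonneg hΛ hε _)
  linarith

end NonnegSupersolution

end EnergyEstimate

section EnergyLimit

variable {s Λ T a b ρ a' b' ρ' L γ ε h R : ℝ} {Ω : Set (Ed d)} {A : ℝ → Ed d → Ed d → Ed d}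
  {K : ℝ → Ed d → Ed d → ℝ} {v : ℝ → Ed d → ℝ} {Dv : ℝ → Ed d → Ed d} {x₀ : Ed d}
  {ζ m : ℝ → ℝ} {η : Ed d → ℝ} {S : Set ℝ}

lemma iUnion_inter_compl_nearDiag {P : Set (ℝ × Ed d × Ed d)} (hP : ∀ z ∈ P, z.2.1 ≠ z.2.2)
    (γ : ℝ) : ⋃ n : ℕ, P ∩ (nearDiag d (γ / ((n : ℝ) + 1)))ᶜ = P := by
  rw [← inter_iUnion, inter_eq_left]
  intro z hz
  have h0 : 0 < ‖z.2.2 - z.2.1‖ := norm_pos_iff.2 (sub_ne_zero.2 (hP z hz).symm)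
  have h1 : Tendsto (fun n : ℕ => γ / ((n : ℝ) + 1)) atTop (𝓝 0) := by
    simpa [div_eq_mul_inv] using
      (tendsto_one_div_add_atTop_nhds_zero_nat (𝕜 := ℝ)).const_mul γ
  obtain ⟨n, hn⟩ := (h1.eventually (gt_mem_nhds h0)).exists
  exact mem_iUnion.2 ⟨n, fun h => absurd (show ‖z.2.2 - z.2.1‖ < _ from h) (not_lt.2 hn.le)⟩

lemma tendsto_measureReal_inter_compl_nearDiag {μ : Measure (ℝ × Ed d × Ed d)}
    {P : Set (ℝ × Ed d × Ed d)} (hP : ∀ z ∈ P, z.2.1 ≠ z.2.2) (hμ : μ P ≠ ⊤) (hγ : 0 ≤ γ) :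
    Tendsto (fun n : ℕ => μ.real (P ∩ (nearDiag d (γ / ((n : ℝ) + 1)))ᶜ)) atTop
      (𝓝 (μ.real P)) := by
  have hmono : Monotone fun n : ℕ => P ∩ (nearDiag d (γ / ((n : ℝ) + 1)))ᶜ := by
    intro n k hnk z hz
    refine ⟨hz.1, fun h => hz.2 ?_⟩
    have h1 : ‖z.2.2 - z.2.1‖ < γ / ((k : ℝ) + 1) := h
    have h2 : γ / ((k : ℝ) + 1) ≤ γ / ((n : ℝ) + 1) := by
      have : (n : ℝ) ≤ k := by exact_mod_cast hnk
      gcongr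
    exact h1.trans_le h2
  have h1 := tendsto_measure_iUnion_atTop (μ := μ) hmono
  rw [iUnion_inter_compl_nearDiag hP] at h1
  exact (ENNReal.tendsto_toReal hμ).comp h1

lemma NonnegSupersolution.energy_add_transition_le
    (H : NonnegSupersolution s Λ T Ω A K v Dv a b ρ x₀)
    (hζ : IsTimeCutoff a b a' b' ζ m) (hη : IsSpaceCutoff x₀ ρ' L η) (hε : 0 < ε)
    (hh : 8 * ε ≤ h) (hγ : 0 < γ) (ha : a + 4 * γ ≤ a') (hb : b' + 4 * γ ≤ b)
    (hργ : ρ' + 4 * γ ≤ ρ) (hρ' : 4 * ρ' ≤ 3 * ρ) (hRρ : R ≤ ρ) (hSm : MeasurableSet S)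
    (hS : S ⊆ Ioo a b) (hζS : ∀ t ∈ S, ζ t = 1) (hηR : ∀ x ∈ ball x₀ R, η x = 1)
    {C₁ C₂ M : ℝ}
    (hC₁ : ∫⁻ z in ball (0 : Ed d) (2 * ρ), ENNReal.ofReal (‖z‖ ^ 2 * kern s z) ≤
      ENNReal.ofReal C₁) (hC₁0 : 0 ≤ C₁)
    (hC₂ : ∫⁻ z in (ball (0 : Ed d) ρ)ᶜ, ENNReal.ofReal (kern s z) ≤ ENNReal.ofReal C₂)
    (hC₂0 : 0 ≤ C₂) (hM : 0 ≤ M)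
    (htail : ∫⁻ t in Ioo a b, ∫⁻ y in (ball x₀ ρ)ᶜ,
      ENNReal.ofReal (max (-v t y) 0 * kern s (y - x₀)) ≤ ENNReal.ofReal M) :
    (Λ⁻¹ / 2) * (∫ p, potEnergy ζ η ε h (onCyl a b ρ x₀ v) (onCyl a b ρ x₀ Dv) p) +
      Λ⁻¹ * (h / ε / 64) * ((2 * R) ^ ((d : ℝ) + 2 * s))⁻¹ *
          ((volume.restrict (Ioc a b)).prod (volume.prod volume)).real
            (transitionPairs S x₀ R ε h v) ≤
      volume.real (ball x₀ ρ) * (Real.log (h / ε) + 2 * Λ ^ 3 * L ^ 2 * (b - a) +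
        3 * Λ * L ^ 2 * ((b - a) * C₁) +
        2 * (Λ * 4 ^ ((d : ℝ) + 2 * s) * ((b - a) * C₂ + ε⁻¹ * M))) := by
  have hεh : ε ≤ h := by linarith
  obtain ⟨N, -, hN⟩ := H.neg_log_le_potTest hζ hη hε hεh hγ ha hb hργ
  have hE := H.integral_inner_potGrad_le hζ hη hε hεh
  have h1 := tendsto_measureReal_inter_compl_nearDiag (γ := γ)
    (P := transitionPairs S x₀ R ε h v) (fun z hz he => by
      have h2 := hz.2.1.2
      rw [he] at h2
      linarith [hz.2.2.2]) (measure_transitionPairs_lt_top x₀ R ε h v S a b).ne hγ.le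
  have h2 : Tendsto (fun n : ℕ => N * (γ / ((n : ℝ) + 1)) ^ (2 - 2 * s)) atTop (𝓝 0) := by
    have h3 : Tendsto (fun n : ℕ => γ / ((n : ℝ) + 1)) atTop (𝓝 0) := by
      simpa [div_eq_mul_inv] using
        (tendsto_one_div_add_atTop_nhds_zero_nat (𝕜 := ℝ)).const_mul γ
    have h4 : 0 < 2 - 2 * s := by linarith [H.order.2]
    have h5 := (h3.rpow_const (p := 2 - 2 * s) (Or.inr h4.le)).const_mul N
    rwa [Real.zero_rpow h4.ne', mul_zero] at h5
  refine le_of_tendsto_of_tendsto' (tendsto_const_nhds.add (h1.const_mul _))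
    (by simpa using tendsto_const_nhds.add h2) fun n => ?_
  have hn : 0 < (n : ℝ) + 1 := by positivity
  have hr : γ / ((n : ℝ) + 1) ∈ Ioc 0 γ :=
    ⟨by positivity, div_le_self hγ.le (by linarith [(Nat.cast_nonneg n : (0 : ℝ) ≤ n)])⟩
  have h6 := hN _ hr
  have h7 := H.integral_nonlocalForm_potTest_le hζ hη hε hh hρ' hRρ hSm hS hζS hηR hC₁ hC₁0
    hC₂ hC₂0 hM htail hr.1
  linarith

end EnergyLimit

section TransitionPoincare

variable {s Λ T a b ρ a' b' ρ' L γ ε h R : ℝ} {Ω : Set (Ed d)} {A : ℝ → Ed d → Ed d → Ed d}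
  {K : ℝ → Ed d → Ed d → ℝ} {v : ℝ → Ed d → ℝ} {Dv : ℝ → Ed d → Ed d} {x₀ : Ed d}
  {ζ m : ℝ → ℝ} {η : Ed d → ℝ} {S : Set ℝ}

lemma measurable_potG (ε h : ℝ) : Measurable (potG ε h) :=
  (Real.measurable_log.comp (measurable_id.add_const ε)).sub
    (Real.measurable_log.comp (measurable_id.add_const h))

namespace NonnegSupersolution

lemma lintegral_potF_smul_sq_le (H : NonnegSupersolution s Λ T Ω A K v Dv a b ρ x₀)
    (hζ : IsTimeCutoff a b a' b' ζ m) (hη : IsSpaceCutoff x₀ ρ' L η) (hε : 0 < ε) (hh : ε ≤ h)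
    (hSm : MeasurableSet S) (hζS : ∀ t ∈ S, ζ t = 1) (hηR : ∀ x ∈ ball x₀ R, η x = 1) :
    ∫⁻ p in S ×ˢ ball x₀ R, ‖potF ε h (onCyl a b ρ x₀ v p) • onCyl a b ρ x₀ Dv p‖ₑ ^ 2 ≤
      ENNReal.ofReal (∫ p, potEnergy ζ η ε h (onCyl a b ρ x₀ v) (onCyl a b ρ x₀ Dv) p) := by
  rw [ofReal_integral_eq_lintegral_ofReal (H.integrable_potEnergy hζ hη hε hh)
    (ae_of_all _ (potEnergy_nonneg hζ _ _))]
  refine (setLIntegral_mono_ae' (hSm.prod measurableSet_ball) (ae_of_all _ fun p hp => ?_)).trans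
    (setLIntegral_le_lintegral (S ×ˢ ball x₀ R) _)
  rw [← ofReal_norm, ← ENNReal.ofReal_pow (norm_nonneg _), norm_smul, potEnergy, hζS _ hp.1,
    hηR _ hp.2, mul_pow, Real.norm_eq_abs, sq_abs]
  simp

lemma log_sq_mul_measure_transitionPairs_le
    (H : NonnegSupersolution s Λ T Ω A K v Dv a b ρ x₀) (hε : 0 < ε) (hh : 8 * ε ≤ h)
    (hγ : 0 < γ) (hSm : MeasurableSet S) (hS : S ⊆ Icc (a + γ) (b - γ)) (hR : R + γ ≤ ρ) :
    ENNReal.ofReal ((Real.log (h / ε) / 8) ^ 2) *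
        ((volume.restrict (Ioc a b)).prod (volume.prod volume)) (transitionPairs S x₀ R ε h v) ≤
      ENNReal.ofReal ((2 * R) ^ 2) * volume (ball (0 : Ed d) (2 * R)) *
        ∫⁻ p in S ×ˢ ball x₀ R,
          ‖potF ε h (onCyl a b ρ x₀ v p) • onCyl a b ρ x₀ Dv p‖ₑ ^ 2 := by
  set V := onCyl a b ρ x₀ v with hV
  set E := ∫⁻ p in S ×ˢ ball x₀ R, ‖potF ε h (V p) • onCyl a b ρ x₀ Dv p‖ₑ ^ 2 with hE
  have hεh : ε ≤ h := by linarith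
  have hVm : Measurable V := measurable_onCyl H.reg.meas
  set D : Set (ℝ × Ed d × Ed d) := S ×ˢ (ball x₀ R ×ˢ ball x₀ R) with hD
  have hDm : MeasurableSet D := hSm.prod (measurableSet_ball.prod measurableSet_ball)
  set g : ℝ × Ed d × Ed d → ℝ≥0∞ := D.indicator fun z =>
    ‖potG ε h (V (z.1, z.2.2)) - potG ε h (V (z.1, z.2.1))‖ₑ ^ 2 with hg
  have hgm : Measurable g := by
    have h1 : Measurable fun z : ℝ × Ed d × Ed d => potG ε h (V (z.1, z.2.2)) :=
      (measurable_potG ε h).comp (hVm.comp (by fun_prop))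
    have h2 : Measurable fun z : ℝ × Ed d × Ed d => potG ε h (V (z.1, z.2.1)) :=
      (measurable_potG ε h).comp (hVm.comp (by fun_prop))
    exact ((h1.sub h2).enorm.pow_const 2).indicator hDm
  have hTm := measurableSet_transitionPairs (x₀ := x₀) (R := R) (ε := ε) (h := h) hSm H.reg.meas
  have hVeq : ∀ t ∈ S, ∀ x ∈ ball x₀ R, V (t, x) = v t x := fun t ht x hx => by
    have h1 : (t, x) ∈ Ioo a b ×ˢ ball x₀ ρ := ⟨⟨by linarith [(hS ht).1],
      by linarith [(hS ht).2]⟩, ball_subset_ball (by linarith) hx⟩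
    rw [hV, onCyl, indicator_of_mem h1]
  calc _ = ∫⁻ z, (transitionPairs S x₀ R ε h v).indicator
          (fun _ => ENNReal.ofReal ((Real.log (h / ε) / 8) ^ 2)) z
          ∂((volume.restrict (Ioc a b)).prod (volume.prod volume)) := by
        rw [lintegral_indicator_const hTm]
    _ ≤ ∫⁻ z, g z ∂((volume.restrict (Ioc a b)).prod (volume.prod volume)) := by
        refine lintegral_mono_ae ?_
        filter_upwards [ae_space_pair H.onCyl_nonneg (Ioc a b)] with z hz
        by_cases hzT : z ∈ transitionPairs S x₀ R ε h v
        · have hzD : z ∈ D := ⟨hzT.1, hzT.2.1.1, hzT.2.2.1⟩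
          rw [indicator_of_mem hzT, hg, indicator_of_mem hzD, ← ofReal_norm,
            ← ENNReal.ofReal_pow (norm_nonneg _)]
          refine ENNReal.ofReal_le_ofReal ?_
          rw [norm_sub_rev, Real.norm_eq_abs]
          have h1 : 1 ≤ h / ε := (one_le_div hε).2 hεh
          refine pow_le_pow_left₀ (div_nonneg (Real.log_nonneg h1) (by norm_num))
            ((potG_diff_ge hε hh hz.2 ?_ ?_).trans (le_abs_self _)) 2
          · change V _ ≤ ε
            rw [hVeq _ hzT.1 _ hzT.2.2.1]
            exact hzT.2.2.2
          · rw [hVeq _ hzT.1 _ hzT.2.1.1]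
            exact hzT.2.1.2
        · rw [indicator_of_notMem hzT]
          exact zero_le
    _ ≤ ∫⁻ z, g z := by
        rw [Measure.restrict_prod_eq_prod_univ]
        exact lintegral_mono' Measure.restrict_le_self le_rfl
    _ = ∫⁻ z : Ed d, ∫⁻ p : ℝ × Ed d, g (p.1, p.2, p.2 + z) := lintegral_shear hgm
    _ ≤ ∫⁻ z : Ed d, (ball (0 : Ed d) (2 * R)).indicator
          (fun _ => ENNReal.ofReal ((2 * R) ^ 2) * E) z := by
        refine lintegral_mono fun z => ?_
        set P : Set (ℝ × Ed d) := {p | p.1 ∈ S ∧ p.2 ∈ ball x₀ R ∧ p.2 + z ∈ ball x₀ R} with hP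
        have hPm : MeasurableSet P := (measurable_fst hSm).inter
          ((measurable_snd measurableSet_ball).inter
            ((by fun_prop : Measurable fun p : ℝ × Ed d => p.2 + z) measurableSet_ball))
        have e : ∀ p : ℝ × Ed d, g (p.1, p.2, p.2 + z) =
            P.indicator (fun p => ‖potG ε h (V (p.1, p.2 + z)) - potG ε h (V p)‖ₑ ^ 2) p := by
          intro p
          by_cases hp : p ∈ P
          · have hp' : (p.1, p.2, p.2 + z) ∈ D := ⟨hp.1, hp.2.1, hp.2.2⟩
            rw [indicator_of_mem hp]
            exact indicator_of_mem hp' _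
          · have hp' : (p.1, p.2, p.2 + z) ∉ D := fun h => hp ⟨h.1, h.2.1, h.2.2⟩
            rw [indicator_of_notMem hp]
            exact indicator_of_notMem hp' _
        rw [lintegral_congr e, lintegral_indicator hPm]
        by_cases hz : z ∈ ball (0 : Ed d) (2 * R)
        · rw [indicator_of_mem hz]
          have hSS : ∀ p ∈ P, ∀ θ ∈ Icc (0 : ℝ) 1,
              p + θ • ((0, z) : ℝ × Ed d) ∈ S ×ˢ ball x₀ R := by
            intro p hp θ hθ
            refine ⟨by simpa using hp.1, ?_⟩
            have h1 := (convex_ball x₀ R).add_smul_mem hp.2.1 hp.2.2 hθ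
            simpa using h1
          have hSQ : ∀ p ∈ S ×ˢ ball x₀ R, ball p γ ⊆ Ioo a b ×ˢ ball x₀ ρ := fun p hp =>
            ball_subset_cylinder (α := a + γ) (β := b - γ) (ρ₁ := R) le_rfl
              (by linarith) hR ⟨hS hp.1, ball_subset_closedBall hp.2⟩
          have key := H.lintegral_comp_translate_sq_le hγ hPm (hSm.prod measurableSet_ball) z
            hSS hSQ (fun c hc => hasDerivAt_potG hε hεh hc)
            (fun c hc => continuousAt_potF hε hεh c hc) (fun c hc => abs_potF_le hε hεh hc)
          refine key.trans ?_
          have h2 : ‖z‖ ^ 2 ≤ (2 * R) ^ 2 :=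
            pow_le_pow_left₀ (norm_nonneg z) (mem_ball_zero_iff.1 hz).le 2
          exact mul_le_mul_left (ENNReal.ofReal_le_ofReal h2) E
        · have hPe : P = ∅ := by
            refine eq_empty_of_forall_notMem fun p hp => hz (mem_ball_zero_iff.2 ?_)
            have h1 := mem_ball.1 hp.2.1
            have h2 := mem_ball.1 hp.2.2
            have h3 := dist_triangle_right (p.2 + z) p.2 x₀
            rw [dist_eq_norm (p.2 + z), add_sub_cancel_left] at h3
            linarith
          simp [hPe]
    _ = _ := by
        rw [lintegral_indicator_const measurableSet_ball]
        ring

end NonnegSupersolution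

end TransitionPoincare

section TailBound

variable {T s q ρ θ t₀ : ℝ} {Ω : Set (Ed d)} {v : ℝ → Ed d → ℝ} {Dv : ℝ → Ed d → Ed d}

lemma Tail_nonneg (s : ℝ) (w : Ed d → ℝ) (x₀ : Ed d) (ρ : ℝ) : 0 ≤ Tail s w x₀ ρ :=
  mul_nonneg (sq_nonneg _) (integral_nonneg fun y => by positivity)

lemma exists_tail_negPart_le (hreg : LocalWeakReg d s (Ioo 0 T) Ω v Dv) (hs : 0 < s)
    (hρ : 0 < ρ) (x₀ : Ed d) :
    ∃ C : ℝ, ∀ᵐ t : ℝ, t ∈ Ioo 0 T →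
      ∫⁻ y in (ball x₀ ρ)ᶜ, ENNReal.ofReal (max (-v t y) 0 * kern s (y - x₀)) =
          ENNReal.ofReal (Tail s (fun y => max (-v t y) 0) x₀ ρ / ρ ^ 2) ∧
        Tail s (fun y => max (-v t y) 0) x₀ ρ ≤
          C * ∫ y : Ed d, |v t y| / (1 + ‖y‖ ^ ((d : ℝ) + 2 * s)) := by
  obtain ⟨C, hC0, hC⟩ := exists_kern_le_weight hs hρ hρ x₀
  refine ⟨ρ ^ 2 * C, ?_⟩
  filter_upwards [hreg.tail_ae] with t ht htT
  have hvm : Measurable (v t) := hreg.meas.comp measurable_prodMk_left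
  have e : ∀ y, |max (-v t y) 0| / ‖x₀ - y‖ ^ ((d : ℝ) + 2 * s) =
      max (-v t y) 0 * kern s (y - x₀) := fun y => by
    rw [kern, norm_sub_rev, div_eq_mul_inv, abs_of_nonneg (le_max_right _ _)]
  have h0 : ∀ y, 0 ≤ max (-v t y) 0 * kern s (y - x₀) := fun y =>
    mul_nonneg (le_max_right _ _) (kern_nonneg s _)
  have hle : ∀ y ∈ (ball x₀ ρ)ᶜ, max (-v t y) 0 * kern s (y - x₀) ≤
      C * (|v t y| / (1 + ‖y‖ ^ ((d : ℝ) + 2 * s))) := by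
    intro y hy
    have h1 := hC x₀ (mem_ball_self hρ) y (not_lt.1 fun h => hy (mem_ball_iff_norm.2 h))
    calc _ ≤ |v t y| * (C / (1 + ‖y‖ ^ ((d : ℝ) + 2 * s))) := by
          gcongr
          · exact kern_nonneg s _
          · exact max_le (neg_le_abs _) (abs_nonneg _)
      _ = _ := by ring
  have hw := (ht htT).const_mul C
  have hm : Measurable fun y => max (-v t y) 0 * kern s (y - x₀) :=
    (hvm.neg.max measurable_const).mul ((measurable_kern s).comp (by fun_prop))
  have hi : IntegrableOn (fun y => max (-v t y) 0 * kern s (y - x₀)) (ball x₀ ρ)ᶜ := by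
    refine hw.integrableOn.mono' hm.aestronglyMeasurable ?_
    filter_upwards [ae_restrict_mem measurableSet_ball.compl] with y hy
    rw [Real.norm_of_nonneg (h0 y)]
    exact hle y hy
  have hT : Tail s (fun y => max (-v t y) 0) x₀ ρ =
      ρ ^ 2 * ∫ y in (ball x₀ ρ)ᶜ, max (-v t y) 0 * kern s (y - x₀) := by
    simp only [Tail, e]
  refine ⟨?_, ?_⟩
  · rw [hT, mul_div_cancel_left₀ _ (by positivity),
      ofReal_integral_eq_lintegral_ofReal hi (ae_of_all _ h0)]
  · rw [hT, mul_assoc]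
    refine mul_le_mul_of_nonneg_left ?_ (sq_nonneg ρ)
    rw [← integral_const_mul]
    refine (setIntegral_mono_on hi hw.integrableOn measurableSet_ball.compl hle).trans
      (setIntegral_le_integral hw (ae_of_all _ fun y => ?_))
    change 0 ≤ C * (|v t y| / (1 + ‖y‖ ^ ((d : ℝ) + 2 * s)))
    positivity

lemma le_add_mul_rpow {x : ℝ} (hq : 1 < q) (hθ : 0 < θ) (hx : 0 ≤ x) :
    x ≤ θ + θ * (x ^ q / θ ^ q) := by
  rw [← Real.div_rpow hx hθ.le]
  have h1 : x / θ ≤ 1 + (x / θ) ^ q := by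
    rcases le_total (x / θ) 1 with h | h
    · exact h.trans (le_add_of_nonneg_right (by positivity))
    · exact (Real.self_le_rpow_of_one_le h hq.le).trans (by linarith)
  calc x = θ * (x / θ) := by field_simp
    _ ≤ θ * (1 + (x / θ) ^ q) := by gcongr
    _ = _ := by ring

lemma rpow_le_one_add_sq {x : ℝ} (hq : q ∈ Ioc (1 : ℝ) 2) (hx : 0 ≤ x) : x ^ q ≤ 1 + x ^ 2 := by
  rcases le_total x 1 with h | h
  · exact (Real.rpow_le_one hx h (by linarith [hq.1])).trans (by nlinarith)
  · have h1 := Real.rpow_le_rpow_of_exponent_le h hq.2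
    rw [Real.rpow_two] at h1
    linarith

lemma lintegral_tail_negPart_le (hreg : LocalWeakReg d s (Ioo 0 T) Ω v Dv) (hs : 0 < s)
    (hq : q ∈ Ioc (1 : ℝ) 2) (hρ : 0 < ρ) (hJ : Icc (t₀ - ρ ^ 2) t₀ ⊆ Ioo 0 T) (hθ : 0 < θ)
    (x₀ : Ed d) (h : (⨍ t in Iminus t₀ ρ, (Tail s (fun y => max (-v t y) 0) x₀ ρ) ^ q) ^ (1 / q)
      ≤ θ) :
    ∫⁻ t in Ioo (t₀ - ρ ^ 2) t₀, ∫⁻ y in (ball x₀ ρ)ᶜ,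
      ENNReal.ofReal (max (-v t y) 0 * kern s (y - x₀)) ≤ ENNReal.ofReal (2 * θ) := by
  set I := Ioo (t₀ - ρ ^ 2) t₀ with hI
  have hIm : I = Iminus t₀ ρ := rfl
  rw [← hIm] at h
  set F : ℝ → ℝ := fun t => Tail s (fun y => max (-v t y) 0) x₀ ρ with hF
  have hF0 : ∀ t, 0 ≤ F t := fun t => Tail_nonneg _ _ _ _
  have hq0 : 0 < q := by linarith [hq.1]
  obtain ⟨C, hC⟩ := exists_tail_negPart_le hreg hs hρ x₀
  have hCI : ∀ᵐ t ∂(volume.restrict I), _ :=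
    (ae_restrict_of_ae (s := I) hC).and (ae_restrict_mem measurableSet_Ioo)
  have hIJ : I ⊆ Ioo 0 T := Ioo_subset_Icc_self.trans hJ
  have hFm : StronglyMeasurable F := by
    have hm : Measurable fun p : ℝ × Ed d =>
        |max (-v p.1 p.2) 0| / ‖x₀ - p.2‖ ^ ((d : ℝ) + 2 * s) :=
      (((hreg.meas.neg).max measurable_const).abs).div
        ((measurable_const.sub measurable_snd).norm.pow_const _)
    exact (hm.stronglyMeasurable.integral_prod_right' (ν := volume.restrict (ball x₀ ρ)ᶜ)).const_mul
      (ρ ^ 2)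
  have hvol : volume.real I = ρ ^ 2 := by
    rw [hI, Real.volume_real_Ioo_of_le (by nlinarith)]
    ring
  have hFq : Integrable (fun t => F t ^ q) (volume.restrict I) := by
    have h1 := ((integrable_const (μ := volume.restrict I) (1 : ℝ)).add
      ((hreg.tail_l2 _ _ hJ).const_mul (C ^ 2)))
    refine h1.mono' (hFm.measurable.pow_const q).aestronglyMeasurable ?_
    filter_upwards [hCI] with t ht
    rw [Real.norm_of_nonneg (Real.rpow_nonneg (hF0 t) q)]
    refine (rpow_le_one_add_sq hq (hF0 t)).trans ?_
    have h2 := pow_le_pow_left₀ (hF0 t) (ht.1 (hIJ ht.2)).2 2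
    rw [mul_pow] at h2
    exact add_le_add_right h2 1
  have havg : ∫ t in I, F t ^ q ≤ ρ ^ 2 * θ ^ q := by
    rw [setAverage_eq, hvol, smul_eq_mul] at h
    have h1 : 0 ≤ (ρ ^ 2)⁻¹ * ∫ t in I, F t ^ q :=
      mul_nonneg (by positivity) (integral_nonneg fun t => Real.rpow_nonneg (hF0 t) q)
    have h2 := Real.rpow_le_rpow (Real.rpow_nonneg h1 _) h hq0.le
    rw [← Real.rpow_mul h1, one_div_mul_cancel hq0.ne', Real.rpow_one,
      inv_mul_le_iff₀ (by positivity)] at h2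
    exact h2
  have hmaj : Integrable (fun t => (θ + θ * (F t ^ q / θ ^ q)) / ρ ^ 2) (volume.restrict I) :=
    ((integrable_const θ).add ((hFq.div_const _).const_mul θ)).div_const _
  calc _ ≤ ∫⁻ t in I, ENNReal.ofReal ((θ + θ * (F t ^ q / θ ^ q)) / ρ ^ 2) := by
        refine lintegral_mono_ae ?_
        filter_upwards [hCI] with t ht
        rw [(ht.1 (hIJ ht.2)).1]
        refine ENNReal.ofReal_le_ofReal ?_
        gcongr
        exact le_add_mul_rpow hq.1 hθ (hF0 t)
    _ = ENNReal.ofReal (∫ t in I, (θ + θ * (F t ^ q / θ ^ q)) / ρ ^ 2) := by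
        refine (ofReal_integral_eq_lintegral_ofReal hmaj (ae_of_all _ fun t => ?_)).symm
        have := Real.rpow_nonneg (hF0 t) q
        change 0 ≤ (θ + θ * (F t ^ q / θ ^ q)) / ρ ^ 2
        positivity
    _ ≤ _ := by
        refine ENNReal.ofReal_le_ofReal ?_
        rw [integral_div, integral_add (integrable_const θ) ((hFq.div_const _).const_mul θ),
          integral_const_mul, integral_div, setIntegral_const, hvol, smul_eq_mul,
          div_le_iff₀ (by positivity)]
        have h1 : (∫ t in I, F t ^ q) / θ ^ q ≤ ρ ^ 2 :=
          (div_le_iff₀ (Real.rpow_pos_of_pos hθ q)).2 havg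
        nlinarith

end TailBound

section Assembly

variable {s Λ T σ R h t₀ : ℝ} {Ω : Set (Ed d)} {A : ℝ → Ed d → Ed d → Ed d}
  {K : ℝ → Ed d → Ed d → ℝ} {v : ℝ → Ed d → ℝ} {Dv : ℝ → Ed d → Ed d} {x₀ : Ed d} {S : Set ℝ}

lemma mul_log_sq_le (hσ : 0 < σ) (h8 : σ ≤ 8) : σ * Real.log (8 / σ) ^ 2 ≤ 32 := by
  have hy : 1 ≤ 8 / σ := (one_le_div hσ).2 h8
  have h1 := Real.log_le_sub_one_of_pos (Real.sqrt_pos.2 (by positivity : 0 < 8 / σ))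
  rw [Real.log_sqrt (by positivity)] at h1
  have h2 : Real.log (8 / σ) ≤ 2 * √(8 / σ) := by linarith
  have h3 := pow_le_pow_left₀ (Real.log_nonneg hy) h2 2
  rw [mul_pow, Real.sq_sqrt (by positivity)] at h3
  calc _ ≤ σ * (2 ^ 2 * (8 / σ)) := by gcongr
    _ = 32 := by field_simp; norm_num

lemma one_le_log_eight_div (hσ : σ ∈ Ioc (0 : ℝ) 1) : 1 ≤ Real.log (8 / σ) := by
  have h1 : (8 : ℝ) ≤ 8 / σ := le_div_self (by norm_num) hσ.1 hσ.2
  rw [Real.le_log_iff_exp_le (by linarith)]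
  linarith [Real.exp_one_lt_d9]

lemma mul_log_le_of_energy_of_poincare {d : ℕ} {ω B C J N : ℝ} (hΛ : 1 ≤ Λ) (hR : 0 < R)
    (hs : s ∈ Ioo (0 : ℝ) 1) (hσ : σ ∈ Ioc (0 : ℝ) 1) (hω : 0 < ω) (hB : B = R ^ d * ω)
    (hC : 0 < C) (hJ : 0 ≤ J) (hN : 0 ≤ N)
    (hE : Λ⁻¹ / 2 * J + Λ⁻¹ * (8 / σ / 64) * ((2 * R) ^ ((d : ℝ) + 2 * s))⁻¹ * N ≤
      C * B * Real.log (8 / σ) * (1 + R ^ (2 - 2 * s)))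
    (hP : (Real.log (8 / σ) / 8) ^ 2 * N ≤ (2 * R) ^ 2 * (2 ^ d * B) * J) :
    N * Real.log (8 / σ) ≤
      (1024 * 2 ^ d * Λ * C + 512 * Λ * C * 2 ^ ((d : ℝ) + 2 * s) / ω) * R ^ 2 * B ^ 2 := by
  have hσ0 := hσ.1
  have hℓ := one_le_log_eight_div hσ
  have hσℓ := mul_log_sq_le hσ0 (by linarith [hσ.2])
  set ℓ := Real.log (8 / σ) with hℓd
  have hΛ0 : 0 < Λ := by linarith
  have hB0 : 0 < B := by rw [hB]; positivity
  set p : ℝ := (d : ℝ) + 2 * s with hp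
  have h2p : 0 < (2 : ℝ) ^ p := by positivity
  have hRp : 0 < R ^ p := by positivity
  have hmul : (2 * R) ^ p = 2 ^ p * R ^ p := Real.mul_rpow (by norm_num) hR.le
  rw [hmul] at hE
  set X := R ^ (2 - 2 * s) with hX
  have hX0 : 0 < X := by positivity
  have hcross : X * R ^ p = R ^ d * R ^ 2 := by
    rw [hX, ← Real.rpow_add hR, hp, show 2 - 2 * s + ((d : ℝ) + 2 * s) = ((d + 2 : ℕ) : ℝ) by
      push_cast; ring, Real.rpow_natCast, pow_add]
  have hexp : 0 ≤ 2 - 2 * s := by linarith [hs.2]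
  rcases le_total R 1 with hR1 | hR1
  · have hX1 : X ≤ 1 := Real.rpow_le_one hR.le hR1 hexp
    have h1 : Λ⁻¹ / 2 * J ≤ C * B * ℓ * 2 := by
      have h2 : 0 ≤ Λ⁻¹ * (8 / σ / 64) * (2 ^ p * R ^ p)⁻¹ * N := by positivity
      have h3 : C * B * ℓ * (1 + X) ≤ C * B * ℓ * 2 := by gcongr; linarith
      linarith
    have h2 : J ≤ 4 * Λ * C * B * ℓ := by
      calc J = 2 * Λ * (Λ⁻¹ / 2 * J) := by field_simp
        _ ≤ 2 * Λ * (C * B * ℓ * 2) := by gcongr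
        _ = _ := by ring
    have h3 : N * ℓ ≤ 1024 * 2 ^ d * Λ * C * R ^ 2 * B ^ 2 := by
      refine le_of_mul_le_mul_right ?_ (by linarith : 0 < ℓ)
      calc N * ℓ * ℓ = 64 * ((ℓ / 8) ^ 2 * N) := by ring
        _ ≤ 64 * ((2 * R) ^ 2 * (2 ^ d * B) * J) := by gcongr
        _ ≤ 64 * ((2 * R) ^ 2 * (2 ^ d * B) * (4 * Λ * C * B * ℓ)) := by gcongr
        _ = _ := by ring
    have h4 : 0 ≤ 512 * Λ * C * 2 ^ p / ω * R ^ 2 * B ^ 2 := by positivity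
    linarith
  · have hX1 : 1 ≤ X := Real.one_le_rpow hR1 hexp
    have h1 : Λ⁻¹ * (8 / σ / 64) * (2 ^ p * R ^ p)⁻¹ * N ≤ C * B * ℓ * (2 * X) := by
      have h2 : 0 ≤ Λ⁻¹ / 2 * J := by positivity
      have h3 : C * B * ℓ * (1 + X) ≤ C * B * ℓ * (2 * X) := by gcongr; linarith
      linarith
    have h2 : N * ℓ ≤ 512 * Λ * C * 2 ^ p / ω * R ^ 2 * B ^ 2 := by
      calc N * ℓ = 8 * Λ * σ * (2 ^ p * R ^ p) * ℓ *
            (Λ⁻¹ * (8 / σ / 64) * (2 ^ p * R ^ p)⁻¹ * N) := by field_simp; norm_num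
        _ ≤ 8 * Λ * σ * (2 ^ p * R ^ p) * ℓ * (C * B * ℓ * (2 * X)) := by gcongr
        _ = 16 * Λ * C * 2 ^ p * B * (X * R ^ p) * (σ * ℓ ^ 2) := by ring
        _ ≤ 16 * Λ * C * 2 ^ p * B * (X * R ^ p) * 32 := by gcongr
        _ = _ := by rw [hcross, hB]; field_simp; norm_num
    have h4 : 0 ≤ 1024 * 2 ^ d * Λ * C * R ^ 2 * B ^ 2 := by positivity
    linarith

lemma energy_constant_le {η₀ c₁ c₂ ℓ : ℝ} {d : ℕ} (hΛ : 1 ≤ Λ) (hR : 0 < R)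
    (hc₁ : 0 < c₁) (hc₂ : 0 < c₂) (hℓ : 1 ≤ ℓ) :
    ℓ + 2 * Λ ^ 3 * (η₀ / R) ^ 2 * (4 * R ^ 2) +
        3 * Λ * (η₀ / R) ^ 2 * (4 * R ^ 2 * (c₁ * (2 * (2 * R)) ^ (2 - 2 * s))) +
        2 * (Λ * 4 ^ ((d : ℝ) + 2 * s) * (4 * R ^ 2 * (c₂ * (2 * R) ^ (-(2 * s))) + 8)) ≤
      (1 + 8 * Λ ^ 3 * η₀ ^ 2 + 12 * Λ * η₀ ^ 2 * c₁ * 4 ^ (2 - 2 * s) +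
        2 * Λ * 4 ^ ((d : ℝ) + 2 * s) * (4 * 2 ^ (-(2 * s)) * c₂ + 8)) * ℓ *
        (1 + R ^ (2 - 2 * s)) := by
  have hΛ0 : 0 < Λ := by linarith
  have e1 : (2 * (2 * R)) ^ (2 - 2 * s) = 4 ^ (2 - 2 * s) * R ^ (2 - 2 * s) := by
    rw [← Real.mul_rpow (by norm_num) hR.le]
    congr 1
    ring
  have e2 : R ^ 2 * (2 * R) ^ (-(2 * s)) = 2 ^ (-(2 * s)) * R ^ (2 - 2 * s) := by
    rw [Real.mul_rpow (by norm_num) hR.le, sub_eq_add_neg, Real.rpow_add hR, Real.rpow_two]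
    ring
  have e3 : (η₀ / R) ^ 2 * R ^ 2 = η₀ ^ 2 := by field_simp
  set X := R ^ (2 - 2 * s) with hX
  have hX0 : 0 < X := by positivity
  have h4 : (0 : ℝ) < 4 ^ ((d : ℝ) + 2 * s) := by positivity
  have h5 : (0 : ℝ) < 4 ^ (2 - 2 * s) := by positivity
  have h6 : (0 : ℝ) < 2 ^ (-(2 * s)) := by positivity
  have hY1 : 1 ≤ ℓ * (1 + X) := by nlinarith
  have hYX : X ≤ ℓ * (1 + X) := by nlinarith
  have hYℓ : ℓ ≤ ℓ * (1 + X) := by nlinarith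
  set Y := ℓ * (1 + X) with hY
  calc _ = ℓ + 8 * Λ ^ 3 * η₀ ^ 2 * 1 + 12 * Λ * η₀ ^ 2 * c₁ * 4 ^ (2 - 2 * s) * X +
        2 * Λ * 4 ^ ((d : ℝ) + 2 * s) * (4 * 2 ^ (-(2 * s)) * c₂ * X + 8 * 1) := by
        rw [e1, ← e3]
        linear_combination (8 * Λ * 4 ^ ((d : ℝ) + 2 * s) * c₂) * e2
    _ ≤ Y + 8 * Λ ^ 3 * η₀ ^ 2 * Y + 12 * Λ * η₀ ^ 2 * c₁ * 4 ^ (2 - 2 * s) * Y +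
        2 * Λ * 4 ^ ((d : ℝ) + 2 * s) * (4 * 2 ^ (-(2 * s)) * c₂ * Y + 8 * Y) := by
        gcongr
    _ = _ := by rw [hY]; ring

end Assembly

section Shrinking

variable {s Λ T σ R h t₀ : ℝ} {Ω : Set (Ed d)} {A : ℝ → Ed d → Ed d → Ed d}
  {K : ℝ → Ed d → Ed d → ℝ} {v : ℝ → Ed d → ℝ} {Dv : ℝ → Ed d → Ed d} {x₀ : Ed d} {S : Set ℝ}

/-- On time slices away from the final time, the measure of the transition pairs is controlled
by the inverse of the logarithm of the ratio between the two levels. -/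
lemma exists_measure_transitionPairs_le (hd : 1 ≤ d) (hs : s ∈ Ioo (0 : ℝ) 1) (hΛ : 1 ≤ Λ) :
    ∃ C : ℝ, 0 < C ∧ ∀ {T R t₀ : ℝ} {Ω : Set (Ed d)} {A : ℝ → Ed d → Ed d → Ed d}
      {K : ℝ → Ed d → Ed d → ℝ} {v : ℝ → Ed d → ℝ} {Dv : ℝ → Ed d → Ed d} {x₀ : Ed d},
      0 < R → NonnegSupersolution s Λ T Ω A K v Dv (t₀ - 4 * R ^ 2) t₀ (2 * R) x₀ →
      ∀ {σ h κ : ℝ} {S : Set ℝ}, σ ∈ Ioc (0 : ℝ) 1 → 0 < h → 0 < κ → MeasurableSet S →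
      S ⊆ Icc (t₀ - R ^ 2) (t₀ - 2 * κ) →
      ∫⁻ t in Ioo (t₀ - 4 * R ^ 2) t₀, ∫⁻ y in (ball x₀ (2 * R))ᶜ,
        ENNReal.ofReal (max (-v t y) 0 * kern s (y - x₀)) ≤ ENNReal.ofReal (2 * (σ * h)) →
      ((volume.restrict (Ioc (t₀ - 4 * R ^ 2) t₀)).prod (volume.prod volume)).real
          (transitionPairs S x₀ R (σ * h / 4) (2 * h) v) * Real.log (8 / σ) ≤
        C * R ^ 2 * volume.real (ball x₀ R) ^ 2 := by
  obtain ⟨η₀, hη₀, hη⟩ := exists_isSpaceCutoff d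
  obtain ⟨c₁, hc₁, hc₁'⟩ := exists_lintegral_sq_kern_le hd hs
  obtain ⟨c₂, hc₂, hc₂'⟩ := exists_lintegral_kern_compl_le (d := d) hs.1
  have hΛ0 : 0 < Λ := by linarith
  set ω := volume.real (ball (0 : Ed d) 1) with hω
  have hω0 : 0 < ω :=
    ENNReal.toReal_pos (measure_ball_pos volume 0 one_pos).ne' measure_ball_lt_top.ne
  set E := 1 + 8 * Λ ^ 3 * η₀ ^ 2 + 12 * Λ * η₀ ^ 2 * c₁ * 4 ^ (2 - 2 * s) +
    2 * Λ * 4 ^ ((d : ℝ) + 2 * s) * (4 * 2 ^ (-(2 * s)) * c₂ + 8) with hE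
  have hE0 : 0 < E := by positivity
  refine ⟨1024 * 2 ^ d * Λ * (2 ^ d * E) + 512 * Λ * (2 ^ d * E) * 2 ^ ((d : ℝ) + 2 * s) / ω,
    by positivity, ?_⟩
  intro T R t₀ Ω A K v Dv x₀ hR H σ h κ S hσ hh hκ hSm hS htail
  obtain ⟨η, hηc, hη1⟩ := hη x₀ R hR
  obtain ⟨ζ, m, hζc, hζ1⟩ := exists_isTimeCutoff (b := t₀) hR hκ
  have hσ0 := hσ.1
  have hℓ := one_le_log_eight_div hσ
  set ε := σ * h / 4 with hε
  have hε0 : 0 < ε := by positivity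
  have hεh : 8 * ε ≤ 2 * h := by rw [hε]; nlinarith [hσ.2]
  have hratio : 2 * h / ε = 8 / σ := by rw [hε]; field_simp; norm_num
  set γ := min (R ^ 2) (min κ (R / 2)) / 4 with hγ
  have hγ0 : 0 < γ := by positivity
  have hγ1 : 4 * γ ≤ R ^ 2 := by
    rw [hγ, mul_div_cancel₀ _ (by norm_num)]
    exact min_le_left _ _
  have hγ2 : 4 * γ ≤ κ := by
    rw [hγ, mul_div_cancel₀ _ (by norm_num)]
    exact (min_le_right _ _).trans (min_le_left _ _)
  have hγ3 : 4 * γ ≤ R / 2 := by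
    rw [hγ, mul_div_cancel₀ _ (by norm_num)]
    exact (min_le_right _ _).trans (min_le_right _ _)
  have hball : ∀ (x : Ed d) (r : ℝ), 0 < r → volume (ball x r) = ENNReal.ofReal (r ^ d * ω) := by
    intro x r hr
    rw [Measure.addHaar_ball_of_pos _ _ hr, finrank_euclideanSpace_fin,
      ENNReal.ofReal_mul (by positivity), hω, ofReal_measureReal measure_ball_lt_top.ne]
  have hballr : ∀ (x : Ed d) (r : ℝ), 0 < r → volume.real (ball x r) = r ^ d * ω := by
    intro x r hr
    rw [Measure.real, hball x r hr, ENNReal.toReal_ofReal (by positivity)]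
  have hB := hballr x₀ R hR
  have hB2 : volume.real (ball x₀ (2 * R)) = 2 ^ d * volume.real (ball x₀ R) := by
    rw [hB, hballr x₀ (2 * R) (by positivity), mul_pow]
    ring
  set B := volume.real (ball x₀ R) with hBd
  have hB0 : 0 ≤ B := measureReal_nonneg
  have hεM : ε⁻¹ * (2 * (σ * h)) = 8 := by rw [hε]; field_simp; norm_num
  have hSab : S ⊆ Ioo (t₀ - 4 * R ^ 2) t₀ := fun t ht =>
    ⟨by nlinarith [(hS ht).1], by linarith [(hS ht).2]⟩
  have henergy := H.energy_add_transition_le hζc hηc hε0 hεh hγ0 (by linarith) (by linarith)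
    (by linarith) (by linarith) (by linarith) hSm hSab (fun t ht => hζ1 t (hS ht)) hη1
    (hc₁' (2 * (2 * R)) (by positivity)) (by positivity) (hc₂' (2 * R) (by positivity))
    (by positivity) (by positivity) htail
  have hpoin := H.log_sq_mul_measure_transitionPairs_le hε0 hεh hγ0 hSm
    (fun t ht => ⟨by nlinarith [(hS ht).1], by linarith [(hS ht).2]⟩) (R := R) (by linarith)
  have hpot := H.lintegral_potF_smul_sq_le hζc hηc hε0 (by linarith : ε ≤ 2 * h) hSm
    (fun t ht => hζ1 t (hS ht)) hη1
  set J := ∫ p, potEnergy ζ η ε (2 * h) (onCyl (t₀ - 4 * R ^ 2) t₀ (2 * R) x₀ v)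
    (onCyl (t₀ - 4 * R ^ 2) t₀ (2 * R) x₀ Dv) p with hJ
  have hJ0 : 0 ≤ J := integral_nonneg (potEnergy_nonneg hζc _ _)
  set ν := (volume.restrict (Ioc (t₀ - 4 * R ^ 2) t₀)).prod
    ((volume : Measure (Ed d)).prod (volume : Measure (Ed d))) with hν
  have hfin := measure_transitionPairs_lt_top x₀ R ε (2 * h) v S (t₀ - 4 * R ^ 2) t₀
  rw [hratio] at henergy hpoin
  refine mul_log_le_of_energy_of_poincare hΛ hR hs hσ hω0 hB (by positivity) hJ0
    measureReal_nonneg ?_ ?_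
  · refine henergy.trans ?_
    rw [hB2, hεM, show t₀ - (t₀ - 4 * R ^ 2) = 4 * R ^ 2 by ring]
    calc _ ≤ 2 ^ d * B * (E * Real.log (8 / σ) * (1 + R ^ (2 - 2 * s))) := by
          gcongr
          exact energy_constant_le hΛ hR hc₁ hc₂ hℓ
      _ = _ := by ring
  · have h1 := hpoin.trans (mul_le_mul_right hpot _)
    rw [hball 0 (2 * R) (by positivity), ← ENNReal.ofReal_mul (by positivity),
      ← ENNReal.ofReal_mul (by positivity), ← ofReal_measureReal hfin.ne,
      ← ENNReal.ofReal_mul (by positivity), ENNReal.ofReal_le_ofReal_iff (by positivity)] at h1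
    refine h1.trans_eq ?_
    rw [hB, mul_pow (2 : ℝ) R d]
    ring

end Shrinking

section MeasureShrinking

/-- If the product of `α`, a measure `m` and `ℓ` is at most `C R² B`, where `m` is also at most
the measure `(δR)² B` of a cylinder, then `m` is small compared with the cylinder. -/
lemma le_div_sqrt_logb_mul {α δ σ C R B m : ℝ} (hα : α ∈ Ioc (0 : ℝ) 1) (hδ : δ ∈ Ioc (0 : ℝ) 1)
    (hσ : σ ∈ Ioc (0 : ℝ) 1) (hR : 0 < R) (hB : 0 < B) (hm : 0 ≤ m)
    (h1 : m ≤ (δ * R) ^ 2 * B) (h2 : α * m * Real.log (8 / σ) ≤ C * R ^ 2 * B) :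
    m ≤ √(2 * C) / (α * δ * √(Real.logb 2 (2 / σ))) * ((δ * R) ^ 2 * B) := by
  have hα0 := hα.1
  have hδ0 := hδ.1
  have hσ0 := hσ.1
  have hlog2 : 1 / 2 ≤ Real.log 2 := by linarith [Real.log_two_gt_d9]
  have hl : Real.log 2 ≤ Real.log (2 / σ) :=
    Real.log_le_log two_pos (by rw [le_div_iff₀ hσ0]; linarith [hσ.2])
  have hl' : Real.log (2 / σ) ≤ Real.log (8 / σ) :=
    Real.log_le_log (by positivity) (by gcongr; norm_num)
  set L := Real.logb 2 (2 / σ) with hL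
  have hLe : L * Real.log 2 = Real.log (2 / σ) := by
    rw [hL, Real.logb, div_mul_cancel₀ _ (by linarith)]
  have hL0 : 0 < L := by
    rw [hL, Real.logb]
    exact div_pos (by linarith) (by linarith)
  have hL8 : L ≤ 2 * Real.log (8 / σ) := by nlinarith
  have hQ : 0 < (δ * R) ^ 2 * B := by positivity
  rw [← div_le_iff₀ hQ]
  set x := m / ((δ * R) ^ 2 * B) with hx
  have hmx : m = x * ((δ * R) ^ 2 * B) := by rw [hx, div_mul_cancel₀ _ hQ.ne']
  have hx0 : 0 ≤ x := by positivity
  have hx1 : x ≤ 1 := (div_le_one hQ).2 h1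
  have h3 : α * x * δ ^ 2 * L ≤ 2 * C := by
    have h4 : α * x * δ ^ 2 * Real.log (8 / σ) ≤ C := by
      rw [hmx] at h2
      refine le_of_mul_le_mul_right (h2.trans_eq' ?_ |>.trans_eq ?_)
        (show 0 < R ^ 2 * B by positivity)
      · ring
      · ring
    have : α * x * δ ^ 2 * L ≤ α * x * δ ^ 2 * (2 * Real.log (8 / σ)) := by gcongr
    linarith
  rw [le_div_iff₀ (by positivity)]
  refine Real.le_sqrt_of_sq_le ?_
  calc (x * (α * δ * √L)) ^ 2 = (α * x) * (α * x * δ ^ 2 * L) := by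
        rw [mul_pow, mul_pow, Real.sq_sqrt hL0.le]
        ring
    _ ≤ 1 * (2 * C) := by
        gcongr
        exact mul_le_one₀ hα.2 hx0 hx1
    _ = 2 * C := one_mul _

variable {R δ ε t₀ : ℝ} {v : ℝ → Ed d → ℝ} {x₀ : Ed d}

/-- A bound for the measure of a sublevel set in truncated time intervals passes to the full
interval. -/
lemma measure_sublevel_le_of_truncated {c : ℝ≥0∞}
    (h : ∀ κ : ℝ, 0 < κ → volume {p : ℝ × Ed d |
      p ∈ Ioo (t₀ - (δ * R) ^ 2) (t₀ - 2 * κ) ×ˢ ball x₀ R ∧ v p.1 p.2 ≤ ε} ≤ c) :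
    volume {p : ℝ × Ed d | p ∈ Iminus t₀ (δ * R) ×ˢ ball x₀ R ∧ v p.1 p.2 ≤ ε} ≤ c := by
  set E : ℕ → Set (ℝ × Ed d) := fun n => {p | p ∈ Ioo (t₀ - (δ * R) ^ 2)
    (t₀ - 2 * (1 / ((n : ℝ) + 1))) ×ˢ ball x₀ R ∧ v p.1 p.2 ≤ ε} with hE
  have hmono : Monotone E := fun m n hmn p hp =>
    ⟨⟨⟨hp.1.1.1, hp.1.1.2.trans_le (by
      have := Nat.one_div_le_one_div (α := ℝ) hmn
      linarith)⟩, hp.1.2⟩, hp.2⟩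
  have hsub : {p : ℝ × Ed d | p ∈ Iminus t₀ (δ * R) ×ˢ ball x₀ R ∧ v p.1 p.2 ≤ ε} ⊆
      ⋃ n, E n := by
    intro p hp
    obtain ⟨n, hn⟩ := exists_nat_one_div_lt (show 0 < (t₀ - p.1) / 2 by linarith [hp.1.1.2])
    exact mem_iUnion.2 ⟨n, ⟨⟨hp.1.1.1, by linarith⟩, hp.1.2⟩, hp.2⟩
  refine (measure_mono hsub).trans ?_
  rw [hmono.measure_iUnion]
  exact iSup_le fun n => h _ (by positivity)

end MeasureShrinking

/-- **Lemma 3.5: measure shrinking lemma.** -/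
theorem measure_shrinking_lemma
    (d : ℕ) (hd : 2 ≤ d) (s Λ q : ℝ)
    (hs : s ∈ Set.Ioo (0 : ℝ) 1) (hΛ : 1 ≤ Λ) (hq : q ∈ Set.Ioc (1 : ℝ) 2) :
    ∃ C : ℝ, 0 < C ∧
      ∀ (T : ℝ), 0 < T → ∀ (Ω : Set (Ed d)), IsOpen Ω → Bornology.IsBounded Ω →
      ∀ (A : ℝ → Ed d → Ed d → Ed d), VectorFieldHyp d Λ A →
      ∀ (K : ℝ → Ed d → Ed d → ℝ), KernelHyp d s Λ K →
      ∀ (v : ℝ → Ed d → ℝ) (Dv : ℝ → Ed d → Ed d),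
        LocalWeakReg d s (Set.Ioo 0 T) Ω v Dv →
        IsLocalWeakSupersolutionHom A K (Set.Ioo 0 T) Ω v Dv →
        ∀ α ∈ Set.Ioc (0 : ℝ) 1, ∀ R : ℝ, 0 < R → ∀ (t₀ : ℝ) (x₀ : Ed d),
          closure ((Iminus t₀ (2 * R)) ×ˢ Metric.ball x₀ (2 * R)) ⊆ (Set.Ioo 0 T) ×ˢ Ω →
          ∀ δ ∈ Set.Ioc (0 : ℝ) 1, ∀ σ ∈ Set.Ioc (0 : ℝ) 1, ∀ H : ℝ, 0 < H →
            -- `v ≥ 0` in `Q_{2R}(t₀,x₀)`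
            (∀ᵐ p ∂(volume : Measure (ℝ × Ed d)),
              p ∈ pCyl t₀ x₀ (2 * R) → 0 ≤ v p.1 p.2) →
            -- measure density assumption (3.18) for a.e. `t ∈ I_{δR}^⊖(t₀)`
            (∀ᵐ t ∂(volume.restrict (Iminus t₀ (δ * R))),
              ENNReal.ofReal α * volume (Metric.ball x₀ R) ≤
                volume {x : Ed d | x ∈ Metric.ball x₀ R ∧ H ≤ v t x}) →
            -- either the tail is large (3.19) ...
            (σ * H < (⨍ t in Iminus t₀ (2 * R),
                (Tail s (fun y => max (-v t y) 0) x₀ (2 * R)) ^ q) ^ (1 / q)) ∨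
            -- ... or the sublevel set is small
            volume {p : ℝ × Ed d |
                p ∈ (Iminus t₀ (δ * R)) ×ˢ Metric.ball x₀ R ∧ v p.1 p.2 ≤ σ * H / 4} ≤
              ENNReal.ofReal (C / (α * δ * Real.sqrt (Real.logb 2 (2 / σ)))) *
                volume ((Iminus t₀ (δ * R)) ×ˢ Metric.ball x₀ R) := by
  obtain ⟨C, hC, hmain⟩ := exists_measure_transitionPairs_le (d := d) (by omega) hs hΛ
  refine ⟨√(2 * C), by positivity, ?_⟩
  intro T hT Ω hΩ hΩb A hA K hK v Dv hreg hsup α hα R hR t₀ x₀ hcl δ hδ σ hσ H hH hnn hdens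
  rw [or_iff_not_imp_left, not_lt]
  intro htail
  have h4 : (2 * R) ^ 2 = 4 * R ^ 2 := by ring
  have hR2 : 0 < R ^ 2 := by positivity
  rw [closure_prod_eq, Iminus, closure_Ioo (by nlinarith), closure_ball _ (by positivity)] at hcl
  have htime : Icc (t₀ - (2 * R) ^ 2) t₀ ⊆ Ioo 0 T := fun t ht =>
    (hcl (mk_mem_prod ht (mem_closedBall_self (by positivity)))).1
  have hN : NonnegSupersolution s Λ T Ω A K v Dv (t₀ - 4 * R ^ 2) t₀ (2 * R) x₀ :=
    { dim := by omega
      order := hs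
      ellip := hΛ
      field := hA
      kernel := hK
      reg := hreg
      super := hsup
      lt := by linarith
      radius_pos := by positivity
      time_subset := h4 ▸ htime
      space_subset := fun x hx =>
        (hcl (mk_mem_prod (right_mem_Icc.2 (by nlinarith)) hx)).2
      nonneg := by
        rw [← h4]
        exact hnn }
  have htail' := lintegral_tail_negPart_le hreg hs.1 hq (by positivity : 0 < 2 * R) htime
    (mul_pos hσ.1 hH) x₀ htail
  rw [h4] at htail'
  have hB : 0 < volume.real (ball x₀ R) :=
    ENNReal.toReal_pos (measure_ball_pos volume x₀ hR).ne' measure_ball_lt_top.ne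
  have hδR : (δ * R) ^ 2 ≤ R ^ 2 := by
    rw [mul_pow]
    exact mul_le_of_le_one_left hR2.le (pow_le_one₀ hδ.1.le hδ.2)
  have hcyl : volume (Iminus t₀ (δ * R) ×ˢ ball x₀ R) =
      ENNReal.ofReal ((δ * R) ^ 2 * volume.real (ball x₀ R)) := by
    rw [Measure.volume_eq_prod, Measure.prod_prod, Iminus, Real.volume_Ioo, sub_sub_cancel,
      ENNReal.ofReal_mul (by positivity), ofReal_measureReal measure_ball_lt_top.ne]
  rw [hcyl, ← ENNReal.ofReal_mul (by have := hα.1; have := hδ.1; positivity)]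
  refine measure_sublevel_le_of_truncated fun κ hκ => ?_
  set S := Ioo (t₀ - (δ * R) ^ 2) (t₀ - 2 * κ) with hS
  have hSδ : S ⊆ Iminus t₀ (δ * R) := fun t ht => ⟨ht.1, by linarith [ht.2]⟩
  set E : Set (ℝ × Ed d) := {p | p ∈ S ×ˢ ball x₀ R ∧ v p.1 p.2 ≤ σ * H / 4} with hE
  have hEle : volume E ≤ ENNReal.ofReal ((δ * R) ^ 2 * volume.real (ball x₀ R)) := by
    rw [← hcyl]
    exact measure_mono fun p hp => ⟨hSδ hp.1.1, hp.1.2⟩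
  have hEfin : volume E ≠ ⊤ := (hEle.trans_lt ENNReal.ofReal_lt_top).ne
  have hpairs := hmain hR hN hσ hH hκ measurableSet_Ioo
    (fun t ht => ⟨by linarith [ht.1], ht.2.le⟩ : S ⊆ Icc (t₀ - R ^ 2) (t₀ - 2 * κ)) htail'
  have hlow : ENNReal.ofReal α * volume (ball x₀ R) * volume E ≤
      ((volume.restrict (Ioc (t₀ - 4 * R ^ 2) t₀)).prod (volume.prod volume))
        (transitionPairs S x₀ R (σ * H / 4) (2 * H) v) := by
    refine le_measure_transitionPairs measurableSet_Ioo
      (fun t ht => ⟨by linarith [ht.1], by linarith [ht.2]⟩) hreg.meas ?_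
    rw [mul_div_cancel_left₀ H two_ne_zero]
    exact ae_restrict_of_ae_restrict_of_subset hSδ hdens
  have hlow' := ENNReal.toReal_mono
    (measure_transitionPairs_lt_top x₀ R (σ * H / 4) (2 * H) v S (t₀ - 4 * R ^ 2) t₀).ne hlow
  rw [ENNReal.toReal_mul, ENNReal.toReal_mul, ENNReal.toReal_ofReal hα.1.le] at hlow'
  rw [← ENNReal.ofReal_toReal hEfin]
  refine ENNReal.ofReal_le_ofReal (le_div_sqrt_logb_mul hα hδ hσ hR hB ENNReal.toReal_nonneg
    (ENNReal.toReal_le_of_le_ofReal (by positivity) hEle) ?_)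
  refine le_of_mul_le_mul_right ?_ hB
  have hℓ := one_le_log_eight_div hσ
  calc _ = α * volume.real (ball x₀ R) * (volume E).toReal * Real.log (8 / σ) := by ring
    _ ≤ _ := mul_le_mul_of_nonneg_right hlow' (by linarith)
    _ ≤ _ := hpairs
    _ = _ := by ring
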